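/- arXiv:2102.12977 — 3 statements merged into one kernel-verified Lean document; each statement's English description precedes it below -/
import Mathlib

section
/- The rational solutions (x, y) ∈ ℚ × ℚ of the equation y² = x(x² − 241²)(x² − 4·241²) are exactly the five points with y = 0, namely (0,0), (241,0), (−241,0), (482,0), (−482,0). In other words, the set of rational points of the genus 2 curve C_241 consists of only its six Weierstrass points, even though its Jacobian has Mordell–Weil rank 2 over ℚ. -/
/-- A positive natural number whose prime valuations are all even is a square. -/
theorem Nat.isSquare_of_even_padicValNat {n : ℕ} (hn : n ≠ 0)
    (h : ∀ q : ℕ, q.Prime → Even (padicValNat q n)) : IsSquare n := by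
  obtain ⟨a, b, ha, hb, hab, hsq⟩ := Nat.sq_mul_squarefree_of_pos (Nat.pos_of_ne_zero hn)
  suffices a = 1 by subst this; exact ⟨b, by rw [← hab]; ring⟩
  by_contra ha1
  obtain ⟨q, hq, hqa⟩ := Nat.exists_prime_and_dvd ha1
  have := Fact.mk hq
  have h1 := h q hq
  rw [← hab, padicValNat.mul (by positivity) (by positivity), padicValNat.pow] at h1
  have h2 : padicValNat q a = 1 := by
    have h3 : padicValNat q a ≤ 1 := by
      by_contra hc
      have := (padicValNat_dvd_iff_le (p := q) (a := a) (n := 2) (by positivity)).2 (by omega)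
      have h4 := hsq q (by rwa [← sq])
      exact hq.one_lt.ne' (Nat.isUnit_iff.1 h4)
    have h4 := one_le_padicValNat_of_dvd (p := q) (by positivity) hqa
    omega
  rw [h2] at h1
  revert h1
  rw [Nat.even_iff]; omega

theorem Rat.eq_sq_or_eq_neg_sq_of_even_padicValRat {r : ℚ} (hr : r ≠ 0)
    (h : ∀ q : ℕ, q.Prime → Even (padicValRat q r)) :
    ∃ s : ℚ, s ≠ 0 ∧ (r = s ^ 2 ∨ r = -s ^ 2) := by
  have hd : (r.den : ℚ) ≠ 0 := by exact_mod_cast r.den_nz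
  have hnum : r.num ≠ 0 := Rat.num_ne_zero.2 hr
  obtain ⟨m, hm⟩ : IsSquare (r.num.natAbs * r.den) := by
    apply Nat.isSquare_of_even_padicValNat (by simp [hr])
    intro q hq
    have := Fact.mk hq
    rw [padicValNat.mul (by simpa using hr) r.den_nz]
    have := h q hq
    rw [padicValRat, padicValInt] at this
    rw [Int.even_sub, Int.even_coe_nat, Int.even_coe_nat] at this
    rwa [Nat.even_add]
  have hm' : (|r.num| : ℚ) * r.den = m * m := by
    have := congrArg (Nat.cast : ℕ → ℚ) hm
    push_cast at this
    rwa [Nat.cast_natAbs, Int.cast_abs] at this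
  have hm0 : (m : ℚ) ≠ 0 := by
    rintro h0
    rw [h0] at hm'
    have : (r.num : ℚ) ≠ 0 := by exact_mod_cast hnum
    simp_all
  refine ⟨m / r.den, by positivity, ?_⟩
  have hr' : r = r.num / r.den := (Rat.num_div_den r).symm
  rcases abs_choice (r.num : ℚ) with h1 | h1 <;> rw [h1] at hm'
  · left
    rw [div_pow, eq_div_iff (by positivity)]
    nth_rw 1 [hr']
    field_simp
    linear_combination hm'
  · right
    rw [div_pow, ← neg_div, eq_div_iff (by positivity)]
    nth_rw 1 [hr']
    field_simp
    linear_combination -hm'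

/-- A nonzero rational number with even valuation away from `l` is, up to squares,
one of `1, -1, l, -l`. -/
theorem Rat.exists_eq_mul_sq_of_even_padicValRat {r : ℚ} (hr : r ≠ 0) {l : ℕ} (hl : l.Prime)
    (h : ∀ q : ℕ, q.Prime → q ≠ l → Even (padicValRat q r)) :
    ∃ s : ℚ, s ≠ 0 ∧ (r = 1 * s ^ 2 ∨ r = -1 * s ^ 2 ∨ r = l * s ^ 2 ∨ r = -l * s ^ 2) := by
  have := Fact.mk hl
  have hl0 : (l : ℚ) ≠ 0 := by exact_mod_cast hl.ne_zero
  by_cases he : Even (padicValRat l r)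
  · obtain ⟨s, hs, h1⟩ := Rat.eq_sq_or_eq_neg_sq_of_even_padicValRat hr (fun q hq => by
      rcases eq_or_ne q l with rfl | hql
      exacts [he, h q hq hql])
    exact ⟨s, hs, by rcases h1 with h1 | h1 <;> simp [h1]⟩
  · obtain ⟨s, hs, h1⟩ := Rat.eq_sq_or_eq_neg_sq_of_even_padicValRat (r := r * l)
      (mul_ne_zero hr hl0) (fun q hq => by
      have := Fact.mk hq
      rw [padicValRat.mul hr hl0]
      rcases eq_or_ne q l with rfl | hql
      · rw [padicValRat.self hl.one_lt]
        exact (Int.not_even_iff_odd.1 he).add_one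
      · have : padicValRat q (l : ℚ) = 0 := by
          rw [padicValRat.of_nat, padicValNat_primes hql, Nat.cast_zero]
        simpa [this] using h q hq hql)
    refine ⟨s / l, div_ne_zero hs hl0, ?_⟩
    rcases h1 with h1 | h1
    · right; right; left
      field_simp; linear_combination h1
    · right; right; right
      field_simp; linear_combination h1

theorem padicValRat_add_eq_neg_abs {q : ℕ} [Fact q.Prime] {x x' : ℚ} (hx : x ≠ 0) (hx' : x' ≠ 0)
    (hA : padicValRat q (x * x') = 0) (h0 : padicValRat q x ≠ 0) :
    x + x' ≠ 0 ∧ padicValRat q (x + x') = -|padicValRat q x| := by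
  rw [padicValRat.mul hx hx'] at hA
  have hs : x + x' ≠ 0 := by
    intro hs
    rw [eq_neg_of_add_eq_zero_right hs, padicValRat.neg] at hA
    omega
  refine ⟨hs, ?_⟩
  rw [padicValRat.add_eq_min hs hx hx' (by omega)]
  rcases abs_cases (padicValRat q x) with h | h <;> omega

theorem padicValRat_add_nonneg {q : ℕ} [Fact q.Prime] {x x' : ℚ}
    (hx : padicValRat q x = 0) (hx' : padicValRat q x' = 0) : 0 ≤ padicValRat q (x + x') := by
  by_cases h : x + x' = 0
  · simp [h]
  · have := padicValRat.min_le_padicValRat_add (p := q) h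
    omega

/-- If `x + x' = y + y'` and both `x * x'` and `y * y'` are `q`-adic units, then `x * y` has
even `q`-adic valuation. -/
theorem even_padicValRat_mul_of_add_eq_add {q : ℕ} (hq : q.Prime) {x x' y y' A B : ℚ}
    (hA : x * x' = A) (hB : y * y' = B) (hA0 : A ≠ 0) (hB0 : B ≠ 0)
    (hAq : padicValRat q A = 0) (hBq : padicValRat q B = 0) (h : x + x' = y + y') :
    Even (padicValRat q (x * y)) := by
  have := Fact.mk hq
  have hx := left_ne_zero_of_mul (hA ▸ hA0)
  have hx' := right_ne_zero_of_mul (hA ▸ hA0)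
  have hy := left_ne_zero_of_mul (hB ▸ hB0)
  have hy' := right_ne_zero_of_mul (hB ▸ hB0)
  rw [← hA] at hAq
  rw [← hB] at hBq
  have hA2 := hAq
  have hB2 := hBq
  rw [padicValRat.mul hx hx'] at hA2
  rw [padicValRat.mul hy hy'] at hB2
  rw [padicValRat.mul hx hy]
  by_cases h1 : padicValRat q x = 0 <;> by_cases h2 : padicValRat q y = 0
  · simp [h1, h2]
  · have := (padicValRat_add_eq_neg_abs hy hy' hBq h2).2
    have h3 := padicValRat_add_nonneg (q := q) h1 (x' := x') (by omega)
    rw [h, this] at h3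
    have := abs_pos.2 h2
    omega
  · have := (padicValRat_add_eq_neg_abs hx hx' hAq h1).2
    have h3 := padicValRat_add_nonneg (q := q) h2 (x' := y') (by omega)
    rw [← h, this] at h3
    have := abs_pos.2 h1
    omega
  · have h3 := (padicValRat_add_eq_neg_abs hy hy' hBq h2).2
    have h4 := (padicValRat_add_eq_neg_abs hx hx' hAq h1).2
    rw [h, h3] at h4
    rcases abs_cases (padicValRat q x) with h | h <;>
    rcases abs_cases (padicValRat q y) with h' | h' <;> rw [Int.even_iff] <;> omega

theorem Rat.exists_int_eq_of_sq_eq {r : ℚ} {m : ℤ} (h : r ^ 2 = m) : ∃ n : ℤ, r = n := by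
  have h1 : (r ^ 2).den = 1 := by rw [h]; rfl
  rw [Rat.den_pow] at h1
  have h2 : r.den = 1 := by simpa using h1
  exact ⟨r.num, (Rat.den_eq_one_iff r).1 h2 |>.symm⟩

/-- Clearing denominators in a pair of equations `c z² + e = y²`, `c' z² + e' = x²`. -/
theorem Rat.exists_coprime_of_sq_eq {x y z : ℚ} {c e c' e' : ℤ}
    (hy : y ^ 2 = c * z ^ 2 + e) (hx : x ^ 2 = c' * z ^ 2 + e') :
    ∃ Y X Z : ℤ, IsCoprime Z (z.den : ℤ) ∧ z = Z / z.den ∧ y = Y / z.den ∧ x = X / z.den ∧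
      Y ^ 2 = c * Z ^ 2 + e * (z.den : ℤ) ^ 2 ∧ X ^ 2 = c' * Z ^ 2 + e' * (z.den : ℤ) ^ 2 := by
  have hd : (z.den : ℚ) ≠ 0 := by exact_mod_cast z.den_nz
  have hz : z = z.num / z.den := (Rat.num_div_den z).symm
  have key : ∀ {w : ℚ} {c e : ℤ}, w ^ 2 = c * z ^ 2 + e →
      (w * z.den) ^ 2 = ((c * z.num ^ 2 + e * (z.den : ℤ) ^ 2 : ℤ) : ℚ) := by
    intro w c e hw
    rw [mul_pow, hw]
    push_cast
    nth_rw 1 [hz]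
    field_simp
  obtain ⟨Y, hY⟩ := Rat.exists_int_eq_of_sq_eq (key hy)
  obtain ⟨X, hX⟩ := Rat.exists_int_eq_of_sq_eq (key hx)
  refine ⟨Y, X, z.num, ?_, hz, ?_, ?_, ?_, ?_⟩
  · rw [Int.isCoprime_iff_nat_coprime]; exact z.reduced
  · rw [← hY]; field_simp
  · rw [← hX]; field_simp
  · have := key hy
    rw [hY] at this
    exact_mod_cast this
  · have := key hx
    rw [hX] at this
    exact_mod_cast this

/-- Infinite descent for the curve `u² = t² + a`, `v² = t² + b`: if every rational point has
even denominator and is the double of a rational point, then there are no rational points. -/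
theorem no_rational_point_of_halving {a b : ℤ}
    (heven : ∀ T U V N : ℤ, IsCoprime T N → U ^ 2 = T ^ 2 + a * N ^ 2 →
      V ^ 2 = T ^ 2 + b * N ^ 2 → Even N)
    (hhalf : ∀ t u v : ℚ, u ^ 2 = t ^ 2 + a → v ^ 2 = t ^ 2 + b →
      ∃ z x y : ℚ, x ^ 2 = z ^ 2 + a ∧ y ^ 2 = z ^ 2 + b ∧
        (2 * x * y * z * t) ^ 2 = (z ^ 4 - a * b) ^ 2)
    {t u v : ℚ} (hu : u ^ 2 = t ^ 2 + a) (hv : v ^ 2 = t ^ 2 + b) : False := by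
  have hden : ∀ {t u v : ℚ}, u ^ 2 = t ^ 2 + a → v ^ 2 = t ^ 2 + b → 2 ∣ t.den := by
    intro t u v hu hv
    obtain ⟨U, V, T, hc, -, -, -, h1, h2⟩ :=
      Rat.exists_coprime_of_sq_eq (c := 1) (c' := 1) (by simpa using hu) (by simpa using hv)
    have := heven T U V t.den hc (by simpa using h1) (by simpa using h2)
    rw [Int.even_coe_nat] at this
    exact this.two_dvd
  have main : ∀ k : ℕ, ∀ t u v : ℚ, u ^ 2 = t ^ 2 + a → v ^ 2 = t ^ 2 + b → 2 ^ k ∣ t.den := by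
    intro k
    induction k with
    | zero => simp
    | succ k ih =>
      intro t u v hu hv
      obtain ⟨z, x, y, hx, hy, ht⟩ := hhalf t u v hu hv
      have hB := ih z x y hx hy
      have hBeven := hden hx hy
      obtain ⟨X, Y, Z, hc, hz, hx', hy', -, -⟩ :=
        Rat.exists_coprime_of_sq_eq (c := 1) (c' := 1) (by simpa using hx) (by simpa using hy)
      have hZ : ¬ (2 : ℤ) ∣ Z := by
        intro h2
        have := hc.isUnit_of_dvd' h2 (by exact_mod_cast hBeven)
        exact absurd this (by decide)
      have hZ4 : IsCoprime ((2 : ℤ) ^ (k + 1)) (Z ^ 4 - a * b * (z.den : ℤ) ^ 4) := by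
        apply IsCoprime.pow_left
        rw [Int.prime_two.coprime_iff_not_dvd]
        intro h
        apply hZ
        have h3 : (2 : ℤ) ∣ (z.den : ℤ) := by exact_mod_cast hBeven
        have : (2 : ℤ) ∣ Z ^ 4 := by
          have := h.add ((h3.pow (n := 4) (by norm_num)).mul_left (a * b))
          simpa using this
        exact Int.prime_two.dvd_of_dvd_pow this
      have hd : (z.den : ℚ) ≠ 0 := by exact_mod_cast z.den_nz
      have hd' : (t.den : ℚ) ≠ 0 := by exact_mod_cast t.den_nz
      have ht' : t = t.num / t.den := (Rat.num_div_den t).symm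
      have hkey : (2 * X * Y * Z * z.den * t.num) ^ 2 =
          (t.den * (Z ^ 4 - a * b * (z.den : ℤ) ^ 4)) ^ 2 := by
        generalize hn : t.num = n at *
        generalize hD : t.den = D at *
        generalize hB' : z.den = B at *
        subst hz hx' hy' ht'
        field_simp at ht
        have : (2 * X * Y * Z * B * n : ℚ) ^ 2 = (D * (Z ^ 4 - a * b * (B : ℚ) ^ 4)) ^ 2 := by
          linear_combination ht
        exact_mod_cast this
      have hdvd : (2 : ℤ) ^ (k + 1) ∣ t.den * (Z ^ 4 - a * b * (z.den : ℤ) ^ 4) := by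
        rw [← Int.pow_dvd_pow_iff two_ne_zero, ← hkey, Int.pow_dvd_pow_iff two_ne_zero]
        have h3 : (2 : ℤ) ^ k ∣ (z.den : ℤ) := by exact_mod_cast hB
        obtain ⟨w, hw⟩ := h3
        exact ⟨X * Y * Z * w * t.num, by rw [hw]; ring⟩
      exact_mod_cast hZ4.dvd_of_dvd_mul_right hdvd
  have h := main t.den t u v hu hv
  exact absurd (Nat.le_of_dvd t.pos h) (not_le.2 Nat.lt_two_pow_self)

theorem two_covering_of_sq_eq {a b t u v x y c₁ c₂ : ℚ} (hc₁ : c₁ ≠ 0) (hc₂ : c₂ ≠ 0)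
    (hu : u ^ 2 = t ^ 2 + a) (hv : v ^ 2 = t ^ 2 + b) (huv : v + u ≠ 0)
    (h₁ : (u + t) * (v + u) = c₁ * x ^ 2) (h₂ : (v + t) * (v + u) = c₂ * y ^ 2) :
    ∃ z : ℚ, c₁ * c₂ * z ^ 2 = (u + t) * (v + t) ∧
      y ^ 2 = c₁ * z ^ 2 + b / c₂ ∧ x ^ 2 = c₂ * z ^ 2 + a / c₁ := by
  have hz : c₁ * c₂ * (x * y / (v + u)) ^ 2 = (u + t) * (v + t) := by
    field_simp
    linear_combination (-(v + t) * (v + u)) * h₁ - c₁ * x ^ 2 * h₂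
  refine ⟨x * y / (v + u), hz, ?_, ?_⟩
  · generalize x * y / (v + u) = z at hz
    field_simp
    linear_combination -h₂ + hv - hz
  · generalize x * y / (v + u) = z at hz
    field_simp
    linear_combination -h₁ + hu - hz

theorem halving_of_sq_eq {a b t u v x y : ℚ}
    (hu : u ^ 2 = t ^ 2 + a) (hv : v ^ 2 = t ^ 2 + b) (huv : v + u ≠ 0)
    (h₁ : (u + t) * (v + u) = x ^ 2) (h₂ : (v + t) * (v + u) = y ^ 2) :
    ∃ z x y : ℚ, x ^ 2 = z ^ 2 + a ∧ y ^ 2 = z ^ 2 + b ∧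
      (2 * x * y * z * t) ^ 2 = (z ^ 4 - a * b) ^ 2 := by
  obtain ⟨z, hz, hy, hx⟩ := two_covering_of_sq_eq one_ne_zero one_ne_zero hu hv huv
    (by simpa using h₁) (by simpa using h₂)
  simp only [one_mul, div_one] at hz hy hx
  refine ⟨z, x, y, hx, hy, ?_⟩
  have h4 : z ^ 4 - a * b = 2 * (u + t) * (v + t) * (v + u) * t / 1 := by
    have : z ^ 4 = ((u + t) * (v + t)) ^ 2 := by rw [← hz]; ring
    rw [this]
    have ha : a = u ^ 2 - t ^ 2 := by linear_combination -hu
    have hb : b = v ^ 2 - t ^ 2 := by linear_combination -hv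
    rw [ha, hb]; ring
  rw [h4]
  have : (2 * x * y * z * t) ^ 2 = 4 * t ^ 2 * x ^ 2 * y ^ 2 * z ^ 2 := by ring
  rw [this, hz, ← h₁, ← h₂]; ring

theorem exists_coprime_two_covering {a b t u v x y : ℚ} {c₁ c₂ : ℤ} (e e' : ℤ) (hc₁ : c₁ ≠ 0)
    (hc₂ : c₂ ≠ 0) (hu : u ^ 2 = t ^ 2 + a) (hv : v ^ 2 = t ^ 2 + b) (huv : v + u ≠ 0)
    (h₁ : (u + t) * (v + u) = c₁ * x ^ 2) (h₂ : (v + t) * (v + u) = c₂ * y ^ 2)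
    (hb : c₂ * e = b) (ha : c₁ * e' = a) :
    ∃ Y X Z N : ℤ, 0 < N ∧ IsCoprime Z N ∧
      Y ^ 2 = c₁ * Z ^ 2 + e * N ^ 2 ∧ X ^ 2 = c₂ * Z ^ 2 + e' * N ^ 2 := by
  have hc₁' : (c₁ : ℚ) ≠ 0 := by exact_mod_cast hc₁
  have hc₂' : (c₂ : ℚ) ≠ 0 := by exact_mod_cast hc₂
  obtain ⟨z, -, hy, hx⟩ := two_covering_of_sq_eq hc₁' hc₂' hu hv huv h₁ h₂
  obtain ⟨Y, X, Z, hc, -, -, -, hY, hX⟩ := Rat.exists_coprime_of_sq_eq (x := x)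
    (y := y) (z := z) (c := c₁) (c' := c₂)
    (e := e) (e' := e') (by rw [hy, ← hb]; field_simp) (by rw [hx, ← ha]; field_simp)
  exact ⟨Y, X, Z, z.den, by exact_mod_cast z.pos, hc, hY, hX⟩

theorem padicValRat_intCast_eq_zero_of_dvd_pow {q m k : ℕ} {n : ℤ} (hq : q.Prime) (hm : ¬ q ∣ m)
    (hn : n ∣ (m : ℤ) ^ k) : padicValRat q (n : ℚ) = 0 := by
  rw [padicValRat.of_int, padicValInt.eq_zero_of_not_dvd, Nat.cast_zero]
  intro h
  have h' : (q : ℤ) ∣ ((m ^ k : ℕ) : ℤ) := by push_cast; exact h.trans hn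
  exact hm (hq.dvd_of_dvd_pow (Int.natCast_dvd_natCast.1 h'))

theorem sq_ne_of_coprime_of_zmod_nine {c e : ℤ}
    (h : ∀ x z n : ZMod 9, x ^ 2 = c * z ^ 2 + e * n ^ 2 → 3 * z = 0 ∧ 3 * n = 0)
    {X Z N : ℤ} (hc : IsCoprime Z N) : X ^ 2 ≠ c * Z ^ 2 + e * N ^ 2 := by
  intro hX
  have key : ∀ w : ℤ, 3 * (w : ZMod 9) = 0 → (3 : ℤ) ∣ w := by
    intro w hw
    have : ((3 * w : ℤ) : ZMod 9) = 0 := by exact_mod_cast hw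
    rw [ZMod.intCast_zmod_eq_zero_iff_dvd] at this
    omega
  obtain ⟨hZ, hN⟩ := h X Z N (by exact_mod_cast congrArg (Int.cast : ℤ → ZMod 9) hX)
  exact absurd (hc.isUnit_of_dvd' (key Z hZ) (key N hN)) (by decide)

theorem no_rational_point_neg_one_neg_nine {t u v : ℚ} (hu : u ^ 2 = t ^ 2 - 1)
    (hv : v ^ 2 = t ^ 2 - 9) : False := by
  refine no_rational_point_of_halving (a := -1) (b := -9) (t := t) (u := u) (v := v) ?_ ?_
    (by push_cast; linarith) (by push_cast; linarith)
  · intro T U V N _ h1 h2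
    by_contra hN
    obtain ⟨n, rfl⟩ := Int.not_even_iff_odd.1 hN
    obtain ⟨k, rfl | rfl⟩ := Int.even_or_odd' U <;> obtain ⟨m, rfl | rfl⟩ := Int.even_or_odd' T <;>
      obtain ⟨l, rfl | rfl⟩ := Int.even_or_odd' V <;> ring_nf at h1 h2 <;> try omega
    have hm := Int.even_mul_succ_self m
    have hn := Int.even_mul_succ_self n
    rw [Int.even_iff] at hm hn
    ring_nf at hm hn
    obtain ⟨j, rfl | rfl⟩ := Int.even_or_odd' k <;> obtain ⟨i, rfl | rfl⟩ := Int.even_or_odd' l <;>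
      ring_nf at h1 h2 <;> omega
  clear hu hv t u v
  push_cast
  have core : ∀ t u v : ℚ, u ^ 2 = t ^ 2 + -1 → v ^ 2 = t ^ 2 + -9 →
      Even (padicValRat 2 ((u + t) * (v + u))) → 0 < (u + t) * (v + u) →
      ∃ z x y : ℚ, x ^ 2 = z ^ 2 + -1 ∧ y ^ 2 = z ^ 2 + -9 ∧
        (2 * x * y * z * t) ^ 2 = (z ^ 4 - -1 * -9) ^ 2 := by
    intro t u v hu hv h2 hpos
    have hα : (u + t) * (u - t) = (-1 : ℤ) := by push_cast; linear_combination hu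
    have hβ : (v + t) * (v - t) = (-9 : ℤ) := by push_cast; linear_combination hv
    have hγ : (v + u) * (v - u) = (-8 : ℤ) := by push_cast; linear_combination hv - hu
    have hα0 : u + t ≠ 0 := by rintro h; norm_num [h] at hα
    have hβ0 : v + t ≠ 0 := by rintro h; norm_num [h] at hβ
    have hγ0 : v + u ≠ 0 := by rintro h; norm_num [h] at hγ
    obtain ⟨x, -, hx⟩ := Rat.eq_sq_or_eq_neg_sq_of_even_padicValRat (mul_ne_zero hα0 hγ0) (by
      intro q hq
      rcases eq_or_ne q 2 with rfl | hq2
      · exact h2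
      have hq2' := (Nat.prime_dvd_prime_iff_eq hq Nat.prime_two).not.2 hq2
      exact even_padicValRat_mul_of_add_eq_add hq hα (y' := u - v) (B := (8 : ℤ))
        (by push_cast at hγ ⊢; linear_combination -hγ) (by norm_num) (by norm_num)
        (padicValRat_intCast_eq_zero_of_dvd_pow (k := 0) hq hq2' (by norm_num))
        (padicValRat_intCast_eq_zero_of_dvd_pow (k := 3) hq hq2' (by norm_num)) (by ring))
    replace hx : (u + t) * (v + u) = x ^ 2 := by
      refine hx.resolve_right fun h => ?_
      have := sq_nonneg x
      linarith
    obtain ⟨y, -, hy⟩ := Rat.exists_eq_mul_sq_of_even_padicValRat (mul_ne_zero hβ0 hγ0)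
      Nat.prime_three (by
      intro q hq hq3
      have hq3' := (Nat.prime_dvd_prime_iff_eq hq Nat.prime_three).not.2 hq3
      rcases eq_or_ne q 2 with rfl | hq2
      · have hαβ : Even (padicValRat 2 ((u + t) * (v + t))) :=
          even_padicValRat_mul_of_add_eq_add hq (x' := t - u) (y' := t - v) (A := (1 : ℤ))
            (B := (9 : ℤ)) (by push_cast at hα ⊢; linear_combination -hα)
            (by push_cast at hβ ⊢; linear_combination -hβ) (by norm_num) (by norm_num)
            (padicValRat_intCast_eq_zero_of_dvd_pow (k := 0) hq hq3' (by norm_num))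
            (padicValRat_intCast_eq_zero_of_dvd_pow (k := 2) hq hq3' (by norm_num)) (by ring)
        have := Fact.mk hq
        rw [padicValRat.mul hα0 hγ0] at h2
        rw [padicValRat.mul hα0 hβ0] at hαβ
        rw [padicValRat.mul hβ0 hγ0]
        rw [Int.even_iff] at *
        omega
      · have hq2' := (Nat.prime_dvd_prime_iff_eq hq Nat.prime_two).not.2 hq2
        exact even_padicValRat_mul_of_add_eq_add hq hβ hγ (by norm_num) (by norm_num)
          (padicValRat_intCast_eq_zero_of_dvd_pow (k := 2) hq hq3' (by norm_num))
          (padicValRat_intCast_eq_zero_of_dvd_pow (k := 3) hq hq2' (by norm_num)) (by ring))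
    have hcov := fun (c e e' : ℤ) hc =>
      exists_coprime_two_covering (x := x) (y := y) (c₁ := 1) (c₂ := c) e e' one_ne_zero hc hu hv
        hγ0 (by simpa using hx)
    rcases hy with hy | hy | hy | hy
    · exact halving_of_sq_eq hu hv hγ0 hx (by simpa using hy)
    · obtain ⟨Y, X, Z, N, hN, -, -, h⟩ :=
        hcov (-1) 9 (-1) (by norm_num) (by simpa using hy) (by norm_num) (by norm_num)
      nlinarith [sq_nonneg X, sq_nonneg Z]
    · obtain ⟨Y, X, Z, N, -, hc, -, h⟩ :=
        hcov 3 (-3) (-1) (by norm_num) (by simpa using hy) (by norm_num) (by norm_num)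
      exact absurd h (sq_ne_of_coprime_of_zmod_nine (by decide +kernel) hc)
    · obtain ⟨Y, X, Z, N, hN, -, -, h⟩ :=
        hcov (-3) 3 (-1) (by norm_num) (by simpa using hy) (by norm_num) (by norm_num)
      nlinarith [sq_nonneg X, sq_nonneg Z]
  have core' : ∀ t u v : ℚ, u ^ 2 = t ^ 2 + -1 → v ^ 2 = t ^ 2 + -9 →
      Even (padicValRat 2 ((u + t) * (v + u))) →
      ∃ z x y : ℚ, x ^ 2 = z ^ 2 + -1 ∧ y ^ 2 = z ^ 2 + -9 ∧
        (2 * x * y * z * t) ^ 2 = (z ^ 4 - -1 * -9) ^ 2 := by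
    intro t u v hu hv h2
    have hα : (u + t) * (u + -t) = -1 := by linear_combination hu
    have hγ : (v + u) * (v - u) = -8 := by linear_combination hv - hu
    have hα0 : u + t ≠ 0 := by rintro h; norm_num [h] at hα
    have hα0' : u + -t ≠ 0 := by rintro h; norm_num [h] at hα
    have hγ0 : v + u ≠ 0 := by rintro h; norm_num [h] at hγ
    rcases lt_or_gt_of_ne (mul_ne_zero hα0 hγ0) with h | h
    · obtain ⟨z, x, y, h1, h2, h3⟩ := core (-t) u v (by simpa using hu) (by simpa using hv) (by
        have := congrArg (padicValRat 2) hα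
        rw [padicValRat.mul hα0 hα0', padicValRat.neg, padicValRat.one] at this
        rw [padicValRat.mul hα0 hγ0] at h2
        rw [padicValRat.mul hα0' hγ0]
        rw [Int.even_iff] at *
        omega) (by
        have : 0 < (u + t) ^ 2 := by positivity
        have h4 : (u + t) ^ 2 * ((u + -t) * (v + u)) = -((u + t) * (v + u)) := by
          linear_combination (u + t) * (v + u) * hα
        nlinarith)
      exact ⟨z, x, y, h1, h2, by rw [← h3]; ring⟩
    · exact core t u v hu hv h2 h
  intro t u v hu hv
  by_cases h2 : Even (padicValRat 2 ((u + t) * (v + u)))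
  · exact core' t u v hu hv h2
  · have hα : (u + t) * (-u + t) = 1 := by linear_combination -hu
    have hγ : (v + u) * (v + -u) = -((2 : ℕ) : ℚ) ^ 3 := by push_cast; linear_combination hv - hu
    have hα0 : u + t ≠ 0 := by rintro h; norm_num [h] at hα
    have hα0' : -u + t ≠ 0 := by rintro h; norm_num [h] at hα
    have hγ0 : v + u ≠ 0 := by rintro h; norm_num [h] at hγ
    have hγ0' : v + -u ≠ 0 := by rintro h; norm_num [h] at hγ
    refine core' t (-u) v (by simpa using hu) hv ?_
    have h3 := congrArg (padicValRat 2) hα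
    have h4 := congrArg (padicValRat 2) hγ
    rw [padicValRat.mul hα0 hα0', padicValRat.one] at h3
    rw [padicValRat.mul hγ0 hγ0', padicValRat.neg, padicValRat.pow,
      padicValRat.self one_lt_two] at h4
    rw [padicValRat.mul hα0 hγ0] at h2
    rw [padicValRat.mul hα0' hγ0']
    rw [Int.even_iff] at *
    omega

/-- Euler: four rational squares in arithmetic progression are equal. -/
theorem four_rat_squares_in_arithmetic_progression {x y z w d : ℚ} (hy : y ^ 2 = x ^ 2 + d)
    (hz : z ^ 2 = x ^ 2 + 2 * d) (hw : w ^ 2 = x ^ 2 + 3 * d) : d = 0 := by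
  by_contra hd
  refine no_rational_point_neg_one_neg_nine (t := (2 * x ^ 2 + 3 * d) / d) (u := 2 * (y * z) / d)
    (v := 2 * (x * w) / d) ?_ ?_
  · rw [div_pow, mul_pow, mul_pow, hy, hz]
    field_simp
    ring
  · rw [div_pow, mul_pow, mul_pow, hw]
    field_simp
    ring

instance fact_prime_241 : Fact (Nat.Prime 241) := ⟨by norm_num⟩

theorem ZMod.isSquare_intCast_of_primes {n : ℤ}
    (h : ∀ q : ℕ, q.Prime → (q : ℤ) ∣ n → IsSquare (q : ZMod 241)) : IsSquare (n : ZMod 241) := by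
  have key : ∀ m : ℕ, (∀ q : ℕ, q.Prime → q ∣ m → IsSquare (q : ZMod 241)) →
      IsSquare (m : ZMod 241) := by
    intro m
    induction m using induction_on_primes with
    | zero => simp
    | one => simp
    | prime_mul p a hp ih =>
      intro hm
      rw [Nat.cast_mul]
      exact (hm p hp (dvd_mul_right p a)).mul (ih fun q hq hqa => hm q hq (hqa.mul_left p))
  have h1 := key n.natAbs fun q hq hqn => h q hq (Int.natCast_dvd.2 hqn)
  rcases Int.natAbs_eq n with hn | hn <;> rw [hn]
  · rwa [Int.cast_natCast]
  · have h2 : IsSquare (-1 : ZMod 241) := ⟨64, by decide⟩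
    have := h2.mul h1
    rw [neg_one_mul] at this
    rwa [Int.cast_neg, Int.cast_natCast]

/-- Quadratic reciprocity: a prime dividing `241 N² - X²` but not `N` is a square modulo `241`. -/
theorem ZMod.isSquare_prime_of_dvd_sub_sq {q : ℕ} (hq : q.Prime) {X Y N : ℤ}
    (hYN : IsCoprime Y N) (hqY : (q : ℤ) ∣ Y) (h : Y ∣ 241 * N ^ 2 - X ^ 2) :
    IsSquare (q : ZMod 241) := by
  have := Fact.mk hq
  rcases eq_or_ne q 2 with rfl | hq2
  · exact ⟨22, by decide⟩
  rw [ZMod.exists_sq_eq_prime_iff_of_mod_four_eq_one (p := 241) (by norm_num) hq2]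
  have hN : (N : ZMod q) ≠ 0 := by
    rw [Ne, ZMod.intCast_zmod_eq_zero_iff_dvd]
    intro hqN
    exact (Nat.prime_iff_prime_int.1 hq).not_isUnit (hYN.isUnit_of_dvd' hqY hqN)
  have h1 : ((241 * N ^ 2 - X ^ 2 : ℤ) : ZMod q) = 0 :=
    (ZMod.intCast_zmod_eq_zero_iff_dvd _ _).2 (hqY.trans h)
  push_cast at h1
  refine ⟨X / N, ?_⟩
  push_cast
  field_simp
  linear_combination h1

/-- If `241 N² = X² + e Y²` with `Y`, `N` coprime, then every divisor `L` of `k Y²` is a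
square modulo `241`, and so is `L / Y`, provided the prime factors of `k` are squares. -/
theorem isSquare_of_mul_eq_mul_sq {Y X N L L' k e : ℤ} (h : 241 * N ^ 2 = X ^ 2 + e * Y ^ 2)
    (hYN : IsCoprime Y N)
    (hk : ∀ q : ℕ, q.Prime → (q : ℤ) ∣ k → IsSquare (q : ZMod 241))
    (hL : L * L' = k * Y ^ 2) {c : ZMod 241} (hc : (L : ZMod 241) = c * Y) : IsSquare c := by
  have hY : ∀ q : ℕ, q.Prime → (q : ℤ) ∣ Y → IsSquare (q : ZMod 241) := fun q hq hqY =>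
    ZMod.isSquare_prime_of_dvd_sub_sq hq hYN hqY (X := X) ⟨e * Y, by rw [h]; ring⟩
  have hL' : ∀ q : ℕ, q.Prime → (q : ℤ) ∣ L → IsSquare (q : ZMod 241) := fun q hq hqL => by
    have hq' := Nat.prime_iff_prime_int.1 hq
    rcases hq'.dvd_or_dvd (hL ▸ hqL.mul_right L') with h1 | h1
    · exact hk q hq h1
    · exact hY q hq (hq'.dvd_of_dvd_pow h1)
  have hY0 : (Y : ZMod 241) ≠ 0 := by
    have hp : Prime (241 : ℤ) := by norm_num
    rw [Ne, ZMod.intCast_zmod_eq_zero_iff_dvd]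
    intro hpY
    push_cast at hpY
    obtain ⟨Z, rfl⟩ := hpY
    obtain ⟨W, rfl⟩ : (241 : ℤ) ∣ X := hp.dvd_of_dvd_pow (n := 2)
      ⟨N ^ 2 - 241 * e * Z ^ 2, by linear_combination -h⟩
    have : (241 : ℤ) ∣ N := hp.dvd_of_dvd_pow (n := 2)
      ⟨W ^ 2 + e * Z ^ 2, by linarith⟩
    exact hp.not_isUnit (hYN.isUnit_of_dvd' (dvd_mul_right _ _) this)
  have hdiv : c = L / Y := by rw [hc, mul_div_cancel_right₀ _ hY0]
  rw [hdiv]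
  exact (ZMod.isSquare_intCast_of_primes hL').div (ZMod.isSquare_intCast_of_primes hY)

theorem IsCoprime.of_sq_add_mul_sq {p X Y N e : ℤ} (h : p * N ^ 2 = X ^ 2 + e * Y ^ 2)
    (hXN : IsCoprime X N) : IsCoprime Y N := by
  have h1 : IsCoprime (p * N ^ 2 - X ^ 2) N := by
    have : p * N ^ 2 - X ^ 2 = -X ^ 2 + N * (p * N) := by ring
    rw [this]
    exact (hXN.pow_left.neg_left).add_mul_left_left _
  have h2 : p * N ^ 2 - X ^ 2 = e * Y * Y := by rw [h]; ring
  rw [h2] at h1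
  exact h1.of_mul_left_right

theorem primes_dvd_isSquare_of_dvd_six {k : ℤ} (hk : k ∣ 6) (q : ℕ) (hq : q.Prime)
    (hqk : (q : ℤ) ∣ k) : IsSquare (q : ZMod 241) := by
  have h6 : q ∣ 2 * 3 := by exact_mod_cast hqk.trans hk
  rcases hq.dvd_mul.1 h6 with h | h
  · rw [(Nat.prime_dvd_prime_iff_eq hq Nat.prime_two).1 h]; exact ⟨22, by decide⟩
  · rw [(Nat.prime_dvd_prime_iff_eq hq Nat.prime_three).1 h]; exact ⟨56, by decide⟩

theorem ZMod.eq_or_eq_of_sq_eq {A Y r w : ℤ} (h : A ^ 2 = r ^ 2 * Y ^ 2 + 241 * w) :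
    (A : ZMod 241) = r * Y ∨ (A : ZMod 241) = -r * Y := by
  have h1 : (A : ZMod 241) ^ 2 = (r * Y) ^ 2 := by
    have := congrArg (Int.cast : ℤ → ZMod 241) h
    push_cast at this
    have h0 : (241 : ZMod 241) = 0 := by decide
    rw [this, h0]; ring
  rw [neg_mul]
  exact sq_eq_sq_iff_eq_or_eq_neg.1 h1

/-- If `241 N² = X² + e Y²` and `(A - B) (A + B) = k Y²` with `A ≡ ± r Y` and `B ≡ ± s Y`
modulo `241`, then one of `± r ± s` is a square modulo `241`. -/
theorem false_of_not_isSquare {Y X N A B e : ℤ} (k r s wA wB : ℤ)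
    (h : 241 * N ^ 2 = X ^ 2 + e * Y ^ 2) (hYN : IsCoprime Y N) (hk : k ∣ 6)
    (hL : A ^ 2 - B ^ 2 = k * Y ^ 2) (hA : A ^ 2 = r ^ 2 * Y ^ 2 + 241 * wA)
    (hB : B ^ 2 = s ^ 2 * Y ^ 2 + 241 * wB)
    (hS : ∀ c ∈ [(r : ZMod 241) - s, r - -s, -r - s, -r - -s], ¬ IsSquare c) : False := by
  suffices ∃ c ∈ [(r : ZMod 241) - s, r - -s, -r - s, -r - -s], ((A - B : ℤ) : ZMod 241) = c * Y by
    obtain ⟨c, hcS, hc⟩ := this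
    exact hS c hcS (isSquare_of_mul_eq_mul_sq h hYN (primes_dvd_isSquare_of_dvd_six hk)
      (L' := A + B) (by linear_combination hL) hc)
  rw [Int.cast_sub]
  rcases ZMod.eq_or_eq_of_sq_eq hA with h1 | h1 <;>
    rcases ZMod.eq_or_eq_of_sq_eq hB with h2 | h2 <;> rw [h1, h2] <;>
    exact ⟨_, by simp, (sub_mul _ _ _).symm⟩

section

variable {Y X Z N : ℤ}

theorem covering_two_three (hc : IsCoprime Z N) (hY : Y ^ 2 = 2 * Z ^ 2 + 241 * N ^ 2)
    (hX : X ^ 2 = 3 * Z ^ 2 + 241 * N ^ 2) : False :=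
  false_of_not_isSquare 1 56 22 (N ^ 2 - 13 * Z ^ 2) (N ^ 2 - 2 * Z ^ 2)
    (Y := Z) (X := Y) (N := N) (A := X) (B := Y) (e := -2)
    (by linear_combination -hY) hc (by norm_num) (by linear_combination hX - hY)
    (by linear_combination hX) (by linear_combination hY) (by decide +kernel)

theorem covering_neg_two_one (hc : IsCoprime Z N) (hY : Y ^ 2 = -2 * Z ^ 2 + 723 * N ^ 2)
    (hX : X ^ 2 = 1 * Z ^ 2 + -241 * N ^ 2) : False :=
  have h : 241 * N ^ 2 = Z ^ 2 + -1 * X ^ 2 := by linear_combination hX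
  false_of_not_isSquare 3 1 38 (N ^ 2) (N ^ 2 - 6 * X ^ 2) (A := Z) (B := Y)
    h (hc.of_sq_add_mul_sq h) (by norm_num) (by linear_combination -3 * hX - hY)
    (by linear_combination -hX) (by linear_combination hY + 2 * hX) (by decide +kernel)

theorem covering_neg_one_three (hc : IsCoprime Z N) (hY : Y ^ 2 = -1 * Z ^ 2 + 241 * N ^ 2)
    (hX : X ^ 2 = 3 * Z ^ 2 + -482 * N ^ 2) : False :=
  have h : 241 * N ^ 2 = Z ^ 2 + 1 * Y ^ 2 := by linear_combination -hY
  false_of_not_isSquare 2 64 31 (N ^ 2 - 17 * Y ^ 2) (N ^ 2 - 4 * Y ^ 2) (A := Z) (B := X)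
    h (hc.of_sq_add_mul_sq h) (by norm_num) (by linear_combination -2 * hY - hX)
    (by linear_combination hY) (by linear_combination hX + 3 * hY) (by decide +kernel)

theorem covering_one_three (hc : IsCoprime Z N) (hY : Y ^ 2 = 1 * Z ^ 2 + -241 * N ^ 2)
    (hX : X ^ 2 = 3 * Z ^ 2 + -482 * N ^ 2) : False :=
  have h : 241 * N ^ 2 = Z ^ 2 + -1 * Y ^ 2 := by linear_combination hY
  false_of_not_isSquare 2 56 1 (N ^ 2 - 13 * Y ^ 2) (N ^ 2) (A := X) (B := Z)
    h (hc.of_sq_add_mul_sq h) (by norm_num) (by linear_combination hX - 2 * hY)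
    (by linear_combination hX - 3 * hY) (by linear_combination -hY) (by decide +kernel)

theorem covering_neg_two_neg_one (hc : IsCoprime Z N) (hY : Y ^ 2 = -2 * Z ^ 2 + 723 * N ^ 2)
    (hX : X ^ 2 = -1 * Z ^ 2 + 241 * N ^ 2) : False :=
  have h : 241 * N ^ 2 = Z ^ 2 + 1 * X ^ 2 := by linear_combination -hX
  false_of_not_isSquare 3 22 64 (N ^ 2 - 2 * X ^ 2) (N ^ 2 - 17 * X ^ 2) (A := Y) (B := Z)
    h (hc.of_sq_add_mul_sq h) (by norm_num) (by linear_combination hY - 3 * hX)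
    (by linear_combination hY - 2 * hX) (by linear_combination hX) (by decide +kernel)

theorem covering_neg_two_neg_three (hc : IsCoprime Z N) (hY : Y ^ 2 = -2 * Z ^ 2 + 241 * N ^ 2)
    (hX : X ^ 2 = -3 * Z ^ 2 + 241 * N ^ 2) : False :=
  false_of_not_isSquare 1 38 31 (N ^ 2 - 6 * Z ^ 2) (N ^ 2 - 4 * Z ^ 2)
    (Y := Z) (X := Y) (N := N) (A := Y) (B := X) (e := 2)
    (by linear_combination -hY) hc (by norm_num) (by linear_combination hY - hX)
    (by linear_combination hY) (by linear_combination hX) (by decide +kernel)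

end

theorem padicValRat_add_of_lt {q : ℕ} [Fact q.Prime] {x y : ℚ} (hx : x ≠ 0) (hy : y ≠ 0)
    (h : padicValRat q x < padicValRat q y) : padicValRat q (x + y) = padicValRat q x := by
  refine padicValRat.add_eq_of_lt (fun hs => h.ne ?_) hx hy h
  rw [eq_neg_of_add_eq_zero_right hs, padicValRat.neg]

theorem exists_sq_eq_padicValRat_add_le (q : ℕ) (u t : ℚ) :
    ∃ u' : ℚ, u' ^ 2 = u ^ 2 ∧ padicValRat q (u' + t) ≤ padicValRat q (u' - t) := by
  rcases le_total (padicValRat q (u + t)) (padicValRat q (u - t)) with h | h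
  · exact ⟨u, rfl, h⟩
  · refine ⟨-u, by ring, ?_⟩
    rwa [show -u + t = -(u - t) by ring, show -u - t = -(u + t) by ring, padicValRat.neg,
      padicValRat.neg]

/-- The possible square classes of a point on `u² = t² + 2 ε 241`, `v² = t² + 3 ε 241`, after
changing the signs of `u` and `v`. -/
theorem square_classes_of_sq_eq {ε : ℤ} (hε : ε ∣ 1) {t u v : ℚ}
    (hu : u ^ 2 = t ^ 2 + (241 * (2 * ε) : ℤ)) (hv : v ^ 2 = t ^ 2 + (241 * (3 * ε) : ℤ)) :
    ∃ u' v' x y : ℚ, u' ^ 2 = u ^ 2 ∧ v' ^ 2 = v ^ 2 ∧ v' + u' ≠ 0 ∧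
      (∃ c : ℤ, (c = 1 ∨ c = -1 ∨ c = 2 ∨ c = -2) ∧ (u' + t) * (v' + u') = c * x ^ 2) ∧
      ∃ c : ℤ, (c = 1 ∨ c = -1 ∨ c = 3 ∨ c = -3) ∧ (v' + t) * (v' + u') = c * y ^ 2 := by
  have hε0 : ε ≠ 0 := by rintro rfl; norm_num at hε
  obtain ⟨u', hu', hα1⟩ := exists_sq_eq_padicValRat_add_le 241 u t
  obtain ⟨v', hv', hβ1⟩ := exists_sq_eq_padicValRat_add_le 241 v t
  refine ⟨u', v', ?_⟩
  rw [← hu'] at hu ⊢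
  rw [← hv'] at hv ⊢
  clear hu' hv' u v
  have hα : (u' + t) * (u' - t) = (241 * (2 * ε) : ℤ) := by rw [← sub_eq_iff_eq_add'.2 hu]; ring
  have hβ : (v' + t) * (v' - t) = (241 * (3 * ε) : ℤ) := by rw [← sub_eq_iff_eq_add'.2 hv]; ring
  have hγ : (v' + u') * (v' - u') = (241 * ε : ℤ) := by
    push_cast at hα hβ ⊢
    linear_combination hβ - hα
  have hA0 : ((241 * (2 * ε) : ℤ) : ℚ) ≠ 0 := by exact_mod_cast (by omega)
  have hB0 : ((241 * (3 * ε) : ℤ) : ℚ) ≠ 0 := by exact_mod_cast (by omega)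
  have hC0 : ((241 * ε : ℤ) : ℚ) ≠ 0 := by exact_mod_cast (by omega)
  have hα0 := left_ne_zero_of_mul (hα.symm ▸ hA0)
  have hα0' := right_ne_zero_of_mul (hα.symm ▸ hA0)
  have hβ0 := left_ne_zero_of_mul (hβ.symm ▸ hB0)
  have hβ0' := right_ne_zero_of_mul (hβ.symm ▸ hB0)
  have hγ0 := left_ne_zero_of_mul (hγ.symm ▸ hC0)
  have hval : ∀ n : ℤ, n ≠ 0 → n ∣ 6 → padicValRat 241 ((241 * n : ℤ) : ℚ) = 1 := by
    intro n hn hk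
    have := padicValRat_intCast_eq_zero_of_dvd_pow (q := 241) (m := 6) (k := 1) (n := n)
      (by norm_num) (by norm_num) (by simpa using hk)
    rw [Int.cast_mul, padicValRat.mul (by norm_num) (by exact_mod_cast hn), this]
    have := padicValRat.self (p := 241) (by norm_num)
    simpa using this
  have hvα : padicValRat 241 (u' + t) + padicValRat 241 (u' - t) = 1 := by
    rw [← padicValRat.mul hα0 hα0', hα]
    exact hval _ (by omega) ((mul_dvd_mul_left 2 hε).trans (by norm_num))
  have hvβ : padicValRat 241 (v' + t) + padicValRat 241 (v' - t) = 1 := by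
    rw [← padicValRat.mul hβ0 hβ0', hβ]
    exact hval _ (by omega) ((mul_dvd_mul_left 3 hε).trans (by norm_num))
  have h2tα := padicValRat_add_of_lt (q := 241) hα0 (neg_ne_zero.2 hα0')
    (by rw [padicValRat.neg]; omega)
  have h2tβ := padicValRat_add_of_lt (q := 241) hβ0 (neg_ne_zero.2 hβ0')
    (by rw [padicValRat.neg]; omega)
  rw [show u' + t + -(u' - t) = v' + t + -(v' - t) by ring, h2tβ] at h2tα
  have hvγ := padicValRat_add_of_lt (q := 241) hα0 hβ0' (by omega)
  rw [show u' + t + (v' - t) = v' + u' by ring] at hvγ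
  have hdvd : ∀ {q l : ℕ} {n : ℤ}, q.Prime → l.Prime → q ≠ l → q ≠ 241 → n ∣ l * ε →
      padicValRat q ((241 * n : ℤ) : ℚ) = 0 := by
    intro q l n hq hl hql hq241 hn
    refine padicValRat_intCast_eq_zero_of_dvd_pow (k := 1) (m := 241 * l) hq ?_ ?_
    · rw [hq.dvd_mul, Nat.prime_dvd_prime_iff_eq hq (by norm_num), Nat.prime_dvd_prime_iff_eq hq hl]
      tauto
    · rw [pow_one, Nat.cast_mul]
      exact mul_dvd_mul_left _ (hn.trans (by simpa using mul_dvd_mul_left (l : ℤ) hε))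
  obtain ⟨x, -, hx⟩ := Rat.exists_eq_mul_sq_of_even_padicValRat (mul_ne_zero hα0 hγ0)
    Nat.prime_two (by
    intro q hq hq2
    rcases eq_or_ne q 241 with rfl | hqp
    · rw [padicValRat.mul hα0 hγ0, hvγ]
      exact ⟨_, rfl⟩
    · refine even_padicValRat_mul_of_add_eq_add hq hα (y' := u' - v') (B := (241 * -ε : ℤ))
        (by push_cast at hγ ⊢; linear_combination -hγ) hA0 (by simpa using hC0) ?_ ?_ (by ring)
      · exact hdvd hq Nat.prime_two hq2 hqp (dvd_refl _)
      · exact hdvd hq Nat.prime_two hq2 hqp (by simp))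
  obtain ⟨y, -, hy⟩ := Rat.exists_eq_mul_sq_of_even_padicValRat (mul_ne_zero hβ0 hγ0)
    Nat.prime_three (by
    intro q hq hq2
    rcases eq_or_ne q 241 with rfl | hqp
    · rw [padicValRat.mul hβ0 hγ0, hvγ, h2tα]
      exact ⟨_, rfl⟩
    · refine even_padicValRat_mul_of_add_eq_add hq hβ hγ hB0 hC0 ?_ ?_ (by ring)
      · exact hdvd hq Nat.prime_three hq2 hqp (dvd_refl _)
      · exact hdvd hq Nat.prime_three hq2 hqp (by simp))
  refine ⟨x, y, rfl, rfl, hγ0, ?_, ?_⟩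
  · rcases hx with h | h | h | h
    exacts [⟨1, by simp, by simpa using h⟩, ⟨-1, by simp, by simpa using h⟩,
      ⟨2, by simp, by simpa using h⟩, ⟨-2, by simp, by simpa using h⟩]
  · rcases hy with h | h | h | h
    exacts [⟨1, by simp, by simpa using h⟩, ⟨-1, by simp, by simpa using h⟩,
      ⟨3, by simp, by simpa using h⟩, ⟨-3, by simp, by simpa using h⟩]

theorem no_rational_point_of_square_classes {ε : ℤ} (hε : ε ∣ 1)
    (h : ∀ Y X Z N c₁ c₂ : ℤ, (c₁ = 1 ∨ c₁ = -1 ∨ c₁ = 2 ∨ c₁ = -2) →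
      (c₂ = 1 ∨ c₂ = -1 ∨ c₂ = 3 ∨ c₂ = -3) → (c₁ ≠ 1 ∨ c₂ ≠ 1) → 0 < N → IsCoprime Z N →
      Y ^ 2 = c₁ * Z ^ 2 + 241 * (3 * ε) / c₂ * N ^ 2 →
      X ^ 2 = c₂ * Z ^ 2 + 241 * (2 * ε) / c₁ * N ^ 2 → False) {t u v : ℚ}
    (hu : u ^ 2 = t ^ 2 + (241 * (2 * ε) : ℤ)) (hv : v ^ 2 = t ^ 2 + (241 * (3 * ε) : ℤ)) :
    False := by
  refine no_rational_point_of_halving ?_ ?_ hu hv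
  · intro T U V N _ h1 _
    by_contra hN
    obtain ⟨n, rfl⟩ := Int.not_even_iff_odd.1 hN
    rcases Int.isUnit_iff.1 (isUnit_of_dvd_one hε) with rfl | rfl <;>
    obtain ⟨k, rfl | rfl⟩ := Int.even_or_odd' U <;> obtain ⟨m, rfl | rfl⟩ := Int.even_or_odd' T <;>
      ring_nf at h1 <;> omega
  · intro t u v hu hv
    obtain ⟨u', v', x, y, hu', hv', huv, ⟨c₁, hc₁, h₁⟩, ⟨c₂, hc₂, h₂⟩⟩ :=
      square_classes_of_sq_eq hε hu hv
    rw [← hu'] at hu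
    rw [← hv'] at hv
    by_cases hc : c₁ = 1 ∧ c₂ = 1
    · obtain ⟨rfl, rfl⟩ := hc
      exact halving_of_sq_eq hu hv huv (by simpa using h₁) (by simpa using h₂)
    · have hd₁ : c₁ ∣ 2 := by rcases hc₁ with rfl | rfl | rfl | rfl <;> norm_num
      have hd₂ : c₂ ∣ 3 := by rcases hc₂ with rfl | rfl | rfl | rfl <;> norm_num
      obtain ⟨Y, X, Z, N, hN, hcop, hY, hX⟩ := exists_coprime_two_covering
        (241 * (3 * ε) / c₂) (241 * (2 * ε) / c₁) (by omega) (by omega) hu hv huv h₁ h₂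
        (by exact_mod_cast Int.mul_ediv_cancel' ((hd₂.mul_right ε).mul_left 241))
        (by exact_mod_cast Int.mul_ediv_cancel' ((hd₁.mul_right ε).mul_left 241))
      exact (h Y X Z N c₁ c₂ hc₁ hc₂ (not_and_or.1 hc) hN hcop hY hX).elim

theorem no_rational_point_pos {t u v : ℚ} (hu : u ^ 2 = t ^ 2 + 482) (hv : v ^ 2 = t ^ 2 + 723) :
    False := by
  refine no_rational_point_of_square_classes (ε := 1) (dvd_refl _) ?_ (t := t) (u := u) (v := v)
    (by norm_num [hu]) (by norm_num [hv])
  rintro Y X Z N c₁ c₂ (rfl | rfl | rfl | rfl) (rfl | rfl | rfl | rfl) h hN hc hY hX <;>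
  first
  | omega
  | exact covering_two_three hc hY hX
  | exact covering_neg_two_one hc hY hX
  | exact covering_neg_one_three hc hY hX
  | norm_num at hY hX; nlinarith [sq_nonneg X, sq_nonneg Y, sq_nonneg Z, pow_pos hN 2]
  | exact sq_ne_of_coprime_of_zmod_nine (by decide +kernel) hc hX
  | exact sq_ne_of_coprime_of_zmod_nine (by decide +kernel) hc hY

theorem no_rational_point_neg {t u v : ℚ} (hu : u ^ 2 = t ^ 2 - 482) (hv : v ^ 2 = t ^ 2 - 723) :
    False := by
  refine no_rational_point_of_square_classes (ε := -1) (by norm_num) ?_ (t := t) (u := u) (v := v)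
    (by push_cast; linarith) (by push_cast; linarith)
  rintro Y X Z N c₁ c₂ (rfl | rfl | rfl | rfl) (rfl | rfl | rfl | rfl) h hN hc hY hX <;>
  first
  | omega
  | exact covering_one_three hc hY hX
  | exact covering_neg_two_neg_one hc hY hX
  | exact covering_neg_two_neg_three hc hY hX
  | norm_num at hY hX; nlinarith [sq_nonneg X, sq_nonneg Y, sq_nonneg Z, pow_pos hN 2]
  | exact sq_ne_of_coprime_of_zmod_nine (by decide +kernel) hc hX
  | exact sq_ne_of_coprime_of_zmod_nine (by decide +kernel) hc hY

/-- Coefficients of the six linear forms `a, b, a - b, a + b, a - 2b, a + 2b`. -/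
def formCoeff : Fin 6 → ℤ × ℤ := ![(1, 0), (0, 1), (1, -1), (1, 1), (1, -2), (1, 2)]

def linForm (i : Fin 6) (a b : ℤ) : ℤ := (formCoeff i).1 * a + (formCoeff i).2 * b

def formDet (i j : Fin 6) : ℤ :=
  (formCoeff i).1 * (formCoeff j).2 - (formCoeff i).2 * (formCoeff j).1

/-- Whether `D i * linForm i a b` are all squares modulo `m` for some `a`, `b` not both divisible
by `q`, where the bits of `mask` mark the squares modulo `m`. -/
def hasLocalPoint (q m mask : ℕ) (D : Fin 6 → ℤ) : Bool :=
  (List.range m).any fun a => (List.range m).any fun b =>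
    !(a % q == 0 && b % q == 0) &&
      (List.finRange 6).all fun i => mask.testBit (D i * linForm i a b % m).toNat

/-- The square class with sign `σ` and parities `x`, `y`, `z` of its valuations at 2, 3, 241. -/
def squareClass (σ : Fin 6 → ℤ) (x y z : Fin 6 → ZMod 2) (i : Fin 6) : ℤ :=
  σ i * (2 ^ (x i).val * 3 ^ (y i).val * 241 ^ (z i).val)

/-- The possible signs of the six forms when `b` and their product are positive. -/
def signVectors : List (Fin 6 → ℤ) :=
  [![-1, 1, -1, -1, -1, 1], ![1, 1, -1, 1, -1, 1], ![1, 1, 1, 1, 1, 1]]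

/-- Square classes of the six Weierstrass points, in the order `∞, 0, 1, 2, -1, -2`. -/
def weierstrassClasses : List (Fin 6 → ℤ) :=
  [![1, 241, 1, 1, 1, 1], ![241, 1, -1, 1, -2, 2], ![1, 1, -1446, 2, -1, 3],
    ![2, 1, 1, 3, 1446, 1], ![-1, 1, -2, -1446, -3, 1], ![-2, 1, -3, -1, -1, 1446]]

def twoVectors : List (Fin 6 → ZMod 2) :=
  [![0, 0, 0, 0, 0, 0], ![0, 0, 0, 0, 1, 1], ![0, 0, 1, 1, 0, 0], ![1, 0, 0, 0, 0, 1],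
    ![1, 0, 0, 0, 1, 0]]

def threeVectors : List (Fin 6 → ZMod 2) :=
  [![0, 0, 0, 0, 0, 0], ![0, 0, 0, 1, 1, 0], ![0, 0, 1, 0, 0, 1]]

def unitVectors : List (Fin 6 → ZMod 2) :=
  (List.finRange 6).map fun k => Pi.single k 1

theorem mem_twoVectors : ∀ x : Fin 6 → ZMod 2, ∑ i, x i = 0 →
    (∀ i j, i ≠ j → x i ≠ 0 → x j ≠ 0 → ((2 : ℕ) : ℤ) ∣ formDet i j) → x ∈ twoVectors := by
  decide +kernel

theorem mem_threeVectors : ∀ x : Fin 6 → ZMod 2, ∑ i, x i = 0 →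
    (∀ i j, i ≠ j → x i ≠ 0 → x j ≠ 0 → ((3 : ℕ) : ℤ) ∣ formDet i j) → x ∈ threeVectors := by
  decide +kernel

theorem mem_unitVectors : ∀ x : Fin 6 → ZMod 2, ∑ i, x i = 1 →
    (∀ i j, i ≠ j → x i ≠ 0 → x j ≠ 0 → ((241 : ℕ) : ℤ) ∣ formDet i j) → x ∈ unitVectors := by
  decide +kernel

theorem mem_weierstrassClasses_of_hasLocalPoint : ∀ σ ∈ signVectors, ∀ x ∈ twoVectors,
    ∀ y ∈ threeVectors, ∀ z ∈ unitVectors,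
      (∀ p ∈ [(3, 9, 147), (7, 7, 23), (11, 11, 571), (13, 13, 5659), (17, 17, 107287)],
        hasLocalPoint p.1 p.2.1 p.2.2 (squareClass σ x y z) = true) →
      squareClass σ x y z ∈ weierstrassClasses := by
  decide +kernel

theorem hasLocalPoint_of_sq {q m mask : ℕ} {D w : Fin 6 → ℤ} {a b : ℤ} (hm : 0 < m) (hqm : q ∣ m)
    (hmask : ∀ s < m, mask.testBit (s * s % m) = true)
    (hab : ¬ ((q : ℤ) ∣ a ∧ (q : ℤ) ∣ b)) (hw : ∀ i, D i * linForm i a b = w i ^ 2) :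
    hasLocalPoint q m mask D = true := by
  have hm' : (m : ℤ) ≠ 0 := by positivity
  have hcast (c : ℤ) : ((c % m).toNat : ℤ) = c % m := Int.toNat_of_nonneg (Int.emod_nonneg _ hm')
  have hlt (c : ℤ) : (c % m).toNat < m := by
    have := Int.emod_lt_of_pos c (show (0 : ℤ) < m by positivity)
    have := hcast c
    omega
  have hmod (c : ℤ) : c % m ≡ c [ZMOD m] := Int.mod_modEq c m
  have hdvd (c : ℤ) (h : q ∣ (c % m).toNat) : (q : ℤ) ∣ c := by
    have h1 : (q : ℤ) ∣ c % m := by rw [← hcast]; exact_mod_cast h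
    exact (Int.dvd_iff_dvd_of_dvd_sub ((Int.natCast_dvd_natCast.2 hqm).trans
      (hmod c).symm.dvd)).1 h1
  simp only [hasLocalPoint, List.any_eq_true, List.mem_range, Bool.and_eq_true, List.all_eq_true]
  refine ⟨_, hlt a, _, hlt b, ?_, fun i _ => ?_⟩
  · simp only [Bool.not_eq_true', Bool.and_eq_false_iff, beq_eq_false_iff_ne, ne_eq,
      ← Nat.dvd_iff_mod_eq_zero]
    by_contra! hc
    exact hab ⟨hdvd a hc.1, hdvd b hc.2⟩
  · have h1 : D i * linForm i ((a % m).toNat : ℤ) ((b % m).toNat : ℤ) ≡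
        (w i % m) * (w i % m) [ZMOD m] := by
      rw [hcast, hcast]
      calc D i * linForm i (a % m) (b % m) ≡ D i * linForm i a b [ZMOD m] :=
            (((hmod a).mul_left _).add ((hmod b).mul_left _)).mul_left _
        _ = w i * w i := by rw [hw, sq]
        _ ≡ _ [ZMOD m] := ((hmod _).mul (hmod _)).symm
    have h2 : (D i * linForm i ((a % m).toNat : ℤ) ((b % m).toNat : ℤ) % m).toNat =
        (w i % m).toNat * (w i % m).toNat % m := by
      rw [h1.eq, ← hcast (w i)]
      norm_cast
    rw [h2]
    exact hmask _ (hlt _)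

theorem exists_squareClass_mul_eq_sq {n : ℤ} (hn : n ≠ 0)
    (h : ∀ q : ℕ, q.Prime → q ≠ 2 → q ≠ 3 → q ≠ 241 → Even (padicValInt q n)) :
    ∃ w : ℤ, n.sign * (2 ^ (padicValInt 2 n : ZMod 2).val * 3 ^ (padicValInt 3 n : ZMod 2).val *
      241 ^ (padicValInt 241 n : ZMod 2).val) * n = w ^ 2 := by
  have hn' : n.natAbs ≠ 0 := by simpa using hn
  obtain ⟨w, hw⟩ := Nat.isSquare_of_even_padicValNat
    (n := 2 ^ (padicValInt 2 n % 2) * 3 ^ (padicValInt 3 n % 2) * 241 ^ (padicValInt 241 n % 2) *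
      n.natAbs) (by positivity) (by
    intro q hq
    have := Fact.mk hq
    rw [padicValNat.mul (by positivity) hn', padicValNat.mul (by positivity) (by positivity),
      padicValNat.mul (by positivity) (by positivity), padicValNat.pow, padicValNat.pow,
      padicValNat.pow, Nat.even_iff]
    by_cases h2 : q = 2
    · subst h2
      rw [padicValNat_self, padicValNat_primes (by norm_num), padicValNat_primes (by norm_num)]
      simp only [padicValInt]
      omega
    by_cases h3 : q = 3
    · subst h3
      rw [padicValNat_self, padicValNat_primes (by norm_num), padicValNat_primes (by norm_num)]
      simp only [padicValInt]
      omega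
    by_cases h241 : q = 241
    · subst h241
      rw [padicValNat_self, padicValNat_primes (by norm_num), padicValNat_primes (by norm_num)]
      simp only [padicValInt]
      omega
    rw [padicValNat_primes h2, padicValNat_primes h3, padicValNat_primes h241]
    simpa [Nat.even_iff, padicValInt] using h q hq h2 h3 h241)
  refine ⟨w, ?_⟩
  simp only [ZMod.val_natCast]
  rw [mul_right_comm, Int.sign_mul_self_eq_abs, Int.abs_eq_natAbs, mul_comm, sq]
  exact_mod_cast hw

theorem sum_padicValInt_linForm {q : ℕ} [Fact q.Prime] {a b w : ℤ}
    (h0 : ∀ i, linForm i a b ≠ 0) (hw : 241 * w ^ 2 = ∏ i, linForm i a b) :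
    ∑ i, (padicValInt q (linForm i a b) : ZMod 2) = (padicValInt q 241 : ZMod 2) := by
  have hw0 : w ≠ 0 := by
    rintro rfl
    exact Finset.prod_ne_zero_iff.2 (fun i _ => h0 i) (by rw [← hw]; norm_num)
  have hprod (s : Finset (Fin 6)) :
      padicValInt q (∏ i ∈ s, linForm i a b) = ∑ i ∈ s, padicValInt q (linForm i a b) := by
    induction s using Finset.induction_on with
    | empty => simp
    | insert i s hi ih =>
      rw [Finset.prod_insert hi, Finset.sum_insert hi,
        padicValInt.mul (h0 i) (Finset.prod_ne_zero_iff.2 fun i _ => h0 i), ih]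
  have h := hprod Finset.univ
  rw [← hw, padicValInt.mul (by norm_num) (by positivity), sq, padicValInt.mul hw0 hw0] at h
  rw [← Nat.cast_sum, ← h]
  push_cast
  rw [CharTwo.add_self_eq_zero, add_zero]

theorem dvd_formDet_of_dvd_linForm {a b : ℤ} (hab : IsCoprime a b) {n : ℤ} {i j : Fin 6}
    (hi : n ∣ linForm i a b) (hj : n ∣ linForm j a b) : n ∣ formDet i j := by
  obtain ⟨u, v, huv⟩ := hab
  have : formDet i j = linForm i a b * (u * (formCoeff j).2 - v * (formCoeff j).1) +
      linForm j a b * (v * (formCoeff i).1 - u * (formCoeff i).2) := by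
    rw [formDet, linForm, linForm]
    linear_combination -((formCoeff i).1 * (formCoeff j).2 - (formCoeff i).2 * (formCoeff j).1) *
      huv
  rw [this]
  exact dvd_add (hi.mul_right _) (hj.mul_right _)

theorem formDet_dvd_twelve : ∀ i j, i ≠ j → formDet i j ∣ 12 := by decide +kernel

theorem eq_zero_of_sum_eq_zero : ∀ x : Fin 6 → ZMod 2, ∑ i, x i = 0 →
    (∀ i j, i ≠ j → x i ≠ 0 → x j = 0) → x = 0 := by
  decide +kernel

theorem sign_linForm_mem_signVectors {a b w : ℤ} (hb : 0 < b) (h0 : ∀ i, linForm i a b ≠ 0)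
    (hw : 241 * w ^ 2 = ∏ i, linForm i a b) :
    (fun i => (linForm i a b).sign) ∈ signVectors := by
  have hw0 : w ≠ 0 := by
    rintro rfl
    exact Finset.prod_ne_zero_iff.2 (fun i _ => h0 i) (by rw [← hw]; norm_num)
  have hpos : (∏ i, linForm i a b).sign = 1 := by
    rw [← hw]
    exact Int.sign_eq_one_of_pos (by positivity)
  have hfun : (fun i => (linForm i a b).sign) =
      ![a.sign, b.sign, (a - b).sign, (a + b).sign, (a - 2 * b).sign, (a + 2 * b).sign] := by
    ext i
    fin_cases i <;> simp [linForm, formCoeff, sub_eq_add_neg]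
  have h1 : a ≠ 0 := by simpa [linForm, formCoeff] using h0 0
  have h2 : a - b ≠ 0 := by simpa [linForm, formCoeff, sub_eq_add_neg] using h0 2
  have h3 : a + b ≠ 0 := by simpa [linForm, formCoeff] using h0 3
  have h4 : a - 2 * b ≠ 0 := by simpa [linForm, formCoeff, sub_eq_add_neg] using h0 4
  have h5 : a + 2 * b ≠ 0 := by simpa [linForm, formCoeff] using h0 5
  have hprod : a.sign * (a - b).sign * (a + b).sign * (a - 2 * b).sign * (a + 2 * b).sign = 1 := by
    simpa [Fin.prod_univ_six, Int.sign_mul, linForm, formCoeff, sub_eq_add_neg,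
      Int.sign_eq_one_of_pos hb] using hpos
  rw [hfun, Int.sign_eq_one_of_pos hb]
  rcases h1.lt_or_gt with h1 | h1 <;> rcases h2.lt_or_gt with h2 | h2 <;>
    rcases h3.lt_or_gt with h3 | h3 <;> rcases h4.lt_or_gt with h4 | h4 <;>
    rcases h5.lt_or_gt with h5 | h5 <;> first
    | omega
    | simp_all [signVectors, Int.sign_eq_neg_one_of_neg, Int.sign_eq_one_of_pos]

/-- The six forms at an integral point with nonzero values lie in the same square classes as at one
of the Weierstrass points. -/
theorem exists_weierstrassClass {a b w : ℤ} (hab : IsCoprime a b) (hb : 0 < b)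
    (h0 : ∀ i, linForm i a b ≠ 0) (hw : 241 * w ^ 2 = ∏ i, linForm i a b) :
    ∃ D ∈ weierstrassClasses, ∀ i, ∃ s : ℤ, D i * linForm i a b = s ^ 2 := by
  have hne (q : ℕ) (i : Fin 6) (h : (padicValInt q (linForm i a b) : ZMod 2) ≠ 0) :
      (q : ℤ) ∣ linForm i a b := by
    by_contra hc
    exact h (by rw [padicValInt.eq_zero_of_not_dvd hc, Nat.cast_zero])
  have hdet (q : ℕ) (i j : Fin 6) (_ : i ≠ j)
      (hi : (padicValInt q (linForm i a b) : ZMod 2) ≠ 0)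
      (hj : (padicValInt q (linForm j a b) : ZMod 2) ≠ 0) : (q : ℤ) ∣ formDet i j :=
    dvd_formDet_of_dvd_linForm hab (hne q i hi) (hne q j hj)
  have hval {q : ℕ} (hq : q.Prime) (hq' : q ≠ 241) : padicValInt q 241 = 0 :=
    padicValInt.eq_zero_of_not_dvd fun h => hq'
      ((Nat.prime_dvd_prime_iff_eq hq fact_prime_241.out).1 (by exact_mod_cast h))
  have heven (q : ℕ) (hq : q.Prime) (h2 : q ≠ 2) (h3 : q ≠ 3) (h241 : q ≠ 241) (i : Fin 6) :
      Even (padicValInt q (linForm i a b)) := by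
    have := Fact.mk hq
    refine ZMod.natCast_eq_zero_iff_even.1 (congrFun (eq_zero_of_sum_eq_zero
      (fun i => (padicValInt q (linForm i a b) : ZMod 2)) ?_ ?_) i)
    · rw [sum_padicValInt_linForm h0 hw, hval hq h241, Nat.cast_zero]
    · intro i j hij hi
      by_contra hj
      have h12 : q ∣ 2 ^ 2 * 3 := by
        exact_mod_cast (hdet q i j hij hi hj).trans (formDet_dvd_twelve i j hij)
      rcases hq.dvd_mul.1 h12 with h | h
      · exact h2 ((Nat.prime_dvd_prime_iff_eq hq Nat.prime_two).1 (hq.dvd_of_dvd_pow h))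
      · exact h3 ((Nat.prime_dvd_prime_iff_eq hq Nat.prime_three).1 h)
  choose s hs using fun i => exists_squareClass_mul_eq_sq (h0 i)
    fun q hq h2 h3 h241 => heven q hq h2 h3 h241 i
  refine ⟨_, mem_weierstrassClasses_of_hasLocalPoint _ (sign_linForm_mem_signVectors hb h0 hw)
    (fun i => (padicValInt 2 (linForm i a b) : ZMod 2)) (mem_twoVectors _ ?_ (hdet 2))
    (fun i => (padicValInt 3 (linForm i a b) : ZMod 2)) (mem_threeVectors _ ?_ (hdet 3))
    (fun i => (padicValInt 241 (linForm i a b) : ZMod 2)) (mem_unitVectors _ ?_ (hdet 241)) ?_,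
    fun i => ⟨s i, hs i⟩⟩
  · rw [sum_padicValInt_linForm h0 hw, hval Nat.prime_two (by norm_num), Nat.cast_zero]
  · rw [sum_padicValInt_linForm h0 hw, hval Nat.prime_three (by norm_num), Nat.cast_zero]
  · rw [sum_padicValInt_linForm h0 hw, ← Nat.cast_ofNat (R := ℤ), padicValInt.of_nat,
      padicValNat_self, Nat.cast_one]
  · have hcop {q : ℕ} (hq : q.Prime) : ¬ ((q : ℤ) ∣ a ∧ (q : ℤ) ∣ b) := fun h =>
      (Nat.prime_iff_prime_int.1 hq).not_isUnit (hab.isUnit_of_dvd' h.1 h.2)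
    simp only [List.forall_mem_cons]
    refine ⟨?_, ?_, ?_, ?_, ?_, by simp⟩
    · exact hasLocalPoint_of_sq (by norm_num) (by norm_num) (by decide)
        (hcop (by norm_num)) hs
    · exact hasLocalPoint_of_sq (by norm_num) (by norm_num) (by decide)
        (hcop (by norm_num)) hs
    · exact hasLocalPoint_of_sq (by norm_num) (by norm_num) (by decide)
        (hcop (by norm_num)) hs
    · exact hasLocalPoint_of_sq (by norm_num) (by norm_num) (by decide)
        (hcop (by norm_num)) hs
    · exact hasLocalPoint_of_sq (by norm_num) (by norm_num) (by decide)
        (hcop (by norm_num)) hs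

theorem prod_linForm_ne {a b w : ℤ} (hab : IsCoprime a b) (hb : 0 < b)
    (h0 : ∀ i, linForm i a b ≠ 0) : 241 * w ^ 2 ≠ ∏ i, linForm i a b := by
  intro hw
  obtain ⟨D, hD, hs⟩ := exists_weierstrassClass hab hb h0 hw
  choose s hs using hs
  have ha0 : (a : ℚ) ≠ 0 := by exact_mod_cast (by simpa [linForm, formCoeff] using h0 0 : a ≠ 0)
  have hb0 : (b : ℚ) ≠ 0 := by exact_mod_cast hb.ne'
  have h2 : (a : ℚ) - b ≠ 0 := by
    exact_mod_cast (by simpa [linForm, formCoeff, sub_eq_add_neg] using h0 2 : a - b ≠ 0)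
  have h3 : (a : ℚ) + b ≠ 0 := by
    exact_mod_cast (by simpa [linForm, formCoeff] using h0 3 : a + b ≠ 0)
  have h4 : (a : ℚ) - 2 * b ≠ 0 := by
    exact_mod_cast (by simpa [linForm, formCoeff, sub_eq_add_neg] using h0 4 : a - 2 * b ≠ 0)
  have h5 : (a : ℚ) + 2 * b ≠ 0 := by
    exact_mod_cast (by simpa [linForm, formCoeff] using h0 5 : a + 2 * b ≠ 0)
  have hs' (i : Fin 6) : (D i : ℚ) * linForm i a b = (s i : ℚ) ^ 2 := by exact_mod_cast hs i
  have e0 := hs' 0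
  have e1 := hs' 1
  have e2 := hs' 2
  have e3 := hs' 3
  have e4 := hs' 4
  have e5 := hs' 5
  simp only [weierstrassClasses, List.mem_cons, List.not_mem_nil, or_false] at hD
  rcases hD with rfl | rfl | rfl | rfl | rfl | rfl <;>
    simp [linForm, formCoeff] at e0 e1 e2 e3 e4 e5
  · exact hb0 (four_rat_squares_in_arithmetic_progression (x := s 4) (y := s 2) (z := s 0)
      (w := s 3) (by linarith) (by linarith) (by linarith))
  · have := four_rat_squares_in_arithmetic_progression (x := s 2) (y := s 4 / 2) (z := s 1)
      (w := s 5 / 2) (d := a / 2) (by linarith) (by linarith) (by linarith)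
    exact ha0 (by linarith)
  · have hn : (s 2 : ℚ) ≠ 0 := fun h => h2 (by rw [h] at e2; linarith)
    refine no_rational_point_neg (t := s 1 * 1446 / s 2) (u := s 5 / 3 * 1446 / s 2)
      (v := s 3 / 2 * 1446 / s 2) ?_ ?_ <;> field_simp <;> linarith
  · have hn : (s 4 : ℚ) ≠ 0 := fun h => h4 (by rw [h] at e4; linarith)
    refine no_rational_point_pos (t := s 1 * 1446 / s 4) (u := s 3 / 3 * 1446 / s 4)
      (v := s 0 / 2 * 1446 / s 4) ?_ ?_ <;> field_simp <;> linarith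
  · have hn : (s 3 : ℚ) ≠ 0 := fun h => h3 (by rw [h] at e3; linarith)
    refine no_rational_point_pos (t := s 1 * 1446 / s 3) (u := s 4 / 3 * 1446 / s 3)
      (v := s 2 / 2 * 1446 / s 3) ?_ ?_ <;> field_simp <;> linarith
  · have hn : (s 5 : ℚ) ≠ 0 := fun h => h5 (by rw [h] at e5; linarith)
    refine no_rational_point_neg (t := s 1 * 1446 / s 5) (u := s 2 / 3 * 1446 / s 5)
      (v := s 0 / 2 * 1446 / s 5) ?_ ?_ <;> field_simp <;> linarith

/-- The rational points of the genus 2 curve `C_241 : y² = x(x² − 241²)(x² − 4·241²)`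
are exactly its six Weierstrass points: the affine solutions are precisely the five
points with `y = 0`. -/
theorem rational_points_C241 (x y : ℚ) :
    y ^ 2 = x * (x ^ 2 - 241 ^ 2) * (x ^ 2 - 4 * 241 ^ 2) ↔
      y = 0 ∧ (x = 0 ∨ x = 241 ∨ x = -241 ∨ x = 482 ∨ x = -482) := by
  constructor
  · intro h
    have hy : y = 0 := by
      by_contra hy
      set X := x / 241 with hX
      have hb0 : (X.den : ℚ) ≠ 0 := by exact_mod_cast X.den_nz
      have hx : x = 241 * (X.num / X.den) := by rw [Rat.num_div_den, hX]; ring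
      have hprod : ∏ i, linForm i X.num X.den = X.num * X.den * (X.num - X.den) *
          (X.num + X.den) * (X.num - 2 * X.den) * (X.num + 2 * X.den) := by
        simp [Fin.prod_univ_six, linForm, formCoeff, sub_eq_add_neg]
      have key : 241 * (y / 241 ^ 3 * X.den ^ 3) ^ 2 =
          ((∏ i, linForm i X.num X.den : ℤ) : ℚ) := by
        rw [hprod]
        push_cast
        rw [mul_pow, div_pow, h, hx]
        field_simp
        ring
      obtain ⟨n, hn⟩ := Rat.exists_int_eq_of_sq_eq (r := 241 * (y / 241 ^ 3 * X.den ^ 3))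
        (m := 241 * ∏ i, linForm i X.num X.den) (by rw [Int.cast_mul, ← key]; push_cast; ring)
      have hn2 : n ^ 2 = 241 * ∏ i, linForm i X.num X.den := by
        have : (n : ℚ) ^ 2 = 241 * ((∏ i, linForm i X.num X.den : ℤ) : ℚ) := by
          rw [← hn, ← key]; ring
        exact_mod_cast this
      obtain ⟨w, rfl⟩ := (Nat.prime_iff_prime_int.1 fact_prime_241.out).dvd_of_dvd_pow
        (Dvd.intro _ hn2.symm)
      have hw : 241 * w ^ 2 = ∏ i, linForm i X.num X.den := by push_cast at hn2; linarith
      refine prod_linForm_ne (Int.isCoprime_iff_nat_coprime.2 X.reduced)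
        (by exact_mod_cast X.pos) (fun i hi => ?_) hw
      rw [Finset.prod_eq_zero (Finset.mem_univ i) hi] at key
      simp [hy] at key
    refine ⟨hy, ?_⟩
    have h' : x * ((x - 241) * ((x + 241) * ((x - 482) * (x + 482)))) = 0 := by
      rw [hy] at h
      linear_combination -h
    simpa only [mul_eq_zero, sub_eq_zero, add_eq_zero_iff_eq_neg] using h'
  · rintro ⟨rfl, rfl | rfl | rfl | rfl | rfl⟩ <;> norm_num
end

section
/- The rational solutions (x, y) ∈ ℚ × ℚ of the equation y² = x(x² − 25)(x² − 100) are exactly the five points with y = 0, namely (0,0), (5,0), (−5,0), (10,0), (−10,0), together with the two points (20, 1500) and (20, −1500). -/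
/-- Every integer which has even valuation at all primes other than `2, 3, 5` is, up to sign and a
square, a product of distinct primes among `2, 3, 5`. -/
lemma exists_eq_sign_mul_sq {n : ℤ} (hn : n ≠ 0)
    (h : ∀ p : ℕ, p.Prime → p ≠ 2 → p ≠ 3 → p ≠ 5 → padicValInt p n % 2 = 0) :
    ∃ s r : ℤ, (s = 1 ∨ s = -1) ∧ r ≠ 0 ∧
      n = s * 2 ^ (padicValInt 2 n % 2) * 3 ^ (padicValInt 3 n % 2) *
        5 ^ (padicValInt 5 n % 2) * r ^ 2 := by
  have hN : n.natAbs ≠ 0 := Int.natAbs_ne_zero.mpr hn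
  set N := n.natAbs with hNdef
  have hval : ∀ p, padicValInt p n = N.factorization p ∨ ¬ p.Prime := by
    intro p
    by_cases hp : p.Prime
    · left; simp [padicValInt, Nat.factorization_def _ hp, hNdef]
    · exact Or.inr hp
  have key : ∃ r : ℕ, N = 2 ^ (padicValInt 2 n % 2) * 3 ^ (padicValInt 3 n % 2) *
      5 ^ (padicValInt 5 n % 2) * r ^ 2 := by
    obtain ⟨b, a, hab, hb⟩ := Nat.sq_mul_squarefree N
    have hb0 : b ≠ 0 := hb.ne_zero
    have ha0 : a ≠ 0 := by rintro rfl; simp at hab; exact hN hab.symm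
    have hf : ∀ p, p.Prime → b.factorization p = padicValInt p n % 2 := by
      intro p hp
      have h1 : b.factorization p ≤ 1 := (Nat.squarefree_iff_factorization_le_one hb0).mp hb p
      have h2 : N.factorization p = 2 * a.factorization p + b.factorization p := by
        rw [← hab, Nat.factorization_mul (by positivity) hb0, Nat.factorization_pow]; simp
      rcases hval p with h3 | h3
      · omega
      · exact absurd hp h3
    refine ⟨a, ?_⟩
    rw [← hab, mul_comm]
    congr 1
    apply Nat.eq_of_factorization_eq hb0 (by positivity)
    intro p
    by_cases hp : p.Prime
    · rw [Nat.factorization_mul (by positivity) (by positivity),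
        Nat.factorization_mul (by positivity) (by positivity)]
      simp only [Nat.factorization_pow, Finsupp.add_apply, Finsupp.smul_apply, hf p hp]
      rw [Nat.prime_two.factorization, Nat.prime_three.factorization,
        Nat.prime_five.factorization]
      by_cases h2 : p = 2
      · subst h2; simp
      by_cases h3 : p = 3
      · subst h3; simp
      by_cases h5 : p = 5
      · subst h5; simp
      rw [h p hp h2 h3 h5]
      simp [Ne.symm h2, Ne.symm h3, Ne.symm h5]
    · simp [Nat.factorization_eq_zero_of_not_prime _ hp]
  obtain ⟨r, hr⟩ := key
  have hr0 : (r : ℤ) ≠ 0 := by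
    rintro h0
    have : r = 0 := by exact_mod_cast h0
    subst this
    simp at hr
    exact hN hr
  have hrz : (N : ℤ) = 2 ^ (padicValInt 2 n % 2) * 3 ^ (padicValInt 3 n % 2) *
      5 ^ (padicValInt 5 n % 2) * (r : ℤ) ^ 2 := by exact_mod_cast hr
  rcases Int.natAbs_eq n with h1 | h1
  · exact ⟨1, r, Or.inl rfl, hr0, by rw [one_mul, ← hrz]; exact h1⟩
  · refine ⟨-1, r, Or.inr rfl, hr0, ?_⟩
    calc n = -(N : ℤ) := h1
      _ = _ := by rw [hrz]; ring

lemma padicValInt_prod {ι : Type*} (s : Finset ι) (F : ι → ℤ) (hF : ∀ i, F i ≠ 0) (p : ℕ)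
    [Fact p.Prime] : padicValInt p (∏ i ∈ s, F i) = ∑ i ∈ s, padicValInt p (F i) := by
  classical
  induction s using Finset.induction_on with
  | empty => simp
  | insert a s ha ih =>
    rw [Finset.prod_insert ha, Finset.sum_insert ha,
      padicValInt.mul (hF a) (Finset.prod_ne_zero_iff.mpr fun i _ => hF i), ih]

/-- If a product of integers is a square up to the factor `k`, the valuations of the factors
add up to that of `k` modulo `2`. -/
lemma sum_padicValInt_parity {ι : Type*} [Fintype ι] {F : ι → ℤ} {k w : ℤ} (hF : ∀ i, F i ≠ 0)
    (hk : k ≠ 0) (h : (∏ i, F i) * k = w ^ 2) (p : ℕ) [Fact p.Prime] :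
    (∑ i, padicValInt p (F i)) % 2 = padicValInt p k % 2 := by
  have h0 : ∏ i, F i ≠ 0 := Finset.prod_ne_zero_iff.mpr fun i _ => hF i
  have hw : w ≠ 0 := by
    rintro rfl
    exact mul_ne_zero h0 hk (by simpa using h)
  have := congrArg (padicValInt p) h
  rw [padicValInt.mul h0 hk, padicValInt_prod _ _ hF, pow_two, padicValInt.mul hw hw] at this
  omega

lemma dvd_det_of_dvd {m n d α β γ δ : ℤ} (hc : IsCoprime m n) (h₁ : d ∣ α * m + β * n)
    (h₂ : d ∣ γ * m + δ * n) : d ∣ α * δ - β * γ := by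
  obtain ⟨u, v, huv⟩ := hc
  have : α * δ - β * γ = (u * δ - v * γ) * (α * m + β * n) + (v * α - u * β) * (γ * m + δ * n) := by
    linear_combination (-(α * δ - β * γ)) * huv
  rw [this]
  exact dvd_add (h₁.mul_left _) (h₂.mul_left _)

/-- The values of linear forms with determinants dividing `72` at a coprime pair have even valuation
at `p ≥ 7` if their product is a square up to a power of `5`. -/
lemma linear_forms_padicValInt_even {ι : Type*} [Fintype ι] {F : ι → ℤ} {k w m n : ℤ}
    (α β : ι → ℤ) (hα : ∀ i, F i = α i * m + β i * n)
    (hd : ∀ i j, i ≠ j → α i * β j - β i * α j ∣ 72) (hc : IsCoprime m n) (hF : ∀ i, F i ≠ 0)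
    (hk : k ∣ 5) (h : (∏ i, F i) * k = w ^ 2) (i : ι) (p : ℕ) (hp : p.Prime) (h2 : p ≠ 2)
    (h3 : p ≠ 3) (h5 : p ≠ 5) : padicValInt p (F i) % 2 = 0 := by
  have : Fact p.Prime := ⟨hp⟩
  have hk0 : k ≠ 0 := by rintro rfl; norm_num at hk
  by_cases hi : (p : ℤ) ∣ F i
  · have hj : ∀ j, j ≠ i → padicValInt p (F j) = 0 := by
      intro j hji
      apply padicValInt.eq_zero_of_not_dvd
      intro hpj
      rw [hα] at hi hpj
      have h72 : (p : ℤ) ∣ 72 := (dvd_det_of_dvd hc hpj hi).trans (hd j i hji)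
      have : p ∣ 2 ^ 3 * 3 ^ 2 := by exact_mod_cast h72
      rcases (hp.dvd_mul).mp this with h | h
      · exact h2 ((Nat.prime_dvd_prime_iff_eq hp Nat.prime_two).mp (hp.dvd_of_dvd_pow h))
      · exact h3 ((Nat.prime_dvd_prime_iff_eq hp Nat.prime_three).mp (hp.dvd_of_dvd_pow h))
    have hs := sum_padicValInt_parity hF hk0 h p
    rw [Finset.sum_eq_single i (fun j _ hji => hj j hji) (by simp)] at hs
    rw [hs, padicValInt.eq_zero_of_not_dvd]
    intro hpk
    have : p ∣ 5 := by exact_mod_cast hpk.trans hk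
    exact h5 ((Nat.prime_dvd_prime_iff_eq hp Nat.prime_five).mp this)
  · rw [padicValInt.eq_zero_of_not_dvd hi]

/-- The quadratic character modulo `5` in terms of the exponents of `2` and `3`. -/
lemma emod_five_of_eq {n s r : ℤ} {a b c : ℕ} (hs : s = 1 ∨ s = -1)
    (h : n = s * 2 ^ (a % 2) * 3 ^ (b % 2) * 5 ^ c * r ^ 2) :
    n % 5 = 0 ∨ ((n % 5 = 1 ∨ n % 5 = 4) ∧ (a + b) % 2 = 0) ∨
      ((n % 5 = 2 ∨ n % 5 = 3) ∧ (a + b) % 2 = 1) := by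
  rcases Nat.eq_zero_or_pos c with rfl | hc
  · have hr : r ^ 2 % 5 = 0 ∨ r ^ 2 % 5 = 1 ∨ r ^ 2 % 5 = 4 := by
      have : r % 5 = 0 ∨ r % 5 = 1 ∨ r % 5 = 2 ∨ r % 5 = 3 ∨ r % 5 = 4 := by omega
      rcases this with h | h | h | h | h <;> simp [pow_two, Int.mul_emod, h]
    rcases Nat.mod_two_eq_zero_or_one a with ha | ha <;>
      rcases Nat.mod_two_eq_zero_or_one b with hb | hb <;>
      rcases hs with rfl | rfl <;> simp only [ha, hb] at h <;> omega
  · left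
    apply Int.emod_eq_zero_of_dvd
    rw [h]
    exact ((dvd_pow_self 5 hc.ne').mul_left _).mul_right _

/-- Halving a point on `k y² = x (x - e) (x - f)` all of whose coordinates `x`, `x - e`, `x - f`
are `k` times a square. -/
lemma exists_half {k e f t a b c : ℚ} (hk : k ≠ 0) (he : e ≠ 0) (hf : f ≠ 0) (hef : e ≠ f)
    (h₁ : t = k * a ^ 2) (h₂ : t - e = k * b ^ 2) (h₃ : t - f = k * c ^ 2) :
    ∃ q y : ℚ, y ≠ 0 ∧ k * q * (q - e) * (q - f) = y ^ 2 ∧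
      (q ^ 2 - e * f) ^ 2 = t * (4 * (q * (q - e) * (q - f))) := by
  have e1 : e = k * (a + b) * (a - b) := by linear_combination h₁ - h₂
  have e2 : f = k * (a + c) * (a - c) := by linear_combination h₁ - h₃
  have e3 : f - e = k * (b + c) * (b - c) := by linear_combination h₂ - h₃
  have n1 : a + b ≠ 0 := by intro h; apply he; rw [e1, h]; ring
  have n2 : a + c ≠ 0 := by intro h; apply hf; rw [e2, h]; ring
  have n3 : b + c ≠ 0 := by
    intro h
    apply hef
    rw [h] at e3
    linear_combination -e3
  refine ⟨k * (a + b) * (a + c), k ^ 2 * ((a + b) * (a + c) * (b + c)), by positivity, ?_, ?_⟩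
  · have q2 : k * (a + b) * (a + c) - e = k * (a + b) * (b + c) := by
      rw [e1]; ring
    have q3 : k * (a + b) * (a + c) - f = k * (a + c) * (b + c) := by
      rw [e2]; ring
    rw [q2, q3]; ring
  · rw [e1, e2, h₁]; ring

/-- The duplication map raises the height `max |m| n` of `m / n` to the fourth power, up to a
bounded factor. -/
lemma max_abs_pow_four_le {m n T U e f R : ℤ} (hef : e * f < 0) (hR0 : 0 < R)
    (hR : ∀ d : ℤ, d ∣ (m ^ 2 - e * f * n ^ 2) ^ 2 →
      d ∣ 4 * (n * m * (m - e * n) * (m - f * n)) → d ∣ R) (hn : 0 < n) (hT : T ≠ 0)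
    (h : (m ^ 2 - e * f * n ^ 2) ^ 2 * U = T * (4 * (n * m * (m - e * n) * (m - f * n)))) :
    max |m| n ^ 4 ≤ |T| * R := by
  set P := (m ^ 2 - e * f * n ^ 2) ^ 2 with hP
  set D := 4 * (n * m * (m - e * n) * (m - f * n))
  have hPT : P ∣ |T| * R := by
    have hg : ((Int.gcd P D : ℕ) : ℤ) ∣ R := hR _ (Int.gcd_dvd_left ..) (Int.gcd_dvd_right ..)
    have h1 : P ∣ T * (Int.gcd P D : ℕ) := by
      rw [Int.gcd_eq_gcd_ab, mul_add]
      refine dvd_add (Dvd.intro (T * Int.gcdA P D) (by ring)) ?_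
      exact Dvd.intro (U * Int.gcdB P D) (by rw [← mul_assoc, h]; ring)
    rw [← abs_of_pos hR0, ← abs_mul]
    exact (dvd_abs _ _).mpr (h1.trans (mul_dvd_mul_left T hg))
  have hPle : P ≤ |T| * R := Int.le_of_dvd (mul_pos (abs_pos.mpr hT) hR0) hPT
  have hsq : max |m| n ^ 2 ≤ m ^ 2 - e * f * n ^ 2 := by
    have : n ^ 2 ≤ - (e * f) * n ^ 2 := le_mul_of_one_le_left (sq_nonneg n) (by omega)
    rcases max_choice |m| n with hm | hm <;> rw [hm]
    · rw [sq_abs]; linarith [sq_nonneg n]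
    · linarith [sq_nonneg m]
  calc max |m| n ^ 4 = (max |m| n ^ 2) ^ 2 := by ring
    _ ≤ P := by rw [hP]; gcongr
    _ ≤ |T| * R := hPle

/-- Infinite descent on `y² = k x (x - e) (x - f)` when every rational point is, up to translation
by a point of order two, divisible by two. -/
theorem eq_zero_of_descent {k e f K R B : ℤ} (hk : k ≠ 0) (hef : e * f < 0) (hR0 : 0 < R)
    (hR : ∀ m n d : ℤ, IsCoprime m n → d ∣ (m ^ 2 - e * f * n ^ 2) ^ 2 →
      d ∣ 4 * (n * m * (m - e * n) * (m - f * n)) → d ∣ R)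
    (hstep : ∀ m n w : ℤ, 0 < n → IsCoprime m n → n * m * (m - e * n) * (m - f * n) * k = w ^ 2 →
      w ≠ 0 → ∃ T U a b c : ℤ, T ≠ 0 ∧ U ≠ 0 ∧ T * U * k = a ^ 2 ∧ (T - e * U) * U * k = b ^ 2 ∧
        (T - f * U) * U * k = c ^ 2 ∧ |T| ≤ K * max |m| n)
    (hsmall : ∀ m n w : ℤ, 0 < n → |m| ≤ B → n ≤ B →
      n * m * (m - e * n) * (m - f * n) * k = w ^ 2 → w = 0)
    (hB0 : 0 ≤ B) (hB : R * K < (B + 1) ^ 3) {t y : ℚ} (h : k * t * (t - e) * (t - f) = y ^ 2) :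
    y = 0 := by
  have int_of_rat : ∀ q y : ℚ, k * q * (q - e) * (q - f) = y ^ 2 → ∃ w : ℤ,
      (w : ℚ) = y * q.den ^ 2 ∧
      (q.den : ℤ) * q.num * (q.num - e * q.den) * (q.num - f * q.den) * k = w ^ 2 := by
    intro q y hq
    have hd : (q.den : ℚ) ≠ 0 := by exact_mod_cast q.den_nz
    have hn : (q.num : ℚ) = q * q.den := (Rat.mul_den_eq_num q).symm
    have hsq : (((q.den : ℤ) * q.num * (q.num - e * q.den) * (q.num - f * q.den) * k : ℤ) : ℚ) =
        (y * q.den ^ 2) ^ 2 := by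
      push_cast
      rw [hn, mul_pow, ← hq]; ring
    have : IsSquare (((q.den : ℤ) * q.num * (q.num - e * q.den) * (q.num - f * q.den) * k : ℤ) :
        ℚ) := ⟨_, hsq.trans (pow_two _)⟩
    obtain ⟨w, hw⟩ := Rat.isSquare_intCast_iff.mp this
    have hw2 : (w : ℚ) ^ 2 = (y * q.den ^ 2) ^ 2 := by
      rw [← hsq, hw]; push_cast; ring
    rcases sq_eq_sq_iff_eq_or_eq_neg.mp hw2 with h1 | h1
    · exact ⟨w, h1, by rw [hw]; ring⟩
    · exact ⟨-w, by push_cast; rw [h1]; ring, by rw [hw]; ring⟩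
  have main : ∀ N : ℕ, ∀ m n w : ℤ, 0 < n → IsCoprime m n → max |m| n = N →
      n * m * (m - e * n) * (m - f * n) * k = w ^ 2 → w = 0 := by
    intro N
    induction N using Nat.strong_induction_on with
    | _ N ih =>
    intro m n w hn hmn hN heq
    by_contra hw
    rcases le_or_gt (N : ℤ) B with hNB | hNB
    · exact hw (hsmall m n w hn ((le_max_left _ _).trans (hN.le.trans hNB))
        ((le_max_right _ _).trans (hN.le.trans hNB)) heq)
    obtain ⟨T, U, a, b, c, hT, hU, ha, hb, hc, hTK⟩ := hstep m n w hn hmn heq hw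
    have hkq : (k : ℚ) ≠ 0 := by exact_mod_cast hk
    have hUq : (U : ℚ) ≠ 0 := by exact_mod_cast hU
    have he0 : e ≠ 0 := by rintro rfl; simp at hef
    have hf0 : f ≠ 0 := by rintro rfl; simp at hef
    have hne : e ≠ f := by rintro rfl; nlinarith [sq_nonneg e]
    have haq : (T : ℚ) * U * k = a ^ 2 := by exact_mod_cast ha
    have hbq : ((T : ℚ) - e * U) * U * k = b ^ 2 := by exact_mod_cast hb
    have hcq : ((T : ℚ) - f * U) * U * k = c ^ 2 := by exact_mod_cast hc
    obtain ⟨q, y, hy, hq, hdup⟩ := exists_half (k := k) (e := e) (f := f) (t := T / U)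
      (a := a / (k * U)) (b := b / (k * U)) (c := c / (k * U)) hkq (by exact_mod_cast he0)
      (by exact_mod_cast hf0) (by exact_mod_cast hne)
      (by rw [div_pow, ← haq]; field_simp) (by rw [div_pow, ← hbq]; field_simp)
      (by rw [div_pow, ← hcq]; field_simp)
    obtain ⟨w', hw', hq'⟩ := int_of_rat q y hq
    have hd : (q.den : ℚ) ≠ 0 := by exact_mod_cast q.den_nz
    have hw0 : w' ≠ 0 := by
      intro h0
      rw [h0] at hw'
      exact mul_ne_zero hy (pow_ne_zero 2 hd) (by simpa using hw'.symm)
    have hcop : IsCoprime q.num (q.den : ℤ) := by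
      rw [Int.isCoprime_iff_gcd_eq_one]; exact q.reduced
    have hdpos : (0 : ℤ) < q.den := by exact_mod_cast q.den_pos
    have hqn : (q.num : ℚ) = q * q.den := (Rat.mul_den_eq_num q).symm
    set m' := q.num
    set n' := (q.den : ℤ) with hn'
    have hnq : (n' : ℚ) = q.den := by simp [hn']
    have hPD : (m' ^ 2 - e * f * n' ^ 2) ^ 2 * U =
        T * (4 * (n' * m' * (m' - e * n') * (m' - f * n'))) := by
      have hdup' : (q ^ 2 - e * f) ^ 2 * U = T * (4 * (q * (q - e) * (q - f))) := by
        rw [hdup]; field_simp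
      have : ((m' : ℚ) ^ 2 - e * f * n' ^ 2) ^ 2 * U =
          T * (4 * (n' * m' * (m' - e * n') * (m' - f * n'))) := by
        rw [hnq, hqn]
        linear_combination (q.den : ℚ) ^ 4 * hdup'
      exact_mod_cast this
    obtain ⟨N', hN'⟩ : ∃ N' : ℕ, max |m'| n' = N' :=
      ⟨(max |m'| n').toNat, (Int.toNat_of_nonneg (le_max_of_le_right hdpos.le)).symm⟩
    have hN4 : (N' : ℤ) ^ 4 ≤ |T| * R := by
      rw [← hN']
      exact max_abs_pow_four_le hef hR0 (fun d => hR m' n' d hcop) hdpos hT hPD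
    have hlt : N' < N := by
      by_contra! hge
      have hge' : (N : ℤ) ≤ N' := by exact_mod_cast hge
      have hNpos : (0 : ℤ) < N := lt_of_le_of_lt hB0 hNB
      have h1 : (N : ℤ) ^ 4 ≤ (N' : ℤ) ^ 4 := by gcongr
      have h2 : |T| * R ≤ K * N * R := mul_le_mul_of_nonneg_right (hN ▸ hTK) hR0.le
      have h3 : (B + 1) ^ 3 ≤ (N : ℤ) ^ 3 := by gcongr; omega
      have h4 : (N : ℤ) ^ 3 * N ≤ R * K * N := by
        calc (N : ℤ) ^ 3 * N = (N : ℤ) ^ 4 := by ring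
          _ ≤ K * N * R := h1.trans (hN4.trans h2)
          _ = _ := by ring
      have h5 := le_of_mul_le_mul_right h4 hNpos
      omega
    exact hw0 (ih N' hlt m' n' w' hdpos hcop hN' hq')
  obtain ⟨w, hw, hq⟩ := int_of_rat t y h
  have hd : (t.den : ℚ) ≠ 0 := by exact_mod_cast t.den_nz
  have hdpos : (0 : ℤ) < t.den := by exact_mod_cast t.den_pos
  have hcop : IsCoprime t.num (t.den : ℤ) := by
    rw [Int.isCoprime_iff_gcd_eq_one]; exact t.reduced
  have hw0 := main (max |t.num| t.den).toNat t.num t.den w hdpos hcop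
    (Int.toNat_of_nonneg (le_max_of_le_right hdpos.le)).symm hq
  rw [hw0] at hw
  simpa [hd] using hw.symm

lemma padicValInt_eq_zero_of_emod {p : ℕ} {n : ℤ} (h : n % p ≠ 0) : padicValInt p n = 0 :=
  padicValInt.eq_zero_of_not_dvd fun hd => h (Int.emod_eq_zero_of_dvd hd)

lemma padicValInt_five {p : ℕ} {k : ℤ} (hk : k = 5 ∨ k = -5) (hp : p.Prime) :
    padicValInt p k = if p = 5 then 1 else 0 := by
  have : padicValInt p k = padicValNat p 5 := by rcases hk with rfl | rfl <;> rfl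
  rw [this]
  split_ifs with h
  · have : Fact (Nat.Prime p) := ⟨hp⟩
    subst h; exact padicValNat_self
  · exact padicValNat.eq_zero_of_not_dvd fun hd =>
      h ((Nat.prime_dvd_prime_iff_eq hp Nat.prime_five).mp hd)

lemma not_emod_eq_zero_of_isCoprime {m n : ℤ} (h : IsCoprime m n) (p : ℕ) (hp : p.Prime) :
    ¬ (m % p = 0 ∧ n % p = 0) := by
  rintro ⟨h1, h2⟩
  have := h.isUnit_of_dvd' (Int.dvd_of_emod_eq_zero h1) (Int.dvd_of_emod_eq_zero h2)
  rw [Int.isUnit_iff_natAbs_eq] at this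
  exact hp.one_lt.ne' (by simpa using this)


lemma sq_pos_and_emod_three {r : ℤ} (hr : r ≠ 0) :
    0 < r ^ 2 ∧ (r ^ 2 % 3 = 1 ∨ r ^ 2 % 9 = 0) := by
  refine ⟨by positivity, ?_⟩
  have : r % 9 = 0 ∨ r % 9 = 1 ∨ r % 9 = 2 ∨ r % 9 = 3 ∨ r % 9 = 4 ∨ r % 9 = 5 ∨ r % 9 = 6 ∨
    r % 9 = 7 ∨ r % 9 = 8 := by omega
  rw [← Int.emod_emod_of_dvd (r ^ 2) (by norm_num : (3 : ℤ) ∣ 9)]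
  rcases this with h | h | h | h | h | h | h | h | h <;> simp [pow_two, Int.mul_emod, h]

lemma parity_at_two {m n : ℤ} {a₀ a₁ a₂ a₃ : ℕ} (h : (a₀ + a₁ + a₂ + a₃) % 2 = 0)
    (c : ¬ (m % 2 = 0 ∧ n % 2 = 0)) (z₀ : n % 2 ≠ 0 → a₀ = 0) (z₁ : m % 2 ≠ 0 → a₁ = 0)
    (z₂ : (m - n) % 2 ≠ 0 → a₂ = 0) (z₃ : (m + 2 * n) % 2 ≠ 0 → a₃ = 0) :
    a₀ % 2 = 0 ∧ a₂ % 2 = 0 ∧ (a₁ + a₃) % 2 = 0 := by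
  have hm : m % 2 = 0 ∨ m % 2 = 1 := by omega
  have hn : n % 2 = 0 ∨ n % 2 = 1 := by omega
  rw [Int.sub_emod] at z₂
  rw [Int.add_emod, Int.mul_emod] at z₃
  rcases hm with hm | hm <;> rcases hn with hn | hn <;> norm_num [hm, hn] at z₀ z₁ z₂ z₃ c <;>
    omega

lemma parity_at_three {m n : ℤ} {a₀ a₁ a₂ a₃ : ℕ} (h : (a₀ + a₁ + a₂ + a₃) % 2 = 0)
    (c : ¬ (m % 3 = 0 ∧ n % 3 = 0)) (z₀ : n % 3 ≠ 0 → a₀ = 0) (z₁ : m % 3 ≠ 0 → a₁ = 0)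
    (z₂ : (m - n) % 3 ≠ 0 → a₂ = 0) (z₃ : (m + 2 * n) % 3 ≠ 0 → a₃ = 0) :
    a₀ % 2 = 0 ∧ a₁ % 2 = 0 ∧ (a₂ + a₃) % 2 = 0 := by
  have hm : m % 3 = 0 ∨ m % 3 = 1 ∨ m % 3 = 2 := by omega
  have hn : n % 3 = 0 ∨ n % 3 = 1 ∨ n % 3 = 2 := by omega
  rw [Int.sub_emod] at z₂
  rw [Int.add_emod, Int.mul_emod] at z₃
  rcases hm with hm | hm | hm <;> rcases hn with hn | hn | hn <;>
    norm_num [hm, hn] at z₀ z₁ z₂ z₃ c <;> omega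

lemma valuation_patterns {m n : ℤ} {a₀ a₁ a₂ a₃ b₀ b₁ b₂ b₃ d₀ d₁ d₂ d₃ : ℕ}
    (h2 : (a₀ + a₁ + a₂ + a₃) % 2 = 0) (h3 : (b₀ + b₁ + b₂ + b₃) % 2 = 0)
    (h5 : (d₀ + d₁ + d₂ + d₃) % 2 = 1)
    (c2 : ¬ (m % 2 = 0 ∧ n % 2 = 0)) (c3 : ¬ (m % 3 = 0 ∧ n % 3 = 0))
    (c5 : ¬ (m % 5 = 0 ∧ n % 5 = 0))
    (z₀ : (n % 2 ≠ 0 → a₀ = 0) ∧ (n % 3 ≠ 0 → b₀ = 0) ∧ (n % 5 ≠ 0 → d₀ = 0))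
    (z₁ : (m % 2 ≠ 0 → a₁ = 0) ∧ (m % 3 ≠ 0 → b₁ = 0) ∧ (m % 5 ≠ 0 → d₁ = 0))
    (z₂ : ((m - n) % 2 ≠ 0 → a₂ = 0) ∧ ((m - n) % 3 ≠ 0 → b₂ = 0) ∧ ((m - n) % 5 ≠ 0 → d₂ = 0))
    (z₃ : ((m + 2 * n) % 2 ≠ 0 → a₃ = 0) ∧ ((m + 2 * n) % 3 ≠ 0 → b₃ = 0) ∧
      ((m + 2 * n) % 5 ≠ 0 → d₃ = 0))
    (q₀ : n % 5 = 0 ∨ ((n % 5 = 1 ∨ n % 5 = 4) ∧ (a₀ + b₀) % 2 = 0) ∨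
      ((n % 5 = 2 ∨ n % 5 = 3) ∧ (a₀ + b₀) % 2 = 1))
    (q₁ : m % 5 = 0 ∨ ((m % 5 = 1 ∨ m % 5 = 4) ∧ (a₁ + b₁) % 2 = 0) ∨
      ((m % 5 = 2 ∨ m % 5 = 3) ∧ (a₁ + b₁) % 2 = 1))
    (q₂ : (m - n) % 5 = 0 ∨ (((m - n) % 5 = 1 ∨ (m - n) % 5 = 4) ∧ (a₂ + b₂) % 2 = 0) ∨
      (((m - n) % 5 = 2 ∨ (m - n) % 5 = 3) ∧ (a₂ + b₂) % 2 = 1))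
    (q₃ : (m + 2 * n) % 5 = 0 ∨
      (((m + 2 * n) % 5 = 1 ∨ (m + 2 * n) % 5 = 4) ∧ (a₃ + b₃) % 2 = 0) ∨
      (((m + 2 * n) % 5 = 2 ∨ (m + 2 * n) % 5 = 3) ∧ (a₃ + b₃) % 2 = 1)) :
    a₀ % 2 = 0 ∧ a₂ % 2 = 0 ∧ b₀ % 2 = 0 ∧ b₁ % 2 = 0 ∧
      ((a₁ % 2 = 0 ∧ a₃ % 2 = 0 ∧ b₂ % 2 = 0 ∧ b₃ % 2 = 0 ∧
          d₀ % 2 = 1 ∧ d₁ % 2 = 0 ∧ d₂ % 2 = 0 ∧ d₃ % 2 = 0) ∨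
        (a₁ % 2 = 1 ∧ a₃ % 2 = 1 ∧ b₂ % 2 = 0 ∧ b₃ % 2 = 0 ∧
          d₀ % 2 = 0 ∧ d₁ % 2 = 1 ∧ d₂ % 2 = 0 ∧ d₃ % 2 = 0) ∨
        (a₁ % 2 = 0 ∧ a₃ % 2 = 0 ∧ b₂ % 2 = 1 ∧ b₃ % 2 = 1 ∧
          d₀ % 2 = 0 ∧ d₁ % 2 = 0 ∧ d₂ % 2 = 1 ∧ d₃ % 2 = 0) ∨
        (a₁ % 2 = 1 ∧ a₃ % 2 = 1 ∧ b₂ % 2 = 1 ∧ b₃ % 2 = 1 ∧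
          d₀ % 2 = 0 ∧ d₁ % 2 = 0 ∧ d₂ % 2 = 0 ∧ d₃ % 2 = 1)) := by
  obtain ⟨z2₀, z3₀, z5₀⟩ := z₀
  obtain ⟨z2₁, z3₁, z5₁⟩ := z₁
  obtain ⟨z2₂, z3₂, z5₂⟩ := z₂
  obtain ⟨z2₃, z3₃, z5₃⟩ := z₃
  obtain ⟨A₀, A₂, A₁₃⟩ := parity_at_two h2 c2 z2₀ z2₁ z2₂ z2₃
  obtain ⟨B₀, B₁, B₂₃⟩ := parity_at_three h3 c3 z3₀ z3₁ z3₂ z3₃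
  clear z2₀ z2₁ z2₂ z2₃ h2 c2 z3₀ z3₁ z3₂ z3₃ h3 c3
  refine ⟨A₀, A₂, B₀, B₁, ?_⟩
  have hd (x : ℤ) : x % 5 = 0 ∨ x % 5 = 1 ∨ x % 5 = 2 ∨ x % 5 = 3 ∨ x % 5 = 4 := by omega
  have hs : (m - n) % 5 = (m % 5 - n % 5) % 5 := Int.sub_emod ..
  have ha : (m + 2 * n) % 5 = (m % 5 + 2 * (n % 5)) % 5 := by omega
  rw [hs] at z5₂ q₂
  rw [ha] at z5₃ q₃
  have key : (n % 5 = 0 ∧ d₀ % 2 = 1 ∧ d₁ = 0 ∧ d₂ = 0 ∧ d₃ = 0) ∨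
      (m % 5 = 0 ∧ d₀ = 0 ∧ d₁ % 2 = 1 ∧ d₂ = 0 ∧ d₃ = 0) ∨
      (m % 5 = n % 5 ∧ d₀ = 0 ∧ d₁ = 0 ∧ d₂ % 2 = 1 ∧ d₃ = 0) ∨
      (m % 5 = 3 * (n % 5) % 5 ∧ d₀ = 0 ∧ d₁ = 0 ∧ d₂ = 0 ∧ d₃ % 2 = 1) := by
    clear q₀ q₁ q₂ q₃ A₀ A₂ A₁₃ B₀ B₁ B₂₃ hs ha
    rcases hd m with hm | hm | hm | hm | hm <;> rcases hd n with hn | hn | hn | hn | hn 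
    · exact absurd ⟨hm, hn⟩ c5
    all_goals norm_num [hm, hn] at z5₀ z5₁ z5₂ z5₃ ⊢; omega
  clear z5₀ z5₁ z5₂ z5₃ hs ha h5
  rcases key with ⟨hn, e₀, rfl, rfl, rfl⟩ | ⟨hm, rfl, e₁, rfl, rfl⟩ | ⟨h, rfl, rfl, e₂, rfl⟩ |
    ⟨h, rfl, rfl, rfl, e₃⟩
  · rcases hd m with hm | hm | hm | hm | hm
    · exact absurd ⟨hm, hn⟩ c5
    all_goals norm_num [hm, hn] at q₀ q₁ q₂ q₃
    all_goals refine Or.inl ⟨?_, ?_, ?_, ?_, ?_, ?_, ?_, ?_⟩ <;> omega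
  · rcases hd n with hn | hn | hn | hn | hn
    · exact absurd ⟨hm, hn⟩ c5
    all_goals norm_num [hm, hn] at q₀ q₁ q₂ q₃
    all_goals refine Or.inr (Or.inl ⟨?_, ?_, ?_, ?_, ?_, ?_, ?_, ?_⟩) <;> omega
  · rcases hd n with hn | hn | hn | hn | hn
    · exact absurd ⟨h.trans hn, hn⟩ c5
    all_goals have hm := h.trans hn
    all_goals norm_num [hm, hn] at q₀ q₁ q₂ q₃
    all_goals refine Or.inr (Or.inr (Or.inl ⟨?_, ?_, ?_, ?_, ?_, ?_, ?_, ?_⟩)) <;> omega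
  · rcases hd n with hn | hn | hn | hn | hn <;> rw [hn] at h
    · exact absurd ⟨h, hn⟩ c5
    all_goals have hm := h
    all_goals norm_num [hm, hn] at q₀ q₁ q₂ q₃
    all_goals refine Or.inr (Or.inr (Or.inr ⟨?_, ?_, ?_, ?_, ?_, ?_, ?_, ?_⟩)) <;> omega

/-- A sign condition on the four linear forms when `5` divides `n`. -/
lemma signs_infty {σ m n s₁ s₂ s₃ R₀ R₁ R₂ R₃ : ℤ} (hσ : σ = 1 ∨ σ = -1)
    (c3 : ¬ (m % 3 = 0 ∧ n % 3 = 0)) (hs₁ : s₁ = 1 ∨ s₁ = -1) (hs₂ : s₂ = 1 ∨ s₂ = -1)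
    (hs₃ : s₃ = 1 ∨ s₃ = -1) (hs : s₁ * s₂ * s₃ = σ) (h₀ : 0 < R₀ ∧ (R₀ % 3 = 1 ∨ R₀ % 9 = 0))
    (h₁ : 0 < R₁ ∧ (R₁ % 3 = 1 ∨ R₁ % 9 = 0)) (h₂ : 0 < R₂ ∧ (R₂ % 3 = 1 ∨ R₂ % 9 = 0))
    (h₃ : 0 < R₃ ∧ (R₃ % 3 = 1 ∨ R₃ % 9 = 0)) (e₀ : n = 5 * R₀) (e₁ : m = s₁ * R₁)
    (e₂ : m - n = s₂ * R₂) (e₃ : m + 2 * n = s₃ * R₃) :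
    s₁ = σ ∧ s₂ = σ ∧ s₃ = σ := by
  subst hs
  rcases hs₁ with rfl | rfl <;> rcases hs₂ with rfl | rfl <;> rcases hs₃ with rfl | rfl <;> omega

/-- A sign condition on the four linear forms when `5` divides `m`. -/
lemma signs_zero {σ m n s₁ s₂ s₃ R₀ R₁ R₂ R₃ : ℤ} (hσ : σ = 1 ∨ σ = -1)
    (c3 : ¬ (m % 3 = 0 ∧ n % 3 = 0)) (hs₁ : s₁ = 1 ∨ s₁ = -1) (hs₂ : s₂ = 1 ∨ s₂ = -1)
    (hs₃ : s₃ = 1 ∨ s₃ = -1) (hs : s₁ * s₂ * s₃ = σ) (h₀ : 0 < R₀ ∧ (R₀ % 3 = 1 ∨ R₀ % 9 = 0))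
    (h₁ : 0 < R₁ ∧ (R₁ % 3 = 1 ∨ R₁ % 9 = 0)) (h₂ : 0 < R₂ ∧ (R₂ % 3 = 1 ∨ R₂ % 9 = 0))
    (h₃ : 0 < R₃ ∧ (R₃ % 3 = 1 ∨ R₃ % 9 = 0)) (e₀ : n = R₀) (e₁ : m = s₁ * 2 * 5 * R₁)
    (e₂ : m - n = s₂ * R₂) (e₃ : m + 2 * n = s₃ * 2 * R₃) :
    s₁ = -σ ∧ s₂ = -1 ∧ s₃ = 1 := by
  subst hs
  rcases hs₁ with rfl | rfl <;> rcases hs₂ with rfl | rfl <;> rcases hs₃ with rfl | rfl <;> omega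

/-- A sign condition on the four linear forms when `5` divides `m - n`. -/
lemma signs_one {σ m n s₁ s₂ s₃ R₀ R₁ R₂ R₃ : ℤ} (hσ : σ = 1 ∨ σ = -1)
    (c3 : ¬ (m % 3 = 0 ∧ n % 3 = 0)) (hs₁ : s₁ = 1 ∨ s₁ = -1) (hs₂ : s₂ = 1 ∨ s₂ = -1)
    (hs₃ : s₃ = 1 ∨ s₃ = -1) (hs : s₁ * s₂ * s₃ = σ) (h₀ : 0 < R₀ ∧ (R₀ % 3 = 1 ∨ R₀ % 9 = 0))
    (h₁ : 0 < R₁ ∧ (R₁ % 3 = 1 ∨ R₁ % 9 = 0)) (h₂ : 0 < R₂ ∧ (R₂ % 3 = 1 ∨ R₂ % 9 = 0))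
    (h₃ : 0 < R₃ ∧ (R₃ % 3 = 1 ∨ R₃ % 9 = 0)) (e₀ : n = R₀) (e₁ : m = s₁ * R₁)
    (e₂ : m - n = s₂ * 3 * 5 * R₂) (e₃ : m + 2 * n = s₃ * 3 * R₃) :
    s₁ = 1 ∧ s₂ = σ ∧ s₃ = 1 := by
  subst hs
  rcases hs₁ with rfl | rfl <;> rcases hs₂ with rfl | rfl <;> rcases hs₃ with rfl | rfl <;> omega

/-- A sign condition on the four linear forms when `5` divides `m + 2 * n`. -/
lemma signs_two {σ m n s₁ s₂ s₃ R₀ R₁ R₂ R₃ : ℤ} (hσ : σ = 1 ∨ σ = -1)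
    (c3 : ¬ (m % 3 = 0 ∧ n % 3 = 0)) (hs₁ : s₁ = 1 ∨ s₁ = -1) (hs₂ : s₂ = 1 ∨ s₂ = -1)
    (hs₃ : s₃ = 1 ∨ s₃ = -1) (hs : s₁ * s₂ * s₃ = σ) (h₀ : 0 < R₀ ∧ (R₀ % 3 = 1 ∨ R₀ % 9 = 0))
    (h₁ : 0 < R₁ ∧ (R₁ % 3 = 1 ∨ R₁ % 9 = 0)) (h₂ : 0 < R₂ ∧ (R₂ % 3 = 1 ∨ R₂ % 9 = 0))
    (h₃ : 0 < R₃ ∧ (R₃ % 3 = 1 ∨ R₃ % 9 = 0)) (e₀ : n = R₀) (e₁ : m = s₁ * 2 * R₁)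
    (e₂ : m - n = s₂ * 3 * R₂) (e₃ : m + 2 * n = s₃ * 2 * 3 * 5 * R₃) :
    s₁ = -1 ∧ s₂ = -1 ∧ s₃ = σ := by
  subst hs
  rcases hs₁ with rfl | rfl <;> rcases hs₂ with rfl | rfl <;> rcases hs₃ with rfl | rfl <;> omega

lemma sign_eq_of_eq {n s r : ℤ} {a b c : ℕ} (hs : s = 1 ∨ s = -1) (hr : r ≠ 0)
    (h : n = s * 2 ^ a * 3 ^ b * 5 ^ c * r ^ 2) : n.sign = s := by
  have : 0 < 2 ^ a * 3 ^ b * 5 ^ c * r ^ 2 := by positivity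
  rcases hs with rfl | rfl
  · exact Int.sign_eq_one_of_pos (by linarith)
  · exact Int.sign_eq_neg_one_of_neg (by linarith)

lemma descent_step_five {σ m n w : ℤ} (hσ : σ = 1 ∨ σ = -1) (hn : 0 < n) (hc : IsCoprime m n)
    (h : n * m * (m - 1 * n) * (m - (-2) * n) * (5 * σ) = w ^ 2) (hw : w ≠ 0) :
    ∃ T U a b c : ℤ, T ≠ 0 ∧ U ≠ 0 ∧ T * U * (5 * σ) = a ^ 2 ∧
      (T - 1 * U) * U * (5 * σ) = b ^ 2 ∧ (T - (-2) * U) * U * (5 * σ) = c ^ 2 ∧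
      |T| ≤ 4 * max |m| n := by
  have hk : 5 * σ = 5 ∨ 5 * σ = -5 := by omega
  have hprod : n * m * (m - n) * (m + 2 * n) * (5 * σ) = w ^ 2 := by rw [← h]; ring
  have hne := pow_ne_zero 2 hw
  rw [← hprod] at hne
  simp only [mul_ne_zero_iff] at hne
  obtain ⟨⟨⟨⟨hn0, hm0⟩, h10⟩, h20⟩, -⟩ := hne
  have hF : ∀ i, (![n, m, m - n, m + 2 * n] : Fin 4 → ℤ) i ≠ 0 := by
    intro i; fin_cases i <;> simpa
  have hP : (∏ i, (![n, m, m - n, m + 2 * n] : Fin 4 → ℤ) i) * (5 * σ) = w ^ 2 := by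
    rw [Fin.prod_univ_four]; exact hprod
  have hev := linear_forms_padicValInt_even (F := ![n, m, m - n, m + 2 * n]) ![0, 1, 1, 1]
    ![1, 0, -1, 2] (by intro i; fin_cases i <;> simp [sub_eq_add_neg]) (by decide) hc hF
    (by rcases hk with hk | hk <;> rw [hk] <;> decide) hP
  have hsum := sum_padicValInt_parity hF (by omega) hP
  have h2 := hsum 2
  have h3 := hsum 3
  have : Fact (Nat.Prime 5) := ⟨Nat.prime_five⟩
  have h5 := hsum 5
  rw [padicValInt_five hk (by norm_num), Fin.sum_univ_four] at h2 h3 h5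
  norm_num at h2 h3 h5
  have c2 := not_emod_eq_zero_of_isCoprime hc 2 (by norm_num)
  have c3 := not_emod_eq_zero_of_isCoprime hc 3 (by norm_num)
  have c5 := not_emod_eq_zero_of_isCoprime hc 5 (by norm_num)
  obtain ⟨s0, r0, hs0, hr0, e0⟩ := exists_eq_sign_mul_sq hn0 (hev 0)
  obtain ⟨s1, r1, hs1, hr1, e1⟩ := exists_eq_sign_mul_sq hm0 (hev 1)
  obtain ⟨s2, r2, hs2, hr2, e2⟩ := exists_eq_sign_mul_sq h10 (hev 2)
  obtain ⟨s3, r3, hs3, hr3, e3⟩ := exists_eq_sign_mul_sq h20 (hev 3)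
  have z (x : ℤ) : (x % 2 ≠ 0 → padicValInt 2 x = 0) ∧ (x % 3 ≠ 0 → padicValInt 3 x = 0) ∧
      (x % 5 ≠ 0 → padicValInt 5 x = 0) :=
    ⟨padicValInt_eq_zero_of_emod, padicValInt_eq_zero_of_emod, padicValInt_eq_zero_of_emod⟩
  have z0 := z n
  have z1 := z m
  have z2 := z (m - n)
  have z3 := z (m + 2 * n)
  have q0 := emod_five_of_eq hs0 e0
  have q1 := emod_five_of_eq hs1 e1
  have q2 := emod_five_of_eq hs2 e2
  have q3 := emod_five_of_eq hs3 e3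
  simp only [Matrix.cons_val] at h2 h3 h5 e0 e1 e2 e3 q0 q1 q2 q3
  have hsign := congrArg Int.sign hprod
  have hσs : (5 * σ).sign = σ := by rcases hσ with rfl | rfl <;> rfl
  have hs0' : s0 = 1 := by rw [← sign_eq_of_eq hs0 hr0 e0, Int.sign_eq_one_of_pos hn]
  rw [Int.sign_eq_one_of_pos (by positivity : 0 < w ^ 2), Int.sign_mul, Int.sign_mul, Int.sign_mul,
    Int.sign_mul, hσs, sign_eq_of_eq hs0 hr0 e0, sign_eq_of_eq hs1 hr1 e1,
    sign_eq_of_eq hs2 hr2 e2, sign_eq_of_eq hs3 hr3 e3, hs0', one_mul] at hsign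
  have hσ2 : σ ^ 2 = 1 := by rcases hσ with rfl | rfl <;> norm_num
  replace hsign : s1 * s2 * s3 = σ := by
    linear_combination σ * hsign - s1 * s2 * s3 * hσ2
  clear z hev hsum hP hF
  generalize padicValInt 2 n = a0, padicValInt 3 n = b0, padicValInt 5 n = d0,
    padicValInt 2 m = a1, padicValInt 3 m = b1, padicValInt 5 m = d1,
    padicValInt 2 (m - n) = a2, padicValInt 3 (m - n) = b2, padicValInt 5 (m - n) = d2,
    padicValInt 2 (m + 2 * n) = a3, padicValInt 3 (m + 2 * n) = b3,
    padicValInt 5 (m + 2 * n) = d3 at *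
  obtain ⟨A0, A2, B0, B1, hpat⟩ := valuation_patterns h2 h3 h5 c2 c3 c5 z0 z1 z2 z3 q0 q1 q2 q3
  clear z0 z1 z2 z3 q0 q1 q2 q3 c2 c5 h2 h3 h5
  subst hs0'
  have t0 := sq_pos_and_emod_three hr0
  have t1 := sq_pos_and_emod_three hr1
  have t2 := sq_pos_and_emod_three hr2
  have t3 := sq_pos_and_emod_three hr3
  have habs := le_max_left |m| n
  have hmax := le_max_right |m| n
  rcases hpat with ⟨A1, A3, B2, B3, D0, D1, D2, D3⟩ | ⟨A1, A3, B2, B3, D0, D1, D2, D3⟩ |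
    ⟨A1, A3, B2, B3, D0, D1, D2, D3⟩ | ⟨A1, A3, B2, B3, D0, D1, D2, D3⟩ <;>
    simp only [A0, A1, A2, A3, B0, B1, B2, B3, D0, D1, D2, D3, pow_zero, pow_one, mul_one,
      one_mul] at e0 e1 e2 e3 <;>
    clear A0 A1 A2 A3 B0 B1 B2 B3 D0 D1 D2 D3
  · obtain ⟨rfl, rfl, rfl⟩ := signs_infty hσ c3 hs1 hs2 hs3 hsign t0 t1 t2 t3 e0 e1 e2 e3
    exact ⟨m, n, 5 * r0 * r1, 5 * r0 * r2, 5 * r0 * r3, hm0, hn0, by grind, by grind, by grind,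
      by grind⟩
  · obtain ⟨rfl, rfl, rfl⟩ := signs_zero hσ c3 hs1 hs2 hs3 hsign t0 t1 t2 t3 e0 e1 e2 e3
    exact ⟨-2 * n, m, 10 * r0 * r1, 10 * r1 * r3, 10 * r1 * r2, by omega, hm0, by grind, by grind,
      by grind, by grind⟩
  · obtain ⟨rfl, rfl, rfl⟩ := signs_one hσ c3 hs1 hs2 hs3 hsign t0 t1 t2 t3 e0 e1 e2 e3
    exact ⟨m + 2 * n, m - n, 15 * r3 * r2, 15 * r0 * r2, 15 * r1 * r2, h20, h10, by grind,
      by grind, by grind, by grind⟩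
  · obtain ⟨rfl, rfl, rfl⟩ := signs_two hσ c3 hs1 hs2 hs3 hsign t0 t1 t2 t3 e0 e1 e2 e3
    exact ⟨2 * n - 2 * m, m + 2 * n, 30 * r2 * r3, 30 * r1 * r3, 30 * r0 * r3, by omega, h20,
      by grind, by grind, by grind, by grind⟩

lemma dvd_of_dvd_mul_pow {m n d A : ℤ} {k : ℕ} (hc : IsCoprime m n) (h₁ : d ∣ A * n ^ k)
    (h₂ : d ∣ A * m ^ k) : d ∣ A := by
  obtain ⟨u, v, huv⟩ := hc.pow (m := k) (n := k)
  have : A = u * (A * m ^ k) + v * (A * n ^ k) := by linear_combination (-A) * huv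
  rw [this]
  exact dvd_add (h₂.mul_left _) (h₁.mul_left _)

theorem eq_zero_of_five_mul {σ : ℤ} (hσ : σ = 1 ∨ σ = -1) {t y : ℚ}
    (h : 5 * σ * t * (t - 1) * (t + 2) = y ^ 2) : y = 0 := by
  have h' : ((5 * σ : ℤ) : ℚ) * t * (t - (1 : ℤ)) * (t - (-2 : ℤ)) = y ^ 2 := by
    push_cast; rw [← h]; ring
  refine eq_zero_of_descent (K := 4) (R := 144) (B := 8) (by omega) (by norm_num) (by norm_num)
    ?_ (fun m n w hn hc h hw => descent_step_five hσ hn hc h hw) ?_ (by norm_num) (by norm_num) h'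
  · intro m n d hc hN hD
    refine dvd_of_dvd_mul_pow (k := 7) hc ?_ ?_
    · have : 144 * n ^ 7 = (36 * n ^ 3 - 8 * m * n ^ 2 - 12 * m ^ 2 * n) *
          (m ^ 2 - 1 * -2 * n ^ 2) ^ 2 + (-4 * n ^ 3 + 10 * m * n ^ 2 - m ^ 2 * n + 3 * m ^ 3) *
          (4 * (n * m * (m - 1 * n) * (m - -2 * n))) := by ring
      rw [this]
      exact dvd_add (hN.mul_left _) (hD.mul_left _)
    · have : 144 * m ^ 7 = 16 * ((-12 * m * n ^ 2 + 4 * m ^ 2 * n + 9 * m ^ 3) *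
          (m ^ 2 - 1 * -2 * n ^ 2) ^ 2 + (-6 * n ^ 3 - m * n ^ 2 - 5 * m ^ 2 * n - m ^ 3) *
          (4 * (n * m * (m - 1 * n) * (m - -2 * n)))) := by ring
      rw [this]
      exact (dvd_add (hN.mul_left _) (hD.mul_left _)).mul_left _
  · have key : ∀ s ∈ ({1, -1} : Finset ℤ), ∀ m ∈ Finset.Icc (-8 : ℤ) 8, ∀ n ∈ Finset.Icc (1 : ℤ) 8,
        IsSquare (n * m * (m - 1 * n) * (m - -2 * n) * (5 * s)) →
          n * m * (m - 1 * n) * (m - -2 * n) * (5 * s) = 0 := by decide +kernel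
    intro m n w hn hm hn' h
    rw [abs_le] at hm
    have := key σ (by simpa using hσ) m (Finset.mem_Icc.mpr hm)
      n (Finset.mem_Icc.mpr ⟨hn, hn'⟩) ⟨w, by rw [h, sq]⟩
    rw [h] at this
    exact pow_eq_zero_iff two_ne_zero |>.mp this

lemma valuation_patterns_split {m n : ℤ} {a₀ a₁ a₂ a₃ b₀ b₁ b₂ b₃ d₀ d₁ d₂ d₃ : ℕ}
    (h2 : (a₀ + a₁ + a₂ + a₃) % 2 = 0) (h3 : (b₀ + b₁ + b₂ + b₃) % 2 = 0)
    (h5 : (d₀ + d₁ + d₂ + d₃) % 2 = 0)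
    (c2 : ¬ (m % 2 = 0 ∧ n % 2 = 0)) (c3 : ¬ (m % 3 = 0 ∧ n % 3 = 0))
    (c5 : ¬ (m % 5 = 0 ∧ n % 5 = 0))
    (z₀ : (n % 2 ≠ 0 → a₀ = 0) ∧ (n % 3 ≠ 0 → b₀ = 0) ∧ (n % 5 ≠ 0 → d₀ = 0))
    (z₁ : (m % 2 ≠ 0 → a₁ = 0) ∧ (m % 3 ≠ 0 → b₁ = 0) ∧ (m % 5 ≠ 0 → d₁ = 0))
    (z₂ : ((m + n) % 2 ≠ 0 → a₂ = 0) ∧ ((m + n) % 3 ≠ 0 → b₂ = 0) ∧ ((m + n) % 5 ≠ 0 → d₂ = 0))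
    (z₃ : ((m - 8 * n) % 2 ≠ 0 → a₃ = 0) ∧ ((m - 8 * n) % 3 ≠ 0 → b₃ = 0) ∧
      ((m - 8 * n) % 5 ≠ 0 → d₃ = 0)) :
    (a₀ % 2 = 0 ∧ a₂ % 2 = 0 ∧ (a₁ + a₃) % 2 = 0) ∧
      (b₀ % 2 = 0 ∧ b₁ % 2 = 0 ∧ (b₂ + b₃) % 2 = 0) ∧
      d₀ % 2 = 0 ∧ d₁ % 2 = 0 ∧ d₂ % 2 = 0 ∧ d₃ % 2 = 0 := by
  obtain ⟨z2₀, z3₀, z5₀⟩ := z₀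
  obtain ⟨z2₁, z3₁, z5₁⟩ := z₁
  obtain ⟨z2₂, z3₂, z5₂⟩ := z₂
  obtain ⟨z2₃, z3₃, z5₃⟩ := z₃
  refine ⟨?_, ?_, ?_⟩
  · clear z3₀ z3₁ z3₂ z3₃ h3 c3 z5₀ z5₁ z5₂ z5₃ h5 c5
    have hm : m % 2 = 0 ∨ m % 2 = 1 := by omega
    have hn : n % 2 = 0 ∨ n % 2 = 1 := by omega
    rw [Int.add_emod] at z2₂
    rw [Int.sub_emod, Int.mul_emod] at z2₃
    rcases hm with hm | hm <;> rcases hn with hn | hn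
    · exact absurd ⟨hm, hn⟩ c2
    all_goals norm_num [hm, hn] at z2₀ z2₁ z2₂ z2₃; omega
  · clear z2₀ z2₁ z2₂ z2₃ h2 c2 z5₀ z5₁ z5₂ z5₃ h5 c5
    have hm : m % 3 = 0 ∨ m % 3 = 1 ∨ m % 3 = 2 := by omega
    have hn : n % 3 = 0 ∨ n % 3 = 1 ∨ n % 3 = 2 := by omega
    rw [Int.add_emod] at z3₂
    rw [Int.sub_emod, Int.mul_emod] at z3₃
    rcases hm with hm | hm | hm <;> rcases hn with hn | hn | hn
    · exact absurd ⟨hm, hn⟩ c3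
    all_goals norm_num [hm, hn] at z3₀ z3₁ z3₂ z3₃; omega
  · clear z2₀ z2₁ z2₂ z2₃ h2 c2 z3₀ z3₁ z3₂ z3₃ h3 c3
    have hm : m % 5 = 0 ∨ m % 5 = 1 ∨ m % 5 = 2 ∨ m % 5 = 3 ∨ m % 5 = 4 := by omega
    have hn : n % 5 = 0 ∨ n % 5 = 1 ∨ n % 5 = 2 ∨ n % 5 = 3 ∨ n % 5 = 4 := by omega
    rw [Int.add_emod] at z5₂
    rw [Int.sub_emod, Int.mul_emod] at z5₃
    rcases hm with hm | hm | hm | hm | hm <;> rcases hn with hn | hn | hn | hn | hn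
    · exact absurd ⟨hm, hn⟩ c5
    all_goals norm_num [hm, hn] at z5₀ z5₁ z5₂ z5₃; omega

lemma signs_split {m n s₁ s₂ s₃ R₀ R₁ R₂ R₃ : ℤ} {a b : ℕ}
    (c3 : ¬ (m % 3 = 0 ∧ n % 3 = 0)) (hs₁ : s₁ = 1 ∨ s₁ = -1) (hs₂ : s₂ = 1 ∨ s₂ = -1)
    (hs₃ : s₃ = 1 ∨ s₃ = -1) (hs : s₁ * s₂ * s₃ = 1) (h₀ : 0 < R₀ ∧ (R₀ % 3 = 1 ∨ R₀ % 9 = 0))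
    (h₁ : 0 < R₁ ∧ (R₁ % 3 = 1 ∨ R₁ % 9 = 0)) (h₂ : 0 < R₂ ∧ (R₂ % 3 = 1 ∨ R₂ % 9 = 0))
    (h₃ : 0 < R₃ ∧ (R₃ % 3 = 1 ∨ R₃ % 9 = 0)) (e₀ : n = R₀) (e₁ : m = s₁ * 2 ^ (a % 2) * R₁)
    (e₂ : m + n = s₂ * 3 ^ (b % 2) * R₂) (e₃ : m - 8 * n = s₃ * 2 ^ (a % 2) * 3 ^ (b % 2) * R₃) :
    b % 2 = 0 ∧ s₂ = 1 := by
  rcases Nat.mod_two_eq_zero_or_one a with ha | ha <;>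
    rcases Nat.mod_two_eq_zero_or_one b with hb | hb <;> rw [ha, hb] at e₃ <;> rw [ha] at e₁ <;>
    rw [hb] at e₂ ⊢ <;> clear ha hb <;>
    simp only [pow_zero, pow_one, mul_one] at e₁ e₂ e₃ <;>
    rcases hs₁ with rfl | rfl <;> rcases hs₂ with rfl | rfl <;> rcases hs₃ with rfl | rfl <;> omega

lemma descent_step_split {m n w : ℤ} (hn : 0 < n) (hc : IsCoprime m n)
    (h : n * m * (m - (-1) * n) * (m - 8 * n) * 1 = w ^ 2) (hw : w ≠ 0) :
    ∃ T U a b c : ℤ, T ≠ 0 ∧ U ≠ 0 ∧ T * U * 1 = a ^ 2 ∧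
      (T - (-1) * U) * U * 1 = b ^ 2 ∧ (T - 8 * U) * U * 1 = c ^ 2 ∧
      |T| ≤ 16 * max |m| n := by
  have hprod : n * m * (m + n) * (m - 8 * n) * 1 = w ^ 2 := by rw [← h]; ring
  have hne := pow_ne_zero 2 hw
  rw [← hprod] at hne
  simp only [mul_ne_zero_iff] at hne
  obtain ⟨⟨⟨⟨hn0, hm0⟩, h10⟩, h20⟩, -⟩ := hne
  have hF : ∀ i, (![n, m, m + n, m - 8 * n] : Fin 4 → ℤ) i ≠ 0 := by
    intro i; fin_cases i <;> simpa
  have hP : (∏ i, (![n, m, m + n, m - 8 * n] : Fin 4 → ℤ) i) * 1 = w ^ 2 := by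
    rw [Fin.prod_univ_four]; exact hprod
  have hev := linear_forms_padicValInt_even (F := ![n, m, m + n, m - 8 * n]) ![0, 1, 1, 1]
    ![1, 0, 1, -8] (by intro i; fin_cases i <;> simp [sub_eq_add_neg]) (by decide) hc hF
    (by decide) hP
  have hsum := sum_padicValInt_parity hF one_ne_zero hP
  have h2 := hsum 2
  have h3 := hsum 3
  have : Fact (Nat.Prime 5) := ⟨Nat.prime_five⟩
  have h5 := hsum 5
  rw [padicValInt.one, Fin.sum_univ_four] at h2 h3 h5
  have c2 := not_emod_eq_zero_of_isCoprime hc 2 (by norm_num)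
  have c3 := not_emod_eq_zero_of_isCoprime hc 3 (by norm_num)
  have c5 := not_emod_eq_zero_of_isCoprime hc 5 (by norm_num)
  obtain ⟨s0, r0, hs0, hr0, e0⟩ := exists_eq_sign_mul_sq hn0 (hev 0)
  obtain ⟨s1, r1, hs1, hr1, e1⟩ := exists_eq_sign_mul_sq hm0 (hev 1)
  obtain ⟨s2, r2, hs2, hr2, e2⟩ := exists_eq_sign_mul_sq h10 (hev 2)
  obtain ⟨s3, r3, hs3, hr3, e3⟩ := exists_eq_sign_mul_sq h20 (hev 3)
  have z (x : ℤ) : (x % 2 ≠ 0 → padicValInt 2 x = 0) ∧ (x % 3 ≠ 0 → padicValInt 3 x = 0) ∧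
      (x % 5 ≠ 0 → padicValInt 5 x = 0) :=
    ⟨padicValInt_eq_zero_of_emod, padicValInt_eq_zero_of_emod, padicValInt_eq_zero_of_emod⟩
  obtain ⟨⟨A0, A2, A13⟩, ⟨B0, B1, B23⟩, D0, D1, D2, D3⟩ :=
    valuation_patterns_split h2 h3 h5 c2 c3 c5 (z n) (z m) (z (m + n)) (z (m - 8 * n))
  simp only [Matrix.cons_val] at A0 A2 A13 B0 B1 B23 D0 D1 D2 D3 e0 e1 e2 e3
  have hsign := congrArg Int.sign hprod
  have hs0' : s0 = 1 := by rw [← sign_eq_of_eq hs0 hr0 e0, Int.sign_eq_one_of_pos hn]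
  rw [Int.sign_eq_one_of_pos (by positivity : 0 < w ^ 2), mul_one, Int.sign_mul, Int.sign_mul,
    Int.sign_mul, sign_eq_of_eq hs0 hr0 e0, sign_eq_of_eq hs1 hr1 e1,
    sign_eq_of_eq hs2 hr2 e2, sign_eq_of_eq hs3 hr3 e3, hs0', one_mul] at hsign
  have A3 : padicValInt 2 (m - 8 * n) % 2 = padicValInt 2 m % 2 := by omega
  have B3 : padicValInt 3 (m - 8 * n) % 2 = padicValInt 3 (m + n) % 2 := by omega
  subst hs0'
  simp only [A0, A2, A3, B0, B1, B3, D0, D1, D2, D3, pow_zero, mul_one, one_mul] at e0 e1 e2 e3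
  obtain ⟨hb, rfl⟩ := signs_split c3 hs1 hs2 hs3 hsign (sq_pos_and_emod_three hr0)
    (sq_pos_and_emod_three hr1) (sq_pos_and_emod_three hr2) (sq_pos_and_emod_three hr3) e0 e1 e2 e3
  have habs := le_max_left |m| n
  have hmax := le_max_right |m| n
  rw [hb] at e2 e3
  obtain rfl : s3 = s1 := by
    rcases hs1 with rfl | rfl <;> rcases hs3 with rfl | rfl <;> first | rfl | (norm_num at hsign)
  clear hs0 hs2 hs3 hsign hev hsum hP hF z h2 h3 h5 c2 c3 c5 A0 A2 A13 B0 B1 B23 D0 D1 D2 D3 A3 B3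
    hb
  rcases Nat.mod_two_eq_zero_or_one (padicValInt 2 m) with ha | ha <;> rw [ha] at e1 e3 <;>
    clear ha <;> rcases hs1 with rfl | rfl
  · exact ⟨m, n, r0 * r1, r0 * r2, r0 * r3, hm0, hn0, by grind, by grind, by grind, by grind⟩
  · exact ⟨8 * n - m, m + n, r2 * r3, 3 * r0 * r2, 3 * r1 * r2, by omega, h10, by grind,
      by grind, by grind, by grind⟩
  · exact ⟨8 * m + 8 * n, m - 8 * n, 4 * r2 * r3, 6 * r1 * r3, 12 * r0 * r3, by omega, h20,
      by grind, by grind, by grind, by grind⟩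
  · exact ⟨-8 * n, m, 4 * r0 * r1, 2 * r1 * r3, 4 * r1 * r2, by omega, hm0,
      by grind, by grind, by grind, by grind⟩

theorem eq_zero_of_split {t y : ℚ} (h : t * (t + 1) * (t - 8) = y ^ 2) : y = 0 := by
  have h' : ((1 : ℤ) : ℚ) * t * (t - (-1 : ℤ)) * (t - (8 : ℤ)) = y ^ 2 := by
    push_cast; rw [← h]; ring
  refine eq_zero_of_descent (K := 16) (R := 20736) (B := 69) (by norm_num) (by norm_num)
    (by norm_num) ?_ (fun m n w hn hc h hw => descent_step_split hn hc h hw) ?_ (by norm_num)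
    (by norm_num) h'
  · intro m n d hc hN hD
    refine dvd_of_dvd_mul_pow (k := 7) hc ?_ ?_
    · have : 20736 * n ^ 7 = (324 * n ^ 3 + 56 * m * n ^ 2 - 12 * m ^ 2 * n) *
          (m ^ 2 - -1 * 8 * n ^ 2) ^ 2 + (112 * n ^ 3 + 40 * m * n ^ 2 + 7 * m ^ 2 * n +
            3 * m ^ 3) * (4 * (n * m * (m - -1 * n) * (m - 8 * n))) := by ring
      rw [this]
      exact dvd_add (hN.mul_left _) (hD.mul_left _)
    · have : 20736 * m ^ 7 = 256 * ((-192 * m * n ^ 2 - 112 * m ^ 2 * n + 81 * m ^ 3) *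
          (m ^ 2 - -1 * 8 * n ^ 2) ^ 2 + (-384 * n ^ 3 + 112 * m * n ^ 2 - 80 * m ^ 2 * n +
            28 * m ^ 3) * (4 * (n * m * (m - -1 * n) * (m - 8 * n)))) := by ring
      rw [this]
      exact (dvd_add (hN.mul_left _) (hD.mul_left _)).mul_left _
  · have key : ∀ m ∈ Finset.Icc (-69 : ℤ) 69, ∀ n ∈ Finset.Icc (1 : ℤ) 69,
        IsSquare (n * m * (m - -1 * n) * (m - 8 * n) * 1) →
          n * m * (m - -1 * n) * (m - 8 * n) * 1 = 0 := by decide +kernel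
    intro m n w hn hm hn' h
    rw [abs_le] at hm
    have := key m (Finset.mem_Icc.mpr hm) n (Finset.mem_Icc.mpr ⟨hn, hn'⟩) ⟨w, by rw [h, sq]⟩
    rw [h] at this
    exact pow_eq_zero_iff two_ne_zero |>.mp this

/-- A sign condition on the six linear forms when `5` divides `b`. -/
lemma sextic_signs_infty {b c s₁ s₂ s₃ s₄ s₅ R₀ R₁ R₂ R₃ R₄ R₅ : ℤ} (c3 : ¬ (c % 3 = 0 ∧ b % 3 = 0))
    (hs₁ : s₁ = 1 ∨ s₁ = -1) (hs₂ : s₂ = 1 ∨ s₂ = -1) (hs₃ : s₃ = 1 ∨ s₃ = -1)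
    (hs₄ : s₄ = 1 ∨ s₄ = -1) (hs₅ : s₅ = 1 ∨ s₅ = -1) (hs : s₁ * s₂ * s₃ * s₄ * s₅ = 1)
    (h₀ : 0 < R₀ ∧ (R₀ % 3 = 1 ∨ R₀ % 9 = 0)) (h₁ : 0 < R₁ ∧ (R₁ % 3 = 1 ∨ R₁ % 9 = 0))
    (h₂ : 0 < R₂ ∧ (R₂ % 3 = 1 ∨ R₂ % 9 = 0)) (h₃ : 0 < R₃ ∧ (R₃ % 3 = 1 ∨ R₃ % 9 = 0))
    (h₄ : 0 < R₄ ∧ (R₄ % 3 = 1 ∨ R₄ % 9 = 0)) (h₅ : 0 < R₅ ∧ (R₅ % 3 = 1 ∨ R₅ % 9 = 0))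
    (e₀ : b = 5 * R₀) (e₁ : c = s₁ * R₁) (e₂ : c - b = s₂ * R₂) (e₃ : c + b = s₃ * R₃)
    (e₄ : c - 2 * b = s₄ * R₄) (e₅ : c + 2 * b = s₅ * R₅) : s₃ = s₄ := by
  rcases hs₁ with rfl | rfl <;> rcases hs₂ with rfl | rfl <;> rcases hs₃ with rfl | rfl <;>
    rcases hs₄ with rfl | rfl <;> rcases hs₅ with rfl | rfl <;> omega

/-- A sign condition on the six linear forms when `5` divides `c`. -/
lemma sextic_signs_zero {b c s₁ s₂ s₃ s₄ s₅ R₀ R₁ R₂ R₃ R₄ R₅ : ℤ} (hs₁ : s₁ = 1 ∨ s₁ = -1)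
    (hs₂ : s₂ = 1 ∨ s₂ = -1) (hs₃ : s₃ = 1 ∨ s₃ = -1) (hs₄ : s₄ = 1 ∨ s₄ = -1)
    (hs₅ : s₅ = 1 ∨ s₅ = -1) (hs : s₁ * s₂ * s₃ * s₄ * s₅ = 1)
    (h₀ : 0 < R₀ ∧ (R₀ % 3 = 1 ∨ R₀ % 9 = 0)) (h₁ : 0 < R₁ ∧ (R₁ % 3 = 1 ∨ R₁ % 9 = 0))
    (h₂ : 0 < R₂ ∧ (R₂ % 3 = 1 ∨ R₂ % 9 = 0)) (h₃ : 0 < R₃ ∧ (R₃ % 3 = 1 ∨ R₃ % 9 = 0))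
    (h₄ : 0 < R₄ ∧ (R₄ % 3 = 1 ∨ R₄ % 9 = 0)) (h₅ : 0 < R₅ ∧ (R₅ % 3 = 1 ∨ R₅ % 9 = 0))
    (e₀ : b = R₀) (e₁ : c = s₁ * 5 * R₁) (e₂ : c - b = s₂ * R₂) (e₃ : c + b = s₃ * R₃)
    (e₄ : c - 2 * b = s₄ * 2 * R₄) (e₅ : c + 2 * b = s₅ * 2 * R₅) : s₁ = s₃ := by
  rcases hs₁ with rfl | rfl <;> rcases hs₂ with rfl | rfl <;> rcases hs₃ with rfl | rfl <;>
    rcases hs₄ with rfl | rfl <;> rcases hs₅ with rfl | rfl <;> omega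

/-- A sign condition on the six linear forms when `5` divides `c - b`. -/
lemma sextic_signs_one_odd {b c s₁ s₂ s₃ s₄ s₅ R₀ R₁ R₂ R₃ R₄ R₅ : ℤ}
    (c3 : ¬ (c % 3 = 0 ∧ b % 3 = 0))
    (hs₁ : s₁ = 1 ∨ s₁ = -1) (hs₂ : s₂ = 1 ∨ s₂ = -1) (hs₃ : s₃ = 1 ∨ s₃ = -1)
    (hs₄ : s₄ = 1 ∨ s₄ = -1) (hs₅ : s₅ = 1 ∨ s₅ = -1) (hs : s₁ * s₂ * s₃ * s₄ * s₅ = 1)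
    (h₀ : 0 < R₀ ∧ (R₀ % 3 = 1 ∨ R₀ % 9 = 0)) (h₁ : 0 < R₁ ∧ (R₁ % 3 = 1 ∨ R₁ % 9 = 0))
    (h₂ : 0 < R₂ ∧ (R₂ % 3 = 1 ∨ R₂ % 9 = 0)) (h₃ : 0 < R₃ ∧ (R₃ % 3 = 1 ∨ R₃ % 9 = 0))
    (h₄ : 0 < R₄ ∧ (R₄ % 3 = 1 ∨ R₄ % 9 = 0)) (h₅ : 0 < R₅ ∧ (R₅ % 3 = 1 ∨ R₅ % 9 = 0))
    (e₀ : b = R₀) (e₁ : c = s₁ * R₁) (e₂ : c - b = s₂ * 2 * 3 * 5 * R₂) (e₃ : c + b = s₃ * 2 * R₃)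
    (e₄ : c - 2 * b = s₄ * R₄) (e₅ : c + 2 * b = s₅ * 3 * R₅) : s₁ = -s₄ := by
  rcases hs₁ with rfl | rfl <;> rcases hs₂ with rfl | rfl <;> rcases hs₃ with rfl | rfl <;>
    rcases hs₄ with rfl | rfl <;> rcases hs₅ with rfl | rfl <;> omega

/-- A sign condition on the six linear forms when `5` divides `c - b`. -/
lemma sextic_signs_one_even {b c s₁ s₂ s₃ s₄ s₅ R₀ R₁ R₂ R₃ R₄ R₅ : ℤ}
    (c3 : ¬ (c % 3 = 0 ∧ b % 3 = 0))
    (hs₁ : s₁ = 1 ∨ s₁ = -1) (hs₂ : s₂ = 1 ∨ s₂ = -1) (hs₃ : s₃ = 1 ∨ s₃ = -1)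
    (hs₄ : s₄ = 1 ∨ s₄ = -1) (hs₅ : s₅ = 1 ∨ s₅ = -1) (hs : s₁ * s₂ * s₃ * s₄ * s₅ = 1)
    (h₀ : 0 < R₀ ∧ (R₀ % 3 = 1 ∨ R₀ % 9 = 0)) (h₁ : 0 < R₁ ∧ (R₁ % 3 = 1 ∨ R₁ % 9 = 0))
    (h₂ : 0 < R₂ ∧ (R₂ % 3 = 1 ∨ R₂ % 9 = 0)) (h₃ : 0 < R₃ ∧ (R₃ % 3 = 1 ∨ R₃ % 9 = 0))
    (h₄ : 0 < R₄ ∧ (R₄ % 3 = 1 ∨ R₄ % 9 = 0)) (h₅ : 0 < R₅ ∧ (R₅ % 3 = 1 ∨ R₅ % 9 = 0))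
    (e₀ : b = R₀) (e₁ : c = s₁ * R₁) (e₂ : c - b = s₂ * 5 * R₂) (e₃ : c + b = s₃ * 3 * R₃)
    (e₄ : c - 2 * b = s₄ * 2 * 3 * R₄) (e₅ : c + 2 * b = s₅ * 2 * R₅) : False := by
  have hd : (c + b) % 3 = 0 := Int.emod_eq_zero_of_dvd ⟨s₃ * R₃, by rw [e₃]; ring⟩
  have hb : b % 3 = 1 := by clear * - hd c3 h₀ e₀; omega
  have hc : c % 3 = 2 := by clear * - hd hb; omega
  have h1 : s₁ = -1 := by
    clear * - hc hs₁ h₁ e₁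
    rcases hs₁ with rfl | rfl <;> omega
  have h5 : s₅ = -1 := by
    clear * - hc hb hs₅ h₅ e₅
    rcases hs₅ with rfl | rfl <;> omega
  subst h1 h5
  clear hd hb hc c3
  rcases hs₂ with rfl | rfl <;> rcases hs₃ with rfl | rfl <;> rcases hs₄ with rfl | rfl <;> omega

/-- A sign condition on the six linear forms when `5` divides `c + b`. -/
lemma sextic_signs_neg_one_odd {b c s₁ s₃ s₅ R₀ R₁ R₃ R₅ : ℤ} (c3 : ¬ (c % 3 = 0 ∧ b % 3 = 0))
    (hs₁ : s₁ = 1 ∨ s₁ = -1) (hs₅ : s₅ = 1 ∨ s₅ = -1) (h₀ : 0 < R₀ ∧ (R₀ % 3 = 1 ∨ R₀ % 9 = 0))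
    (h₁ : 0 < R₁ ∧ (R₁ % 3 = 1 ∨ R₁ % 9 = 0)) (h₅ : 0 < R₅ ∧ (R₅ % 3 = 1 ∨ R₅ % 9 = 0))
    (e₀ : b = R₀) (e₁ : c = s₁ * R₁) (e₃ : c + b = s₃ * 2 * 3 * 5 * R₃) (e₅ : c + 2 * b = s₅ * R₅) :
    s₁ = -s₅ := by
  have hd : (c + b) % 3 = 0 := Int.emod_eq_zero_of_dvd ⟨s₃ * 10 * R₃, by rw [e₃]; ring⟩
  have hb : b % 3 = 1 := by clear * - hd c3 h₀ e₀; omega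
  have hc : c % 3 = 2 := by clear * - hd hb; omega
  have h1 : s₁ = -1 := by
    clear * - hc hs₁ h₁ e₁
    rcases hs₁ with rfl | rfl <;> omega
  have h5 : s₅ = 1 := by
    clear * - hc hb hs₅ h₅ e₅
    rcases hs₅ with rfl | rfl <;> omega
  rw [h1, h5]

/-- A sign condition on the six linear forms when `5` divides `c + b`. -/
lemma sextic_signs_neg_one_even {b c s₁ s₂ s₃ s₄ s₅ R₀ R₁ R₂ R₃ R₄ R₅ : ℤ} (hs₁ : s₁ = 1 ∨ s₁ = -1)
    (hs₂ : s₂ = 1 ∨ s₂ = -1) (hs₃ : s₃ = 1 ∨ s₃ = -1) (hs₄ : s₄ = 1 ∨ s₄ = -1)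
    (hs₅ : s₅ = 1 ∨ s₅ = -1) (hs : s₁ * s₂ * s₃ * s₄ * s₅ = 1)
    (h₀ : 0 < R₀ ∧ (R₀ % 3 = 1 ∨ R₀ % 9 = 0)) (h₁ : 0 < R₁ ∧ (R₁ % 3 = 1 ∨ R₁ % 9 = 0))
    (h₂ : 0 < R₂ ∧ (R₂ % 3 = 1 ∨ R₂ % 9 = 0)) (h₃ : 0 < R₃ ∧ (R₃ % 3 = 1 ∨ R₃ % 9 = 0))
    (h₄ : 0 < R₄ ∧ (R₄ % 3 = 1 ∨ R₄ % 9 = 0)) (h₅ : 0 < R₅ ∧ (R₅ % 3 = 1 ∨ R₅ % 9 = 0))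
    (e₀ : b = R₀) (e₁ : c = s₁ * R₁) (e₂ : c - b = s₂ * 3 * R₂) (e₃ : c + b = s₃ * 5 * R₃)
    (e₄ : c - 2 * b = s₄ * 2 * R₄) (e₅ : c + 2 * b = s₅ * 2 * 3 * R₅) : s₁ = s₃ := by
  rcases hs₁ with rfl | rfl <;> rcases hs₂ with rfl | rfl <;> rcases hs₃ with rfl | rfl <;>
    rcases hs₄ with rfl | rfl <;> rcases hs₅ with rfl | rfl <;> omega

/-- A sign condition on the six linear forms when `5` divides `c - 2 * b`. -/
lemma sextic_signs_two {b c s₁ s₂ s₃ s₄ s₅ R₀ R₁ R₂ R₃ R₄ R₅ : ℤ} (c3 : ¬ (c % 3 = 0 ∧ b % 3 = 0))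
    (hs₁ : s₁ = 1 ∨ s₁ = -1) (hs₂ : s₂ = 1 ∨ s₂ = -1) (hs₃ : s₃ = 1 ∨ s₃ = -1)
    (hs₄ : s₄ = 1 ∨ s₄ = -1) (hs₅ : s₅ = 1 ∨ s₅ = -1) (hs : s₁ * s₂ * s₃ * s₄ * s₅ = 1)
    (h₀ : 0 < R₀ ∧ (R₀ % 3 = 1 ∨ R₀ % 9 = 0)) (h₁ : 0 < R₁ ∧ (R₁ % 3 = 1 ∨ R₁ % 9 = 0))
    (h₂ : 0 < R₂ ∧ (R₂ % 3 = 1 ∨ R₂ % 9 = 0)) (h₃ : 0 < R₃ ∧ (R₃ % 3 = 1 ∨ R₃ % 9 = 0))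
    (h₄ : 0 < R₄ ∧ (R₄ % 3 = 1 ∨ R₄ % 9 = 0)) (h₅ : 0 < R₅ ∧ (R₅ % 3 = 1 ∨ R₅ % 9 = 0))
    (e₀ : b = R₀) (e₁ : c = s₁ * 2 * R₁) (e₂ : c - b = s₂ * R₂) (e₃ : c + b = s₃ * 3 * R₃)
    (e₄ : c - 2 * b = s₄ * 2 * 3 * 5 * R₄) (e₅ : c + 2 * b = s₅ * R₅) : s₂ = s₅ := by
  rcases hs₁ with rfl | rfl <;> rcases hs₂ with rfl | rfl <;> rcases hs₃ with rfl | rfl <;>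
    rcases hs₄ with rfl | rfl <;> rcases hs₅ with rfl | rfl <;> omega

/-- A sign condition on the six linear forms when `5` divides `c + 2 * b`. -/
lemma sextic_signs_neg_two {b c s₁ s₂ s₃ s₄ s₅ R₀ R₁ R₂ R₃ R₄ R₅ : ℤ}
    (c3 : ¬ (c % 3 = 0 ∧ b % 3 = 0))
    (hs₁ : s₁ = 1 ∨ s₁ = -1) (hs₂ : s₂ = 1 ∨ s₂ = -1) (hs₃ : s₃ = 1 ∨ s₃ = -1)
    (hs₄ : s₄ = 1 ∨ s₄ = -1) (hs₅ : s₅ = 1 ∨ s₅ = -1) (hs : s₁ * s₂ * s₃ * s₄ * s₅ = 1)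
    (h₀ : 0 < R₀ ∧ (R₀ % 3 = 1 ∨ R₀ % 9 = 0)) (h₁ : 0 < R₁ ∧ (R₁ % 3 = 1 ∨ R₁ % 9 = 0))
    (h₂ : 0 < R₂ ∧ (R₂ % 3 = 1 ∨ R₂ % 9 = 0)) (h₃ : 0 < R₃ ∧ (R₃ % 3 = 1 ∨ R₃ % 9 = 0))
    (h₄ : 0 < R₄ ∧ (R₄ % 3 = 1 ∨ R₄ % 9 = 0)) (h₅ : 0 < R₅ ∧ (R₅ % 3 = 1 ∨ R₅ % 9 = 0))
    (e₀ : b = R₀) (e₁ : c = s₁ * 2 * R₁) (e₂ : c - b = s₂ * 3 * R₂) (e₃ : c + b = s₃ * R₃)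
    (e₄ : c - 2 * b = s₄ * R₄) (e₅ : c + 2 * b = s₅ * 2 * 3 * 5 * R₅) : s₃ = s₄ := by
  rcases hs₁ with rfl | rfl <;> rcases hs₂ with rfl | rfl <;> rcases hs₃ with rfl | rfl <;>
    rcases hs₄ with rfl | rfl <;> rcases hs₅ with rfl | rfl <;> omega

lemma sextic_parity_at_two {b c : ℤ} {a₀ a₁ a₂ a₃ a₄ a₅ : ℕ}
    (h : (a₀ + a₁ + a₂ + a₃ + a₄ + a₅) % 2 = 0) (c2 : ¬ (c % 2 = 0 ∧ b % 2 = 0))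
    (z₀ : b % 2 ≠ 0 → a₀ = 0) (z₁ : c % 2 ≠ 0 → a₁ = 0) (z₂ : (c - b) % 2 ≠ 0 → a₂ = 0)
    (z₃ : (c + b) % 2 ≠ 0 → a₃ = 0) (z₄ : (c - 2 * b) % 2 ≠ 0 → a₄ = 0)
    (z₅ : (c + 2 * b) % 2 ≠ 0 → a₅ = 0) :
    a₀ % 2 = 0 ∧ ((a₁ = 0 ∧ a₄ = 0 ∧ a₅ = 0 ∧ (a₂ + a₃) % 2 = 0) ∨
      (a₂ = 0 ∧ a₃ = 0 ∧ (a₁ + a₄ + a₅) % 2 = 0)) := by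
  have hb : b % 2 = 0 ∨ b % 2 = 1 := by omega
  have hc : c % 2 = 0 ∨ c % 2 = 1 := by omega
  rw [Int.sub_emod] at z₂ z₄
  rw [Int.add_emod] at z₃ z₅
  rw [Int.mul_emod] at z₄ z₅
  rcases hb with hb | hb <;> rcases hc with hc | hc
  · exact absurd ⟨hc, hb⟩ c2
  all_goals norm_num [hb, hc] at z₀ z₁ z₂ z₃ z₄ z₅; omega

lemma sextic_parity_at_three {b c : ℤ} {a₀ a₁ a₂ a₃ a₄ a₅ : ℕ}
    (h : (a₀ + a₁ + a₂ + a₃ + a₄ + a₅) % 2 = 0) (c3 : ¬ (c % 3 = 0 ∧ b % 3 = 0))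
    (z₀ : b % 3 ≠ 0 → a₀ = 0) (z₁ : c % 3 ≠ 0 → a₁ = 0) (z₂ : (c - b) % 3 ≠ 0 → a₂ = 0)
    (z₃ : (c + b) % 3 ≠ 0 → a₃ = 0) (z₄ : (c - 2 * b) % 3 ≠ 0 → a₄ = 0)
    (z₅ : (c + 2 * b) % 3 ≠ 0 → a₅ = 0) :
    a₀ % 2 = 0 ∧ a₁ % 2 = 0 ∧ ((a₃ = 0 ∧ a₄ = 0 ∧ (a₂ + a₅) % 2 = 0) ∨
      (a₂ = 0 ∧ a₅ = 0 ∧ (a₃ + a₄) % 2 = 0)) := by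
  have hb : b % 3 = 0 ∨ b % 3 = 1 ∨ b % 3 = 2 := by omega
  have hc : c % 3 = 0 ∨ c % 3 = 1 ∨ c % 3 = 2 := by omega
  rw [Int.sub_emod] at z₂ z₄
  rw [Int.add_emod] at z₃ z₅
  rw [Int.mul_emod] at z₄ z₅
  rcases hb with hb | hb | hb <;> rcases hc with hc | hc | hc
  · exact absurd ⟨hc, hb⟩ c3
  all_goals norm_num [hb, hc] at z₀ z₁ z₂ z₃ z₄ z₅; omega

/-- Exactly one of the six linear forms is divisible by `5`, and the quadratic characters of the
others determine each other. -/
lemma sextic_parity_at_five {b c : ℤ} {x₀ x₁ x₂ x₃ x₄ x₅ d₀ d₁ d₂ d₃ d₄ d₅ : ℕ}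
    (h : (d₀ + d₁ + d₂ + d₃ + d₄ + d₅) % 2 = 1) (c5 : ¬ (c % 5 = 0 ∧ b % 5 = 0))
    (z₀ : b % 5 ≠ 0 → d₀ = 0) (z₁ : c % 5 ≠ 0 → d₁ = 0) (z₂ : (c - b) % 5 ≠ 0 → d₂ = 0)
    (z₃ : (c + b) % 5 ≠ 0 → d₃ = 0) (z₄ : (c - 2 * b) % 5 ≠ 0 → d₄ = 0)
    (z₅ : (c + 2 * b) % 5 ≠ 0 → d₅ = 0)
    (q₀ : b % 5 = 0 ∨ ((b % 5 = 1 ∨ b % 5 = 4) ∧ x₀ % 2 = 0) ∨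
      ((b % 5 = 2 ∨ b % 5 = 3) ∧ x₀ % 2 = 1))
    (q₁ : c % 5 = 0 ∨ ((c % 5 = 1 ∨ c % 5 = 4) ∧ x₁ % 2 = 0) ∨
      ((c % 5 = 2 ∨ c % 5 = 3) ∧ x₁ % 2 = 1))
    (q₂ : (c - b) % 5 = 0 ∨ (((c - b) % 5 = 1 ∨ (c - b) % 5 = 4) ∧ x₂ % 2 = 0) ∨
      (((c - b) % 5 = 2 ∨ (c - b) % 5 = 3) ∧ x₂ % 2 = 1))
    (q₃ : (c + b) % 5 = 0 ∨ (((c + b) % 5 = 1 ∨ (c + b) % 5 = 4) ∧ x₃ % 2 = 0) ∨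
      (((c + b) % 5 = 2 ∨ (c + b) % 5 = 3) ∧ x₃ % 2 = 1))
    (q₄ : (c - 2 * b) % 5 = 0 ∨ (((c - 2 * b) % 5 = 1 ∨ (c - 2 * b) % 5 = 4) ∧ x₄ % 2 = 0) ∨
      (((c - 2 * b) % 5 = 2 ∨ (c - 2 * b) % 5 = 3) ∧ x₄ % 2 = 1))
    (q₅ : (c + 2 * b) % 5 = 0 ∨ (((c + 2 * b) % 5 = 1 ∨ (c + 2 * b) % 5 = 4) ∧ x₅ % 2 = 0) ∨
      (((c + 2 * b) % 5 = 2 ∨ (c + 2 * b) % 5 = 3) ∧ x₅ % 2 = 1)) :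
    ([d₀ % 2, d₁ % 2, d₂ % 2, d₃ % 2, d₄ % 2, d₅ % 2] = [1, 0, 0, 0, 0, 0] ∧
      x₁ % 2 = x₂ % 2 ∧ x₁ % 2 = x₃ % 2 ∧ x₁ % 2 = x₄ % 2 ∧ x₁ % 2 = x₅ % 2) ∨
    ([d₀ % 2, d₁ % 2, d₂ % 2, d₃ % 2, d₄ % 2, d₅ % 2] = [0, 1, 0, 0, 0, 0] ∧
      x₀ % 2 = x₂ % 2 ∧ x₀ % 2 = x₃ % 2 ∧ x₀ % 2 ≠ x₄ % 2 ∧ x₀ % 2 ≠ x₅ % 2) ∨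
    ([d₀ % 2, d₁ % 2, d₂ % 2, d₃ % 2, d₄ % 2, d₅ % 2] = [0, 0, 1, 0, 0, 0] ∧
      x₀ % 2 = x₁ % 2 ∧ x₀ % 2 ≠ x₃ % 2 ∧ x₀ % 2 = x₄ % 2 ∧ x₀ % 2 ≠ x₅ % 2) ∨
    ([d₀ % 2, d₁ % 2, d₂ % 2, d₃ % 2, d₄ % 2, d₅ % 2] = [0, 0, 0, 1, 0, 0] ∧
      x₀ % 2 = x₁ % 2 ∧ x₀ % 2 ≠ x₂ % 2 ∧ x₀ % 2 ≠ x₄ % 2 ∧ x₀ % 2 = x₅ % 2) ∨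
    ([d₀ % 2, d₁ % 2, d₂ % 2, d₃ % 2, d₄ % 2, d₅ % 2] = [0, 0, 0, 0, 1, 0] ∧
      x₀ % 2 ≠ x₁ % 2 ∧ x₀ % 2 = x₂ % 2 ∧ x₀ % 2 ≠ x₃ % 2 ∧ x₀ % 2 = x₅ % 2) ∨
    ([d₀ % 2, d₁ % 2, d₂ % 2, d₃ % 2, d₄ % 2, d₅ % 2] = [0, 0, 0, 0, 0, 1] ∧
      x₀ % 2 ≠ x₁ % 2 ∧ x₀ % 2 ≠ x₂ % 2 ∧ x₀ % 2 = x₃ % 2 ∧ x₀ % 2 = x₄ % 2) := by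
  have hd (x : ℤ) : x % 5 = 0 ∨ x % 5 = 1 ∨ x % 5 = 2 ∨ x % 5 = 3 ∨ x % 5 = 4 := by omega
  rw [Int.sub_emod] at z₂ z₄ q₂ q₄
  rw [Int.add_emod] at z₃ z₅ q₃ q₅
  rw [Int.mul_emod] at z₄ z₅ q₄ q₅
  rcases hd b with hb | hb | hb | hb | hb <;> rcases hd c with hc | hc | hc | hc | hc
  · exact absurd ⟨hc, hb⟩ c5
  all_goals
    clear c5 hd
    norm_num [hb, hc] at z₀ z₁ z₂ z₃ z₄ z₅ q₀ q₁ q₂ q₃ q₄ q₅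
    simp_all

/-- The parities of the valuations at `2`, `3` and `5` of the six linear forms. -/
lemma sextic_patterns {a₀ a₁ a₂ a₃ a₄ a₅ b₀ b₁ b₂ b₃ b₄ b₅ : ℕ} {l : List ℕ}
    (A₀ : a₀ % 2 = 0) (A : (a₁ = 0 ∧ a₄ = 0 ∧ a₅ = 0 ∧ (a₂ + a₃) % 2 = 0) ∨
      (a₂ = 0 ∧ a₃ = 0 ∧ (a₁ + a₄ + a₅) % 2 = 0))
    (B₀ : b₀ % 2 = 0) (B₁ : b₁ % 2 = 0) (B : (b₃ = 0 ∧ b₄ = 0 ∧ (b₂ + b₅) % 2 = 0) ∨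
      (b₂ = 0 ∧ b₅ = 0 ∧ (b₃ + b₄) % 2 = 0))
    (D : (l = [1, 0, 0, 0, 0, 0] ∧ (a₁ + b₁) % 2 = (a₂ + b₂) % 2 ∧
        (a₁ + b₁) % 2 = (a₃ + b₃) % 2 ∧ (a₁ + b₁) % 2 = (a₄ + b₄) % 2 ∧
        (a₁ + b₁) % 2 = (a₅ + b₅) % 2) ∨
      (l = [0, 1, 0, 0, 0, 0] ∧ (a₀ + b₀) % 2 = (a₂ + b₂) % 2 ∧
        (a₀ + b₀) % 2 = (a₃ + b₃) % 2 ∧ (a₀ + b₀) % 2 ≠ (a₄ + b₄) % 2 ∧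
        (a₀ + b₀) % 2 ≠ (a₅ + b₅) % 2) ∨
      (l = [0, 0, 1, 0, 0, 0] ∧ (a₀ + b₀) % 2 = (a₁ + b₁) % 2 ∧
        (a₀ + b₀) % 2 ≠ (a₃ + b₃) % 2 ∧ (a₀ + b₀) % 2 = (a₄ + b₄) % 2 ∧
        (a₀ + b₀) % 2 ≠ (a₅ + b₅) % 2) ∨
      (l = [0, 0, 0, 1, 0, 0] ∧ (a₀ + b₀) % 2 = (a₁ + b₁) % 2 ∧
        (a₀ + b₀) % 2 ≠ (a₂ + b₂) % 2 ∧ (a₀ + b₀) % 2 ≠ (a₄ + b₄) % 2 ∧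
        (a₀ + b₀) % 2 = (a₅ + b₅) % 2) ∨
      (l = [0, 0, 0, 0, 1, 0] ∧ (a₀ + b₀) % 2 ≠ (a₁ + b₁) % 2 ∧
        (a₀ + b₀) % 2 = (a₂ + b₂) % 2 ∧ (a₀ + b₀) % 2 ≠ (a₃ + b₃) % 2 ∧
        (a₀ + b₀) % 2 = (a₅ + b₅) % 2) ∨
      (l = [0, 0, 0, 0, 0, 1] ∧ (a₀ + b₀) % 2 ≠ (a₁ + b₁) % 2 ∧
        (a₀ + b₀) % 2 ≠ (a₂ + b₂) % 2 ∧ (a₀ + b₀) % 2 = (a₃ + b₃) % 2 ∧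
        (a₀ + b₀) % 2 = (a₄ + b₄) % 2)) :
    ([a₁ % 2, a₂ % 2, a₃ % 2, a₄ % 2, a₅ % 2], [b₂ % 2, b₃ % 2, b₄ % 2, b₅ % 2], l) ∈
      [([0, 0, 0, 0, 0], [0, 0, 0, 0], [1, 0, 0, 0, 0, 0]),
        ([0, 0, 0, 1, 1], [0, 0, 0, 0], [0, 1, 0, 0, 0, 0]),
        ([0, 1, 1, 0, 0], [1, 0, 0, 1], [0, 0, 1, 0, 0, 0]),
        ([0, 0, 0, 1, 1], [0, 1, 1, 0], [0, 0, 1, 0, 0, 0]),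
        ([0, 1, 1, 0, 0], [0, 1, 1, 0], [0, 0, 0, 1, 0, 0]),
        ([0, 0, 0, 1, 1], [1, 0, 0, 1], [0, 0, 0, 1, 0, 0]),
        ([1, 0, 0, 1, 0], [0, 1, 1, 0], [0, 0, 0, 0, 1, 0]),
        ([1, 0, 0, 0, 1], [1, 0, 0, 1], [0, 0, 0, 0, 0, 1])] := by
  rcases D with ⟨rfl, D⟩ | ⟨rfl, D⟩ | ⟨rfl, D⟩ | ⟨rfl, D⟩ | ⟨rfl, D⟩ | ⟨rfl, D⟩
  · have h : a₁ % 2 = 0 ∧ a₂ % 2 = 0 ∧ a₃ % 2 = 0 ∧ a₄ % 2 = 0 ∧ a₅ % 2 = 0 ∧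
          b₂ % 2 = 0 ∧ b₃ % 2 = 0 ∧ b₄ % 2 = 0 ∧ b₅ % 2 = 0 := by
        refine ⟨?_, ?_, ?_, ?_, ?_, ?_, ?_, ?_, ?_⟩ <;> omega
    simp [h]
  · have h : a₁ % 2 = 0 ∧ a₂ % 2 = 0 ∧ a₃ % 2 = 0 ∧ a₄ % 2 = 1 ∧ a₅ % 2 = 1 ∧
          b₂ % 2 = 0 ∧ b₃ % 2 = 0 ∧ b₄ % 2 = 0 ∧ b₅ % 2 = 0 := by
        refine ⟨?_, ?_, ?_, ?_, ?_, ?_, ?_, ?_, ?_⟩ <;> omega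
    simp [h]
  · rcases B with B | B
    · have h : a₁ % 2 = 0 ∧ a₂ % 2 = 1 ∧ a₃ % 2 = 1 ∧ a₄ % 2 = 0 ∧ a₅ % 2 = 0 ∧
            b₂ % 2 = 1 ∧ b₃ % 2 = 0 ∧ b₄ % 2 = 0 ∧ b₅ % 2 = 1 := by
          refine ⟨?_, ?_, ?_, ?_, ?_, ?_, ?_, ?_, ?_⟩ <;> omega
      simp [h]
    · have h : a₁ % 2 = 0 ∧ a₂ % 2 = 0 ∧ a₃ % 2 = 0 ∧ a₄ % 2 = 1 ∧ a₅ % 2 = 1 ∧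
            b₂ % 2 = 0 ∧ b₃ % 2 = 1 ∧ b₄ % 2 = 1 ∧ b₅ % 2 = 0 := by
          refine ⟨?_, ?_, ?_, ?_, ?_, ?_, ?_, ?_, ?_⟩ <;> omega
      simp [h]
  · rcases B with B | B
    · have h : a₁ % 2 = 0 ∧ a₂ % 2 = 0 ∧ a₃ % 2 = 0 ∧ a₄ % 2 = 1 ∧ a₅ % 2 = 1 ∧
            b₂ % 2 = 1 ∧ b₃ % 2 = 0 ∧ b₄ % 2 = 0 ∧ b₅ % 2 = 1 := by
          refine ⟨?_, ?_, ?_, ?_, ?_, ?_, ?_, ?_, ?_⟩ <;> omega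
      simp [h]
    · have h : a₁ % 2 = 0 ∧ a₂ % 2 = 1 ∧ a₃ % 2 = 1 ∧ a₄ % 2 = 0 ∧ a₅ % 2 = 0 ∧
            b₂ % 2 = 0 ∧ b₃ % 2 = 1 ∧ b₄ % 2 = 1 ∧ b₅ % 2 = 0 := by
          refine ⟨?_, ?_, ?_, ?_, ?_, ?_, ?_, ?_, ?_⟩ <;> omega
      simp [h]
  · have h : a₁ % 2 = 1 ∧ a₂ % 2 = 0 ∧ a₃ % 2 = 0 ∧ a₄ % 2 = 1 ∧ a₅ % 2 = 0 ∧
          b₂ % 2 = 0 ∧ b₃ % 2 = 1 ∧ b₄ % 2 = 1 ∧ b₅ % 2 = 0 := by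
        refine ⟨?_, ?_, ?_, ?_, ?_, ?_, ?_, ?_, ?_⟩ <;> omega
    simp [h]
  · have h : a₁ % 2 = 1 ∧ a₂ % 2 = 0 ∧ a₃ % 2 = 0 ∧ a₄ % 2 = 0 ∧ a₅ % 2 = 1 ∧
          b₂ % 2 = 1 ∧ b₃ % 2 = 0 ∧ b₄ % 2 = 0 ∧ b₅ % 2 = 1 := by
        refine ⟨?_, ?_, ?_, ?_, ?_, ?_, ?_, ?_, ?_⟩ <;> omega
    simp [h]

/-- If the product of the six linear forms is five times a square, two of them multiply to a square
up to a specific factor. -/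
lemma exists_sq_of_sextic {b c w : ℤ} (hb : 0 < b) (hc : IsCoprime c b)
    (h : b * c * (c - b) * (c + b) * (c - 2 * b) * (c + 2 * b) * 5 = w ^ 2) (hw : w ≠ 0) :
    ∃ r : ℤ, r ≠ 0 ∧ ((c + b) * (c - 2 * b) = r ^ 2 ∨ (c - b) * (c + 2 * b) = r ^ 2 ∨
      c * (c - 2 * b) = -r ^ 2 ∨ c * (c + 2 * b) = -r ^ 2 ∨ c * (c + b) = 5 * r ^ 2) := by
  have hne := pow_ne_zero 2 hw
  rw [← h] at hne
  simp only [mul_ne_zero_iff] at hne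
  obtain ⟨⟨⟨⟨⟨⟨n₀, n₁⟩, n₂⟩, n₃⟩, n₄⟩, n₅⟩, -⟩ := hne
  have hF : ∀ i, (![b, c, c - b, c + b, c - 2 * b, c + 2 * b] : Fin 6 → ℤ) i ≠ 0 := by
    intro i; fin_cases i <;> simpa
  have hP : (∏ i, (![b, c, c - b, c + b, c - 2 * b, c + 2 * b] : Fin 6 → ℤ) i) * 5 = w ^ 2 := by
    rw [Fin.prod_univ_six]; exact h
  have hev := linear_forms_padicValInt_even (F := ![b, c, c - b, c + b, c - 2 * b, c + 2 * b])
    ![0, 1, 1, 1, 1, 1] ![1, 0, -1, 1, -2, 2]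
    (by intro i; fin_cases i <;> simp [sub_eq_add_neg]) (by decide) hc hF dvd_rfl hP
  have hsum := sum_padicValInt_parity hF (by norm_num) hP
  have h2 := hsum 2
  have h3 := hsum 3
  have : Fact (Nat.Prime 5) := ⟨Nat.prime_five⟩
  have h5 := hsum 5
  rw [padicValInt_five (Or.inl rfl) (by norm_num), Fin.sum_univ_six] at h2 h3 h5
  norm_num at h2 h3 h5
  have c2 := not_emod_eq_zero_of_isCoprime hc 2 (by norm_num)
  have c3 := not_emod_eq_zero_of_isCoprime hc 3 (by norm_num)
  have c5 := not_emod_eq_zero_of_isCoprime hc 5 (by norm_num)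
  obtain ⟨s₀, r₀, hs₀, hr₀, e₀⟩ := exists_eq_sign_mul_sq n₀ (hev 0)
  obtain ⟨s₁, r₁, hs₁, hr₁, e₁⟩ := exists_eq_sign_mul_sq n₁ (hev 1)
  obtain ⟨s₂, r₂, hs₂, hr₂, e₂⟩ := exists_eq_sign_mul_sq n₂ (hev 2)
  obtain ⟨s₃, r₃, hs₃, hr₃, e₃⟩ := exists_eq_sign_mul_sq n₃ (hev 3)
  obtain ⟨s₄, r₄, hs₄, hr₄, e₄⟩ := exists_eq_sign_mul_sq n₄ (hev 4)
  obtain ⟨s₅, r₅, hs₅, hr₅, e₅⟩ := exists_eq_sign_mul_sq n₅ (hev 5)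
  simp only [Matrix.cons_val] at h2 h3 h5 e₀ e₁ e₂ e₃ e₄ e₅
  have z2 (x : ℤ) : x % 2 ≠ 0 → padicValInt 2 x = 0 := padicValInt_eq_zero_of_emod
  have z3 (x : ℤ) : x % 3 ≠ 0 → padicValInt 3 x = 0 := padicValInt_eq_zero_of_emod
  have z5 (x : ℤ) : x % 5 ≠ 0 → padicValInt 5 x = 0 := padicValInt_eq_zero_of_emod
  obtain ⟨A₀, A⟩ := sextic_parity_at_two h2 c2 (z2 _) (z2 _) (z2 _) (z2 _) (z2 _) (z2 _)
  obtain ⟨B₀, B₁, B⟩ := sextic_parity_at_three h3 c3 (z3 _) (z3 _) (z3 _) (z3 _) (z3 _) (z3 _)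
  have hpat := sextic_patterns A₀ A B₀ B₁ B (sextic_parity_at_five h5 c5 (z5 _) (z5 _) (z5 _) (z5 _)
    (z5 _) (z5 _) (emod_five_of_eq hs₀ e₀) (emod_five_of_eq hs₁ e₁) (emod_five_of_eq hs₂ e₂)
    (emod_five_of_eq hs₃ e₃) (emod_five_of_eq hs₄ e₄) (emod_five_of_eq hs₅ e₅))
  have hsign := congrArg Int.sign h
  have hs₀' : s₀ = 1 := by rw [← sign_eq_of_eq hs₀ hr₀ e₀, Int.sign_eq_one_of_pos hb]
  rw [Int.sign_eq_one_of_pos (by positivity : 0 < w ^ 2), Int.sign_mul,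
    Int.sign_eq_one_of_pos (by norm_num : (0 : ℤ) < 5), mul_one, Int.sign_mul, Int.sign_mul,
    Int.sign_mul, Int.sign_mul, Int.sign_mul,
    sign_eq_of_eq hs₀ hr₀ e₀, sign_eq_of_eq hs₁ hr₁ e₁,
    sign_eq_of_eq hs₂ hr₂ e₂, sign_eq_of_eq hs₃ hr₃ e₃,
    sign_eq_of_eq hs₄ hr₄ e₄, sign_eq_of_eq hs₅ hr₅ e₅,
    hs₀', one_mul] at hsign
  subst hs₀'
  clear c2 c5 z2 z3 z5 h2 h3 h5 A B hsum hev hP hF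
  have t₀ := sq_pos_and_emod_three hr₀
  have t₁ := sq_pos_and_emod_three hr₁
  have t₂ := sq_pos_and_emod_three hr₂
  have t₃ := sq_pos_and_emod_three hr₃
  have t₄ := sq_pos_and_emod_three hr₄
  have t₅ := sq_pos_and_emod_three hr₅
  simp only [List.mem_cons, Prod.mk.injEq, List.cons.injEq, and_true, List.not_mem_nil,
    or_false] at hpat
  rcases hpat with H | H | H | H | H | H | H | H <;>
    obtain ⟨⟨A₁, A₂, A₃, A₄, A₅⟩, ⟨B₂, B₃, B₄, B₅⟩, D₀, D₁, D₂, D₃, D₄, D₅⟩ := H <;>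
    simp only [A₀, A₁, A₂, A₃, A₄, A₅, B₀, B₁, B₂, B₃, B₄, B₅, D₀, D₁, D₂, D₃, D₄, D₅, pow_zero,
      pow_one, mul_one, one_mul] at e₀ e₁ e₂ e₃ e₄ e₅ <;>
    clear A₀ A₁ A₂ A₃ A₄ A₅ B₀ B₁ B₂ B₃ B₄ B₅ D₀ D₁ D₂ D₃ D₄ D₅
  · have hs := sextic_signs_infty c3 hs₁ hs₂ hs₃ hs₄ hs₅ hsign t₀ t₁ t₂ t₃ t₄ t₅ e₀ e₁ e₂ e₃ e₄ e₅
    refine ⟨r₃ * r₄, by positivity, Or.inl ?_⟩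
    rw [e₄, e₃, hs]
    rcases hs₄ with rfl | rfl <;> ring
  · have hs := sextic_signs_zero hs₁ hs₂ hs₃ hs₄ hs₅ hsign t₀ t₁ t₂ t₃ t₄ t₅ e₀ e₁ e₂ e₃ e₄ e₅
    refine ⟨r₁ * r₃, by positivity, Or.inr (Or.inr (Or.inr (Or.inr ?_)))⟩
    rw [e₃, e₁, hs]
    rcases hs₃ with rfl | rfl <;> ring
  · have hs := sextic_signs_one_odd c3 hs₁ hs₂ hs₃ hs₄ hs₅ hsign t₀ t₁ t₂ t₃ t₄ t₅ e₀ e₁ e₂ e₃ e₄ e₅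
    refine ⟨r₁ * r₄, by positivity, Or.inr (Or.inr (Or.inl ?_))⟩
    rw [e₄, e₁, hs]
    rcases hs₄ with rfl | rfl <;> ring
  · exact (sextic_signs_one_even c3 hs₁ hs₂ hs₃ hs₄ hs₅ hsign t₀ t₁ t₂ t₃ t₄ t₅
      e₀ e₁ e₂ e₃ e₄ e₅).elim
  · have hs := sextic_signs_neg_one_odd c3 hs₁ hs₅ t₀ t₁ t₅ e₀ e₁ e₃ e₅
    refine ⟨r₁ * r₅, by positivity, Or.inr (Or.inr (Or.inr (Or.inl ?_)))⟩
    rw [e₅, e₁, hs]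
    rcases hs₅ with rfl | rfl <;> ring
  · have hs := sextic_signs_neg_one_even hs₁ hs₂ hs₃ hs₄ hs₅ hsign t₀ t₁ t₂ t₃ t₄ t₅
      e₀ e₁ e₂ e₃ e₄ e₅
    refine ⟨r₁ * r₃, by positivity, Or.inr (Or.inr (Or.inr (Or.inr ?_)))⟩
    rw [e₃, e₁, hs]
    rcases hs₃ with rfl | rfl <;> ring
  · have hs := sextic_signs_two c3 hs₁ hs₂ hs₃ hs₄ hs₅ hsign t₀ t₁ t₂ t₃ t₄ t₅ e₀ e₁ e₂ e₃ e₄ e₅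
    refine ⟨r₂ * r₅, by positivity, Or.inr (Or.inl ?_)⟩
    rw [e₅, e₂, hs]
    rcases hs₅ with rfl | rfl <;> ring
  · have hs := sextic_signs_neg_two c3 hs₁ hs₂ hs₃ hs₄ hs₅ hsign t₀ t₁ t₂ t₃ t₄ t₅ e₀ e₁ e₂ e₃ e₄ e₅
    refine ⟨r₃ * r₄, by positivity, Or.inl ?_⟩
    rw [e₄, e₃, hs]
    rcases hs₄ with rfl | rfl <;> ring

/-- A rational point with `v ≠ 0` on the model `v² = 5z(z² - 1)(z² - 4)` has `z = 4`. -/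
lemma eq_four_of_sq_eq {z v : ℚ} (hv : v ≠ 0)
    (h : v ^ 2 = 5 * z * (z ^ 2 - 1) * (z ^ 2 - 4)) : z = 4 := by
  have hb : (z.den : ℚ) ≠ 0 := by exact_mod_cast z.den_nz
  have hz : z = z.num / z.den := z.num_div_den.symm
  obtain ⟨w, hw⟩ : IsSquare ((z.den : ℤ) * z.num * (z.num - z.den) * (z.num + z.den) *
      (z.num - 2 * z.den) * (z.num + 2 * z.den) * 5) := by
    rw [← Rat.isSquare_intCast_iff]
    refine ⟨v * z.den ^ 3, ?_⟩
    rw [← sq, mul_pow, h]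
    generalize z.num = c, z.den = b at *
    subst hz
    push_cast
    field_simp
    ring
  rw [← sq] at hw
  have hwv : (v * z.den ^ 3) ^ 2 = (w : ℚ) ^ 2 := by
    rw [← Int.cast_pow, ← hw, mul_pow, h]
    generalize z.num = c, z.den = b at *
    subst hz
    push_cast
    field_simp
    ring
  have hw0 : w ≠ 0 := by
    rintro rfl
    exact mul_ne_zero hv (pow_ne_zero 3 hb) (by simpa using hwv)
  obtain ⟨r, hr, H⟩ := exists_sq_of_sextic (by exact_mod_cast z.pos)
    (Int.isCoprime_iff_gcd_eq_one.2 (by simpa [Int.gcd] using z.reduced)) hw hw0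
  have hrq : (r : ℚ) ≠ 0 := by exact_mod_cast hr
  set s : ℚ := r / z.den with hs
  have hs0 : s ≠ 0 := div_ne_zero hrq hb
  have hvs : v / s ≠ 0 := div_ne_zero hv hs0
  replace H : (z + 1) * (z - 2) = s ^ 2 ∨ (z - 1) * (z + 2) = s ^ 2 ∨ z * (z - 2) = -s ^ 2 ∨
      z * (z + 2) = -s ^ 2 ∨ z * (z + 1) = 5 * s ^ 2 := by
    rw [hs]
    generalize z.num = c, z.den = b at *
    subst hz
    refine H.imp ?_ (Or.imp ?_ (Or.imp ?_ (Or.imp ?_ ?_))) <;>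
    · intro H
      field_simp
      have H' := congrArg (Int.cast : ℤ → ℚ) H
      push_cast at H'
      linear_combination H'
  clear_value s
  rcases H with H | H | H | H | H
  · refine absurd (eq_zero_of_five_mul (Or.inl rfl) (t := z) ?_) hvs
    rw [div_pow, eq_div_iff (pow_ne_zero 2 hs0), h, ← H]
    push_cast
    ring
  · refine absurd (eq_zero_of_five_mul (Or.inr rfl) (t := -z) ?_) hvs
    rw [div_pow, eq_div_iff (pow_ne_zero 2 hs0), h, ← H]
    push_cast
    ring
  · refine absurd (eq_zero_of_five_mul (Or.inl rfl) (t := -(z + 1)) ?_) hvs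
    rw [div_pow, eq_div_iff (pow_ne_zero 2 hs0), h, ← neg_eq_iff_eq_neg.2 H]
    push_cast
    ring
  · refine absurd (eq_zero_of_five_mul (Or.inr rfl) (t := z - 1) ?_) hvs
    rw [div_pow, eq_div_iff (pow_ne_zero 2 hs0), h, ← neg_eq_iff_eq_neg.2 H]
    push_cast
    ring
  · have hz0 : z ≠ 0 := by
      rintro rfl
      exact hv (by simpa using h)
    have hz2 : z - 2 ≠ 0 := by
      intro hz2
      rw [sub_eq_zero] at hz2
      subst hz2
      norm_num at h
      exact hv h
    have hu : (v / (5 * s)) ^ 2 = (z - 1) * (z - 2) * (z + 2) := by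
      rw [div_pow, div_eq_iff (by positivity), h]
      linear_combination 5 * (z - 1) * (z - 2) * (z + 2) * H
    have hu0 : v / (5 * s) ≠ 0 := div_ne_zero hv (mul_ne_zero (by norm_num) hs0)
    have := eq_zero_of_split (t := z ^ 2 / (z - 2))
      (y := v / (5 * s) * (z * (z - 4) / (z - 2) ^ 2)) (by
        rw [mul_pow, hu]
        field_simp
        ring)
    simpa [hv, hs0, hz0, hz2, sub_eq_zero] using this

/-- The rational points of the genus 2 curve `C_5 : y² = x(x² − 25)(x² − 100)` are exactly
the five affine points with `y = 0` together with the two points `(20, ±1500)`. -/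
theorem rational_points_C5 (x y : ℚ) :
    y ^ 2 = x * (x ^ 2 - 25) * (x ^ 2 - 100) ↔
      (y = 0 ∧ (x = 0 ∨ x = 5 ∨ x = -5 ∨ x = 10 ∨ x = -10)) ∨
        (x = 20 ∧ (y = 1500 ∨ y = -1500)) := by
  constructor
  · intro h
    by_cases hy : y = 0
    · subst hy
      have h' : x * (x - 5) * (x + 5) * (x - 10) * (x + 10) = 0 := by linear_combination -h
      simp only [mul_eq_zero, sub_eq_zero, add_eq_zero_iff_eq_neg] at h'
      tauto
    · have hx : x / 5 = 4 := eq_four_of_sq_eq (v := y / 25) (by simpa) (by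
        rw [div_pow, h]
        ring)
      obtain rfl : x = 20 := by linarith
      have h' : (y - 1500) * (y + 1500) = 0 := by linear_combination h
      simp only [mul_eq_zero, sub_eq_zero, add_eq_zero_iff_eq_neg] at h'
      exact Or.inr ⟨rfl, h'⟩
  · rintro (⟨rfl, rfl | rfl | rfl | rfl | rfl⟩ | ⟨rfl, rfl | rfl⟩) <;> norm_num
end

section
/- Every rational solution (x, y) ∈ ℚ × ℚ of the equation y² = x(x + 241)(x + 482) satisfies y = 0; equivalently, the Mordell–Weil group over ℚ of the elliptic curve E₁ : y² = x(x + 241)(x + 482) is isomorphic to ℤ/2ℤ × ℤ/2ℤ. -/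
theorem Int.exists_nonneg_sq_of_mul_eq {a b c : ℤ} (ha : 0 < a) (hab : IsCoprime a b)
    (h : a * b = c ^ 2) : ∃ s : ℤ, 0 ≤ s ∧ a = s ^ 2 := by
  obtain ⟨s, hs | hs⟩ := Int.sq_of_isCoprime hab h
  · exact ⟨|s|, abs_nonneg s, by rw [sq_abs, hs]⟩
  · linarith [sq_nonneg s]

/-- If a product of two coprime positive integers is a prime times a square, then one factor is a
square and the other is that prime times a square. -/
theorem Int.exists_sq_or_prime_mul_sq_of_mul_eq {q : ℤ} (hq : Prime q) (hq0 : 0 < q) {a b c : ℤ}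
    (ha : 0 < a) (hb : 0 < b) (hab : IsCoprime a b) (h : a * b = q * c ^ 2) :
    (∃ s t : ℤ, 0 ≤ s ∧ 0 ≤ t ∧ a = q * s ^ 2 ∧ b = t ^ 2) ∨
      (∃ s t : ℤ, 0 ≤ s ∧ 0 ≤ t ∧ a = s ^ 2 ∧ b = q * t ^ 2) := by
  have key : ∀ {a b : ℤ}, 0 < a → 0 < b → IsCoprime a b → a * b = q * c ^ 2 → q ∣ a →
      ∃ s t : ℤ, 0 ≤ s ∧ 0 ≤ t ∧ a = q * s ^ 2 ∧ b = t ^ 2 := by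
    rintro _ b ha hb hab h ⟨a, rfl⟩
    have h' : a * b = c ^ 2 := mul_left_cancel₀ hq.ne_zero (by rw [← h]; ring)
    have hab' : IsCoprime a b := hab.of_mul_left_right
    obtain ⟨s, hs0, hs⟩ := Int.exists_nonneg_sq_of_mul_eq
      (pos_of_mul_pos_right ha hq0.le) hab' h'
    obtain ⟨t, ht0, ht⟩ := Int.exists_nonneg_sq_of_mul_eq hb hab'.symm (by rw [mul_comm, h'])
    exact ⟨s, t, hs0, ht0, by rw [hs], ht⟩
  rcases hq.dvd_or_dvd (Dvd.intro _ h.symm) with hqa | hqb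
  · exact .inl (key ha hb hab h hqa)
  · obtain ⟨s, t, hs, ht, h1, h2⟩ := key hb ha hab.symm (by rw [mul_comm, h]) hqb
    exact .inr ⟨t, s, ht, hs, h2, h1⟩

theorem Int.prime_241 : Prime (241 : ℤ) :=
  Nat.prime_iff_prime_int.mp (Fact.out : Nat.Prime 241)

/-- By quadratic reciprocity, if `241 d²` is a square of a unit modulo `m`, then `m` is a square
modulo `241`. -/
theorem isSquare_zmod_241_of_dvd {m c d : ℤ} (hc : IsCoprime m c) (h : m ∣ 241 * d ^ 2 - c ^ 2) :
    IsSquare (m : ZMod 241) := by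
  have prime_case : ∀ q : ℕ, q.Prime → (q : ℤ) ∣ m → IsSquare (q : ZMod 241) := by
    intro q hq hqm
    have : Fact q.Prime := ⟨hq⟩
    rcases hq.eq_two_or_odd with rfl | hodd
    · exact (ZMod.exists_sq_eq_two_iff (by norm_num)).2 (by norm_num)
    · rw [ZMod.exists_sq_eq_prime_iff_of_mod_four_eq_one (p := 241) (by norm_num) (by omega)]
      have hqc : ((c : ℤ) : ZMod q) ≠ 0 := by
        rw [Ne, ZMod.intCast_zmod_eq_zero_iff_dvd]
        intro hdvd
        exact (Nat.prime_iff_prime_int.mp hq).not_isUnit (hc.isUnit_of_dvd' hqm hdvd)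
      have heq : ((241 : ℕ) : ZMod q) * (d : ZMod q) ^ 2 = (c : ZMod q) ^ 2 := by
        have := (ZMod.intCast_zmod_eq_zero_iff_dvd _ q).2 (hqm.trans h)
        push_cast at this ⊢
        exact sub_eq_zero.mp this
      have hd : (d : ZMod q) ≠ 0 := by
        intro hd
        rw [hd] at heq
        exact hqc (by simpa using heq.symm)
      refine ⟨c / d, ?_⟩
      field_simp
      exact heq
  have nat_case : ∀ n : ℕ, (n : ℤ) ∣ m → IsSquare (n : ZMod 241) := by
    intro n
    induction n using induction_on_primes with
    | zero => intro _; exact ⟨0, by simp⟩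
    | one => intro _; exact ⟨1, by simp⟩
    | prime_mul q n hq ih =>
      intro hdvd
      push_cast at hdvd ⊢
      exact (prime_case q hq (dvd_of_mul_right_dvd hdvd)).mul (ih (dvd_of_mul_left_dvd hdvd))
  have habs := nat_case m.natAbs (Int.natAbs_dvd.2 dvd_rfl)
  rcases Int.natAbs_eq m with hm | hm
  · rwa [← Int.cast_natCast, ← hm] at habs
  · rw [hm, Int.cast_neg, Int.cast_natCast, ← neg_one_mul]
    exact (ZMod.exists_sq_eq_neg_one_iff.2 (by norm_num)).mul habs

/-- A form `a⁴ + i a²b² + j b⁴` with no zero over `𝔽₂₄₁` at which `a` and `b` are both squares cannot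
vanish modulo `241` at coprime integers that are squares modulo `241`. -/
theorem quartic_form_ne_of_squares {i j : ℤ}
    (hroot : ∀ z : ZMod 241, z ^ 8 + i * z ^ 4 + j ≠ 0) {a b d : ℤ} (hab : IsCoprime a b)
    (ha : IsSquare (a : ZMod 241)) (hb : IsSquare (b : ZMod 241)) :
    a ^ 4 + i * a ^ 2 * b ^ 2 + j * b ^ 4 ≠ 241 * d ^ 2 := by
  intro h
  have hmod : (a : ZMod 241) ^ 4 + i * (a : ZMod 241) ^ 2 * (b : ZMod 241) ^ 2
      + j * (b : ZMod 241) ^ 4 = 0 := by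
    have := congrArg (Int.cast : ℤ → ZMod 241) h
    push_cast at this
    rw [this, show (241 : ZMod 241) = 0 from rfl, zero_mul]
  by_cases hb0 : (b : ZMod 241) = 0
  · rw [hb0] at hmod
    have ha0 : (a : ZMod 241) = 0 := by simpa using hmod
    rw [ZMod.intCast_zmod_eq_zero_iff_dvd] at ha0 hb0
    exact Int.prime_241.not_isUnit (hab.isUnit_of_dvd' ha0 hb0)
  · obtain ⟨u, hu⟩ := ha
    obtain ⟨v, hv⟩ := hb
    have hv0 : v ≠ 0 := by rintro rfl; exact hb0 (by simpa using hv)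
    apply hroot (u / v)
    rw [hu, hv] at hmod
    field_simp
    linear_combination hmod

theorem quartic_add_six_ne {m n d : ℤ} (hmn : IsCoprime m n) :
    m ^ 4 + 6 * m ^ 2 * n ^ 2 + n ^ 4 ≠ 241 * d ^ 2 := by
  intro h
  have hm : IsSquare (m : ZMod 241) := isSquare_zmod_241_of_dvd (c := n ^ 2) (d := d)
    hmn.pow_right ⟨m ^ 3 + 6 * m * n ^ 2, by rw [← h]; ring⟩
  have hn : IsSquare (n : ZMod 241) := isSquare_zmod_241_of_dvd (c := m ^ 2) (d := d)
    hmn.symm.pow_right ⟨n ^ 3 + 6 * n * m ^ 2, by rw [← h]; ring⟩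
  exact quartic_form_ne_of_squares (i := 6) (j := 1) (d := d) (by decide +kernel) hmn hm hn
    (by rw [← h]; ring)

theorem quartic_sub_six_ne {m n d : ℤ} (hmn : IsCoprime m n) :
    m ^ 4 - 6 * m ^ 2 * n ^ 2 + n ^ 4 ≠ 241 * d ^ 2 := by
  intro h
  have hm : IsSquare (m : ZMod 241) := isSquare_zmod_241_of_dvd (c := n ^ 2) (d := d)
    hmn.pow_right ⟨m ^ 3 - 6 * m * n ^ 2, by rw [← h]; ring⟩
  have hn : IsSquare (n : ZMod 241) := isSquare_zmod_241_of_dvd (c := m ^ 2) (d := d)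
    hmn.symm.pow_right ⟨n ^ 3 - 6 * n * m ^ 2, by rw [← h]; ring⟩
  exact quartic_form_ne_of_squares (i := -6) (j := 1) (d := d) (by decide +kernel) hmn hm hn
    (by rw [← h]; ring)

theorem quartic_add_four_ne {f e d : ℤ} (hfe : IsCoprime f (2 * e)) :
    f ^ 4 + 4 * e ^ 4 ≠ 241 * d ^ 2 := by
  intro h
  have hfe' : IsCoprime f e := hfe.of_mul_right_right
  have hf : IsSquare (f : ZMod 241) := isSquare_zmod_241_of_dvd (c := 2 * e * e) (d := d)
    (hfe.mul_right hfe') ⟨f ^ 3, by rw [← h]; ring⟩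
  have he : IsSquare (e : ZMod 241) := isSquare_zmod_241_of_dvd (c := f ^ 2) (d := d)
    hfe'.symm.pow_right ⟨4 * e ^ 3, by rw [← h]; ring⟩
  exact quartic_form_ne_of_squares (i := 0) (j := 4) (d := d) (by decide +kernel) hfe' hf he
    (by rw [← h]; ring)

theorem Int.sq_emod_four_of_odd {a : ℤ} (h : a % 2 = 1) : a ^ 2 % 4 = 1 :=
  Int.sq_mod_four_eq_one_of_odd (Int.odd_iff.2 h)

theorem Int.sq_emod_four_of_even {a : ℤ} (h : a % 2 = 0) : a ^ 2 % 4 = 0 := by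
  obtain ⟨b, rfl⟩ := Int.dvd_of_emod_eq_zero h
  ring_nf; omega

theorem sq_emod_four_add_of_odd_add {a b : ℤ} (h : (a + b) % 2 = 1) :
    a ^ 2 % 4 + b ^ 2 % 4 = 1 := by
  rcases Int.emod_two_eq_zero_or_one a with ha | ha
  · rw [Int.sq_emod_four_of_even ha, Int.sq_emod_four_of_odd (by omega)]; rfl
  · rw [Int.sq_emod_four_of_odd ha, Int.sq_emod_four_of_even (by omega)]; rfl

/-- Coprime solutions of `a² + b² = c²` with `a` odd and `c` positive, parametrized. -/
theorem pythagorean_parametrization {a b c : ℤ} (h : a ^ 2 + b ^ 2 = c ^ 2) (hab : IsCoprime a b)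
    (ha : a % 2 = 1) (hc : 0 < c) :
    ∃ m n : ℤ, a = m ^ 2 - n ^ 2 ∧ b = 2 * m * n ∧ c = m ^ 2 + n ^ 2 ∧ IsCoprime m n ∧
      (m + n) % 2 = 1 ∧ 0 ≤ m := by
  have ht : PythagoreanTriple a b c := by unfold PythagoreanTriple; linarith
  obtain ⟨m, n, h1, h2, h3, h4, h5, h6⟩ :=
    ht.coprime_classification' (Int.isCoprime_iff_gcd_eq_one.1 hab) ha hc
  exact ⟨m, n, h1, h2, h3, Int.isCoprime_iff_gcd_eq_one.2 h4, by omega, h6⟩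

theorem no_sq_add_sq_sub {a b c d : ℤ} (hab : IsCoprime a b) (hpar : (a + b) % 2 = 1) (hc : 0 < c)
    (h1 : a ^ 2 + b ^ 2 = c ^ 2) (h2 : a ^ 2 - b ^ 2 = 241 * d ^ 2) : False := by
  have ha : a % 2 = 1 := by
    by_contra ha
    have := Int.sq_emod_four_of_even (a := a) (by omega)
    have := Int.sq_emod_four_of_odd (a := b) (by omega)
    rcases Int.emod_two_eq_zero_or_one d with hd | hd
    · have := Int.sq_emod_four_of_even hd; omega
    · have := Int.sq_emod_four_of_odd hd; omega
  obtain ⟨m, n, rfl, rfl, -, hmn, -, -⟩ := pythagorean_parametrization h1 hab ha hc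
  exact quartic_sub_six_ne (d := d) hmn (by rw [← h2]; ring)

theorem no_sq_sub_sq_add {a b c d : ℤ} (hbc : IsCoprime c b) (hpar : (a + b) % 2 = 1) (ha : 0 < a)
    (h1 : a ^ 2 - b ^ 2 = c ^ 2) (h2 : a ^ 2 + b ^ 2 = 241 * d ^ 2) : False := by
  have hc : c % 2 = 1 := by
    by_contra hc
    have := Int.sq_emod_four_of_even (a := c) (by omega)
    have := sq_emod_four_add_of_odd_add hpar
    clear h2
    omega
  obtain ⟨m, n, rfl, rfl, rfl, hmn, -, -⟩ :=
    pythagorean_parametrization (a := c) (b := b) (c := a) (by linarith) hbc hc ha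
  exact quartic_add_six_ne (d := d) hmn (by rw [← h2]; ring)

theorem emod_of_sq_sub_of_sq_add {s t c d : ℤ} (hst : s % 4 + t % 4 = 1) (h1 : s - t = c ^ 2)
    (h2 : s + t = d ^ 2) : t % 4 = 0 ∧ c % 2 = 1 ∧ d % 2 = 1 := by
  rcases Int.emod_two_eq_zero_or_one c with hc | hc <;>
  rcases Int.emod_two_eq_zero_or_one d with hd | hd
  · have := Int.sq_emod_four_of_even hc
    have := Int.sq_emod_four_of_even hd
    omega
  · have := Int.sq_emod_four_of_even hc
    have := Int.sq_emod_four_of_odd hd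
    omega
  · have := Int.sq_emod_four_of_odd hc
    have := Int.sq_emod_four_of_even hd
    omega
  · have := Int.sq_emod_four_of_odd hc
    have := Int.sq_emod_four_of_odd hd
    omega

theorem exists_coprime_of_sq_sub_sq {c d e : ℤ} (hcd : IsCoprime c d) (hc : 0 ≤ c) (hd : 0 ≤ d)
    (hc2 : c % 2 = 1) (hd2 : d % 2 = 1) (he : 0 < e) (h : d ^ 2 - c ^ 2 = 4 * e) :
    ∃ u v : ℤ, 0 < u ∧ 0 < v ∧ IsCoprime u v ∧ c = v - u ∧ d = u + v ∧ u * v = e := by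
  obtain ⟨u, hu⟩ : ∃ u, d - c = 2 * u := ⟨(d - c) / 2, by omega⟩
  obtain ⟨v, hv⟩ : ∃ v, d + c = 2 * v := ⟨(d + c) / 2, by omega⟩
  obtain rfl : d = u + v := by omega
  obtain rfl : c = v - u := by omega
  have huv : u * v = e := by linarith
  have hv0 : 0 < v := by omega
  refine ⟨u, v, pos_of_mul_pos_left (huv ▸ he) hv0.le, hv0, ?_, rfl, rfl, huv⟩
  obtain ⟨x, y, hxy⟩ := hcd
  exact ⟨y - x, x + y, by linear_combination hxy⟩

theorem no_two_sums {a b c d : ℤ} (hcd : IsCoprime c d) (hpar : (a + b) % 2 = 1) (hb : b ≠ 0)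
    (hc : 0 ≤ c) (hd : 0 ≤ d)
    (h1 : 241 * a ^ 2 - b ^ 2 = c ^ 2) (h2 : 241 * a ^ 2 + b ^ 2 = d ^ 2) : False := by
  have hpar4 := sq_emod_four_add_of_odd_add hpar
  obtain ⟨hb4, hc2, hd2⟩ := emod_of_sq_sub_of_sq_add (by omega) h1 h2
  have hbe : b % 2 = 0 := by
    by_contra hbo
    have := Int.sq_emod_four_of_odd (a := b) (by omega)
    omega
  obtain ⟨w, rfl⟩ := Int.dvd_of_emod_eq_zero hbe
  have hw : w ≠ 0 := by rintro rfl; exact hb rfl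
  obtain ⟨u, v, hu0, hv0, hcop, rfl, rfl, huv⟩ :=
    exists_coprime_of_sq_sub_sq (e := 2 * w ^ 2) hcd hc hd hc2 hd2 (by positivity) (by linarith)
  have hsum : u ^ 2 + v ^ 2 = 241 * a ^ 2 := by linarith
  have finish : ∀ {e f : ℤ}, IsCoprime (2 * e ^ 2) (f ^ 2) →
      f ^ 4 + 4 * e ^ 4 = 241 * a ^ 2 → False := by
    intro e f hef h
    have hef' : IsCoprime (2 * e ^ 2) f := (IsCoprime.pow_right_iff two_pos).1 hef
    exact quartic_add_four_ne (hef'.symm.of_isCoprime_of_dvd_right ⟨e, by ring⟩) h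
  rcases Int.exists_sq_or_prime_mul_sq_of_mul_eq Int.prime_two two_pos hu0 hv0 hcop huv with
    ⟨e, f, -, -, rfl, rfl⟩ | ⟨f, e, -, -, rfl, rfl⟩
  · exact finish hcop (by linear_combination hsum)
  · exact finish hcop.symm (by linear_combination hsum)

/-- Three squares in arithmetic progression with difference `241 b²` come from a smaller
solution of `m n (m - n) (m + n) = 241 k²`. -/
theorem exists_smaller_of_squares {a b c d : ℤ} (hcd : IsCoprime c d)
    (hpar : (a + b) % 2 = 1) (ha : 0 < a) (hb : b ≠ 0) (hc : 0 ≤ c) (hd : 0 ≤ d)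
    (h1 : a ^ 2 - 241 * b ^ 2 = c ^ 2) (h2 : a ^ 2 + 241 * b ^ 2 = d ^ 2) :
    ∃ m n k : ℤ, 0 < n ∧ n < m ∧ m < a ∧ IsCoprime m n ∧ (m + n) % 2 = 1 ∧
      m * n * ((m - n) * (m + n)) = 241 * k ^ 2 := by
  have hpar4 := sq_emod_four_add_of_odd_add hpar
  obtain ⟨hb4, hc2, hd2⟩ := emod_of_sq_sub_of_sq_add (by omega) h1 h2
  have hbe : b % 2 = 0 := by
    by_contra hbo
    have := Int.sq_emod_four_of_odd (a := b) (by omega)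
    omega
  obtain ⟨w, rfl⟩ := Int.dvd_of_emod_eq_zero hbe
  have hw : w ≠ 0 := by rintro rfl; exact hb rfl
  obtain ⟨u, v, hu0, hv0, hcop, rfl, rfl, huv⟩ :=
    exists_coprime_of_sq_sub_sq (e := 2 * 241 * w ^ 2) hcd hc hd hc2 hd2 (by positivity) (by linarith)
  have hsum : u ^ 2 + v ^ 2 = a ^ 2 := by linarith
  have finish : ∀ {u v : ℤ}, 0 < u → 0 < v → IsCoprime u v → u ^ 2 + v ^ 2 = a ^ 2 →
      u * v = 2 * 241 * w ^ 2 → u % 2 = 1 →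
      ∃ m n k : ℤ, 0 < n ∧ n < m ∧ m < a ∧ IsCoprime m n ∧ (m + n) % 2 = 1 ∧
        m * n * ((m - n) * (m + n)) = 241 * k ^ 2 := by
    intro u v hu hv hcop hsum huv hodd
    obtain ⟨m, n, rfl, rfl, rfl, hmn, hmn2, hm⟩ :=
      pythagorean_parametrization hsum hcop hodd ha
    have hm0 : 0 < m := by
      rcases hm.eq_or_lt with h | h
      · rw [← h] at hv; simp at hv
      · exact h
    have hn0 : 0 < n := by
      have : 0 < 2 * m := by omega
      exact pos_of_mul_pos_right hv this.le
    exact ⟨m, n, w, hn0, by nlinarith, by nlinarith, hmn, hmn2, by linarith⟩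
  rcases Int.emod_two_eq_zero_or_one u with h | h
  · exact finish hv0 hu0 hcop.symm (by linarith) (by linarith) (by omega)
  · exact finish hu0 hv0 hcop hsum huv h

theorem no_coprime_opposite_parity {r s k : ℤ} (hs : 0 < s) (hsr : s < r) (hrs : IsCoprime r s)
    (hpar : (r + s) % 2 = 1) (h : r * s * ((r - s) * (r + s)) = 241 * k ^ 2) : False := by
  induction hN : r.toNat using Nat.strong_induction_on generalizing r s k with
  | _ N ih =>
  subst hN
  have hr : 0 < r := hs.trans hsr
  have hminus : IsCoprime r (r - s) := by
    obtain ⟨x, y, hxy⟩ := hrs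
    exact ⟨x + y, -y, by linear_combination hxy⟩
  have hplus : IsCoprime r (r + s) := by
    obtain ⟨x, y, hxy⟩ := hrs
    exact ⟨x - y, y, by linear_combination hxy⟩
  have hminus' : IsCoprime s (r - s) := by
    obtain ⟨x, y, hxy⟩ := hrs
    exact ⟨x + y, x, by linear_combination hxy⟩
  have hplus' : IsCoprime s (r + s) := by
    obtain ⟨x, y, hxy⟩ := hrs
    exact ⟨y - x, x, by linear_combination hxy⟩
  have hpm : IsCoprime (r - s) (r + s) := by
    have h2 : IsCoprime (r - s) 2 := ⟨1, -((r - s) / 2), by omega⟩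
    obtain ⟨x, y, hxy⟩ := h2.mul_right hminus.symm
    exact ⟨x + y, y, by linear_combination hxy⟩
  have hd0 : 0 < r - s := by omega
  have hs0 : 0 < r + s := by omega
  have sq_case : ∀ {a b c : ℤ}, 0 < a → 0 < b → IsCoprime a b → a * b = c ^ 2 →
      ∃ s t : ℤ, 0 ≤ s ∧ 0 ≤ t ∧ a = s ^ 2 ∧ b = t ^ 2 := by
    intro a b c ha hb hab habc
    obtain ⟨s, hs, h1⟩ := Int.exists_nonneg_sq_of_mul_eq ha hab habc
    obtain ⟨t, ht, h2⟩ := Int.exists_nonneg_sq_of_mul_eq hb hab.symm (by rw [mul_comm, habc])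
    exact ⟨s, t, hs, ht, h1, h2⟩
  have p0 : (0 : ℤ) < 241 := by norm_num
  have par : ∀ a : ℤ, a ^ 2 % 2 = a % 2 := by
    intro a
    rcases Int.emod_two_eq_zero_or_one a with h | h
    · have := Int.sq_emod_four_of_even h; omega
    · have := Int.sq_emod_four_of_odd h; omega
  rcases Int.exists_sq_or_prime_mul_sq_of_mul_eq Int.prime_241 p0 (mul_pos hr hs)
    (mul_pos hd0 hs0) ((hminus.mul_right hplus).mul_left (hminus'.mul_right hplus')) h with
    ⟨x, y, -, -, h1, h2⟩ | ⟨x, y, -, -, h1, h2⟩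
  · obtain ⟨c, d, hc, hd, hc', hd'⟩ := sq_case hd0 hs0 hpm h2
    have hcd : IsCoprime c d := by
      rw [hc', hd'] at hpm
      exact (IsCoprime.pow_iff two_pos two_pos).1 hpm
    rcases Int.exists_sq_or_prime_mul_sq_of_mul_eq Int.prime_241 p0 hr hs hrs h1 with
      ⟨a, b, ha, hb, rfl, rfl⟩ | ⟨a, b, ha, hb, rfl, rfl⟩
    · have hb0 : b ≠ 0 := by rintro rfl; simp at hs
      have := par a
      have := par b
      exact no_two_sums hcd (by omega) hb0 hc hd hc' hd'
    · have hb0 : b ≠ 0 := by rintro rfl; simp at hs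
      have ha0 : 0 < a := lt_of_le_of_ne ha (by rintro rfl; simp at hr)
      have := par a
      have := par b
      obtain ⟨m, n, l, hn, hnm, hma, hmn, hmn2, hmnl⟩ :=
        exists_smaller_of_squares hcd (by omega) ha0 hb0 hc hd hc' hd'
      have : a ≤ a ^ 2 := by nlinarith
      exact ih m.toNat (by omega) hn hnm hmn hmn2 hmnl rfl
  · obtain ⟨a, b, ha, hb, rfl, rfl⟩ := sq_case hr hs hrs h1
    have hab : IsCoprime a b := (IsCoprime.pow_iff two_pos two_pos).1 hrs
    have ha0 : 0 < a := lt_of_le_of_ne ha (by rintro rfl; simp at hr)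
    have := par a
    have := par b
    rcases Int.exists_sq_or_prime_mul_sq_of_mul_eq Int.prime_241 p0 hd0 hs0 hpm h2 with
      ⟨c, d, hc, hd, hc', hd'⟩ | ⟨c, d, hc, hd, hc', hd'⟩
    · exact no_sq_add_sq_sub hab (by omega)
        (lt_of_le_of_ne hd (by rintro rfl; simp at hd'; omega)) hd' hc'
    · rw [hc'] at hminus'
      exact no_sq_sub_sq_add ((IsCoprime.pow_iff two_pos two_pos).1 hminus').symm (by omega) ha0
        hc' hd'

/-- There are no nontrivial integer solutions of `r s (r - s) (r + s) = 241 k²`. -/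
theorem no_nontrivial_solution {r s k : ℤ} (hk : k ≠ 0)
    (h : r * s * ((r - s) * (r + s)) = 241 * k ^ 2) : False := by
  have coprime_case : ∀ {r s k : ℤ}, k ≠ 0 → IsCoprime r s → 0 < s → s < r →
      r * s * ((r - s) * (r + s)) = 241 * k ^ 2 → False := by
    intro r s k hk hrs hs hsr h
    rcases Int.emod_two_eq_zero_or_one (r + s) with hpar | hpar
    · obtain ⟨a, ha⟩ : ∃ a, r + s = 2 * a := ⟨(r + s) / 2, by omega⟩
      obtain ⟨b, hb⟩ : ∃ b, r - s = 2 * b := ⟨(r - s) / 2, by omega⟩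
      obtain rfl : r = a + b := by omega
      obtain rfl : s = a - b := by omega
      have hk2 : k % 2 = 0 := by
        by_contra hk2
        have := Int.sq_emod_four_of_odd (a := k) (by omega)
        have : 4 * ((a + b) * (a - b) * (a * b)) = 241 * k ^ 2 := by rw [← h]; ring
        omega
      obtain ⟨l, rfl⟩ := Int.dvd_of_emod_eq_zero hk2
      have hab : IsCoprime a b := by
        obtain ⟨x, y, hxy⟩ := hrs
        exact ⟨x + y, x - y, by linear_combination hxy⟩
      have hodd : (a + b) % 2 = 1 := by
        by_contra hne
        have h1 : (2 : ℤ) ∣ a + b := by omega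
        have h2 : (2 : ℤ) ∣ a - b := by omega
        exact Int.prime_two.not_isUnit (hrs.isUnit_of_dvd' h1 h2)
      exact no_coprime_opposite_parity (k := l) (by omega : 0 < b) (by omega : b < a) hab hodd
        (by linarith)
    · exact no_coprime_opposite_parity hs hsr hrs hpar h
  have pos_case : ∀ {r s k : ℤ}, k ≠ 0 → 0 < s → s < r →
      r * s * ((r - s) * (r + s)) = 241 * k ^ 2 → False := by
    intro r s k hk hs hsr h
    have hg : 0 < Int.gcd r s := Int.gcd_pos_of_ne_zero_right r hs.ne'
    obtain ⟨r', s', hcop, hr', hs'⟩ := Int.exists_gcd_one hg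
    set g : ℤ := (Int.gcd r s : ℤ)
    have hg0 : 0 < g := Int.natCast_pos.2 hg
    rw [hr', hs'] at h hsr
    rw [hs'] at hs
    have hk' : 241 * (r' * s' * ((r' - s') * (r' + s'))) * (g ^ 2) ^ 2 = (241 * k) ^ 2 := by
      linear_combination 241 * h
    obtain ⟨j, hj⟩ : g ^ 2 ∣ 241 * k := (Int.pow_dvd_pow_iff two_ne_zero).1 (Dvd.intro_left _ hk')
    have hj2 : 241 * (r' * s' * ((r' - s') * (r' + s'))) = j ^ 2 := by
      apply mul_right_cancel₀ (pow_ne_zero 2 (pow_ne_zero 2 hg0.ne'))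
      rw [hk', hj]
      ring
    obtain ⟨l, rfl⟩ := Int.prime_241.dvd_of_dvd_pow (Dvd.intro _ hj2)
    refine coprime_case (k := l) ?_ (Int.isCoprime_iff_gcd_eq_one.2 hcop)
      (pos_of_mul_pos_left hs hg0.le) (lt_of_mul_lt_mul_right hsr hg0.le) (by linarith)
    rintro rfl
    simp [hk] at hj
  have hpos : 0 < r * s * ((r - s) * (r + s)) := by rw [h]; positivity
  have pos_left : ∀ {r s : ℤ}, 0 < r → r * s * ((r - s) * (r + s)) = 241 * k ^ 2 → False := by
    intro r s hr h
    have hpos : 0 < r * s * ((r - s) * (r + s)) := by rw [h]; positivity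
    rcases lt_trichotomy s 0 with hs | rfl | hs
    · have hlt : r < -s := by
        by_contra hle
        have : 0 ≤ (r - s) * (r + s) := mul_nonneg (by omega) (by omega)
        have : r * s < 0 := mul_neg_of_pos_of_neg hr hs
        nlinarith
      exact pos_case (r := -s) (s := r) hk hr hlt (by rw [← h]; ring)
    · simp at hpos
    · have hlt : s < r := by
        by_contra hle
        have : (r - s) * (r + s) ≤ 0 := mul_nonpos_of_nonpos_of_nonneg (by omega) (by omega)
        have : 0 < r * s := mul_pos hr hs
        nlinarith
      exact pos_case hk hs hlt h
  rcases lt_trichotomy r 0 with hr | rfl | hr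
  · exact pos_left (r := -r) (s := -s) (by omega) (by rw [← h]; ring)
  · simp at hpos
  · exact pos_left hr h

/-- Every rational point on the elliptic curve `E₁ : y² = x(x + 241)(x + 482)` has `y = 0`;
equivalently, `E₁(ℚ) ≅ ℤ/2ℤ × ℤ/2ℤ` consists only of the 2-torsion points. -/
theorem rational_points_E1 (x y : ℚ) (h : y ^ 2 = x * (x + 241) * (x + 482)) : y = 0 := by
  by_contra hy
  set X := x + 241 with hX
  have hd : (X.den : ℚ) ≠ 0 := by exact_mod_cast X.den_ne_zero
  have hnum : X * X.den = X.num := Rat.mul_den_eq_num X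
  have hx : x = X - 241 := by rw [hX]; ring
  have hsq : (y * (X.den : ℚ) ^ 2) ^ 2 =
      ((X.den * X.num * ((X.num - 241 * X.den) * (X.num + 241 * X.den)) : ℤ) : ℚ) := by
    push_cast
    rw [mul_pow, h, hx, ← hnum]
    ring
  obtain ⟨k, hk⟩ : ∃ k : ℤ, y * (X.den : ℚ) ^ 2 = k := by
    have hsq' : IsSquare (((X.den * X.num * ((X.num - 241 * X.den) * (X.num + 241 * X.den)) : ℤ)) : ℚ) :=
      ⟨_, by rw [← hsq, sq]⟩
    obtain ⟨l, hl⟩ := Rat.isSquare_intCast_iff.1 hsq'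
    rw [hl] at hsq
    push_cast at hsq
    rw [← sq] at hsq
    rcases sq_eq_sq_iff_eq_or_eq_neg.1 hsq with h1 | h1
    · exact ⟨l, h1⟩
    · exact ⟨-l, by rw [h1]; push_cast; rfl⟩
  rw [hk] at hsq
  have hsqZ : k ^ 2 = X.den * X.num * ((X.num - 241 * X.den) * (X.num + 241 * X.den)) := by
    exact_mod_cast hsq
  have hk0 : k ≠ 0 := by
    rintro rfl
    have : y * (X.den : ℚ) ^ 2 ≠ 0 := by positivity
    exact this (by simpa using hk)
  exact no_nontrivial_solution (r := X.num) (s := 241 * X.den) hk0 (by rw [hsqZ]; ring)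
end
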